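/- For all positive integers k and ℓ there exists μ = μ(k,ℓ) > 0 with the following property: if g, h ∈ ℤ[x] are nonzero intersective polynomials with deg(g) = k and deg(h) = ℓ, then there exist constants c, C > 0 such that for every integer N ≥ 2 and every set A ⊆ {1,…,N} satisfying a − a' ≠ g(m) + h(n) for all distinct pairs a, a' ∈ A and all integers m, n ≥ 1, one has |A| ≤ C · N · exp(−c·(log N)^{μ}). -/

import Mathlib

/-- A nonzero polynomial `h ∈ ℤ[x]` is *intersective* if for every positive integer `q`
there is a positive integer `n` with `q ∣ h(n)`. -/
def Intersective (h : Polynomial ℤ) : Prop :=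
  h ≠ 0 ∧ ∀ q : ℕ, 0 < q → ∃ n : ℕ, 0 < n ∧ (q : ℤ) ∣ h.eval (n : ℤ)

open scoped BigOperators

/-- The additive character `x ↦ exp (2 π i x)`. -/
noncomputable def ee (x : ℝ) : ℂ := Complex.exp ((2 * Real.pi * x : ℝ) * Complex.I)

lemma ee_add (x y : ℝ) : ee (x + y) = ee x * ee y := by
  unfold ee
  rw [← Complex.exp_add]
  congr 1
  push_cast
  ring

lemma ee_zero : ee 0 = 1 := by simp [ee]

lemma norm_ee (x : ℝ) : ‖ee x‖ = 1 := Complex.norm_exp_ofReal_mul_I _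

lemma ee_int (n : ℤ) : ee n = 1 := by
  unfold ee
  rw [Complex.exp_eq_one_iff]
  exact ⟨n, by push_cast; ring⟩

lemma ee_neg (x : ℝ) : ee (-x) = (starRingEnd ℂ) (ee x) := by
  unfold ee
  rw [← Complex.exp_conj, map_mul, Complex.conj_I, Complex.conj_ofReal]
  congr 1
  push_cast
  ring

lemma ee_sub (x y : ℝ) : ee (x - y) = ee x * (starRingEnd ℂ) (ee y) := by
  rw [sub_eq_add_neg, ee_add, ee_neg]

lemma ee_add_int (x : ℝ) (n : ℤ) : ee (x + n) = ee x := by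
  rw [ee_add, ee_int, mul_one]

lemma ee_sub_int (x : ℝ) (n : ℤ) : ee (x - n) = ee x := by
  rw [← ee_add_int (x - n) n, sub_add_cancel]

lemma norm_ee_sub_one_le (x : ℝ) : ‖ee x - 1‖ ≤ 7 * |x| := by
  unfold ee
  have := Real.norm_exp_I_mul_ofReal_sub_one_le (x := 2 * Real.pi * x)
  rw [mul_comm Complex.I] at this
  refine this.trans ?_
  rw [Real.norm_eq_abs, abs_mul, abs_of_pos Real.two_pi_pos]
  have := Real.pi_lt_d2
  gcongr
  linarith

lemma ee_nat_mul (n : ℕ) (x : ℝ) : ee (n * x) = ee x ^ n := by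
  unfold ee
  rw [← Complex.exp_nat_mul]
  congr 1
  push_cast
  ring

lemma norm_sum_ee_le {ι : Type*} (s : Finset ι) (f : ι → ℝ) :
    ‖∑ x ∈ s, ee (f x)‖ ≤ s.card := by
  refine (norm_sum_le _ _).trans ?_
  simp [norm_ee]

lemma four_mul_abs_le_norm_ee_sub_one {x : ℝ} (hx : |x| ≤ 1 / 2) : 4 * |x| ≤ ‖ee x - 1‖ := by
  unfold ee
  have h1 := Complex.norm_exp_I_mul_ofReal_sub_one (2 * Real.pi * x)
  rw [mul_comm Complex.I] at h1
  rw [h1, Real.norm_eq_abs, abs_mul, abs_two]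
  have h2 : 2 * Real.pi * x / 2 = Real.pi * x := by ring
  rw [h2]
  have h3 : |Real.pi * x| ≤ Real.pi / 2 := by
    rw [abs_mul, abs_of_pos Real.pi_pos]
    have := Real.pi_pos
    nlinarith
  have h4 := Real.mul_abs_le_abs_sin h3
  rw [abs_mul, abs_of_pos Real.pi_pos] at h4
  have h5 : 2 / Real.pi * (Real.pi * |x|) = 2 * |x| := by
    field_simp
  linarith

lemma norm_geom_ee_mul_le (n : ℕ) (x : ℝ) :
    ‖∑ j ∈ Finset.range n, ee (j * x)‖ * ‖ee x - 1‖ ≤ 2 := by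
  rw [← norm_mul]
  simp_rw [ee_nat_mul]
  rw [geom_sum_mul]
  refine (norm_sub_le _ _).trans ?_
  rw [norm_pow, norm_ee]
  norm_num

lemma norm_geom_ee_mul_abs_le (n : ℕ) (x : ℝ) :
    ‖∑ j ∈ Finset.range n, ee (j * x)‖ * |x - round x| ≤ 1 / 2 := by
  have h1 := norm_geom_ee_mul_le n x
  have h2 : ee x = ee (x - round x) := (ee_sub_int _ _).symm
  have h3 := four_mul_abs_le_norm_ee_sub_one (abs_sub_round x)
  rw [← h2] at h3
  have := mul_le_mul_of_nonneg_left h3 (norm_nonneg (∑ j ∈ Finset.range n, ee (j * x)))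
  linarith

/-- Orthogonality of additive characters modulo `N`. -/
lemma sum_ee_div {N : ℕ} (hN : 0 < N) (n : ℤ) :
    ∑ ξ ∈ Finset.range N, ee (ξ * (n / N : ℝ)) = if (N : ℤ) ∣ n then (N : ℂ) else 0 := by
  have hN' : (N : ℝ) ≠ 0 := by positivity
  split_ifs with h
  · obtain ⟨m, rfl⟩ := h
    have : ∀ ξ ∈ Finset.range N, ee (ξ * (((N * m : ℤ) : ℝ) / N)) = 1 := by
      intro ξ _
      have h2 : (ξ * (((N * m : ℤ) : ℝ) / N) : ℝ) = ((ξ * m : ℤ) : ℝ) := by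
        push_cast
        field_simp
      rw [h2, ee_int]
    rw [Finset.sum_congr rfl this]
    simp
  · simp_rw [ee_nat_mul]
    have hne : ee (n / N : ℝ) ≠ 1 := by
      intro h1
      unfold ee at h1
      rw [Complex.exp_eq_one_iff] at h1
      obtain ⟨m, hm⟩ := h1
      apply h
      refine ⟨m, ?_⟩
      have h3 : ((2 * Real.pi * (n / N) : ℝ) : ℂ) = ((m * (2 * Real.pi) : ℝ) : ℂ) := by
        have hI := Complex.I_ne_zero
        apply mul_right_cancel₀ hI
        rw [hm]
        push_cast
        ring
      have h4 := Complex.ofReal_injective h3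
      have h5 : (n : ℝ) = N * m := by
        have := Real.pi_pos
        field_simp at h4
        linarith
      exact_mod_cast h5
    have h2 := geom_sum_mul (ee (n / N : ℝ)) N
    have h3 : ee (n / N : ℝ) ^ N = 1 := by
      rw [← ee_nat_mul]
      have : (N * (n / N) : ℝ) = ((n : ℤ) : ℝ) := by field_simp
      rw [this, ee_int]
    rw [h3, sub_self] at h2
    exact (mul_eq_zero.mp h2).resolve_right (sub_ne_zero.mpr hne)

/-- Vinogradov's lemma: if `α h` is close to an integer for many `h < M`, then `α` is close to
a rational of small height. -/
lemma vinogradov {M : ℕ} {K ε α : ℝ} (hK : 1 ≤ K) (hM : 2 * K ≤ M) (hε0 : 0 ≤ ε)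
    (hε : ε * (24 * K) ≤ 1) (H : Finset ℕ) (hHM : ∀ h ∈ H, h < M) (hcard : M ≤ H.card * K)
    (hH : ∀ h ∈ H, ∃ n : ℤ, |α * h - n| ≤ ε) :
    ∃ b : ℕ, 1 ≤ b ∧ (b : ℝ) ≤ 12 * K ∧ ∃ a : ℤ, |b * α - a| * M ≤ 24 * K ^ 2 * ε := by
  have hMpos : (0 : ℝ) < M := by linarith
  have hM0 : 0 < M := by exact_mod_cast hMpos
  obtain ⟨q, hq1, hq2⟩ := Real.exists_rat_abs_sub_le_and_den_le α (n := 2 * M) (by omega)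
  have hb0 : 0 < q.den := q.den_pos
  have hbR : (0 : ℝ) < q.den := by exact_mod_cast hb0
  have hqe : (q : ℝ) = q.num / q.den := by exact_mod_cast (Rat.num_div_den q).symm
  obtain ⟨b, hb⟩ : ∃ b, b = q.den := ⟨_, rfl⟩
  obtain ⟨a, ha⟩ : ∃ a, a = q.num := ⟨_, rfl⟩
  have hcop : IsCoprime (a : ℤ) (b : ℤ) := by
    rw [ha, hb, Int.isCoprime_iff_gcd_eq_one]
    exact q.reduced
  rw [← hb] at hb0 hbR hq1 hq2 hqe
  rw [← ha] at hqe
  set τ : ℝ := α - a / b with hτ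
  have hτ1 : |τ| * (2 * M * b) ≤ 1 := by
    rw [hqe] at hq1
    push_cast at hq1
    rw [le_div_iff₀ (by positivity)] at hq1
    have : |τ| * (2 * M * b) ≤ |τ| * ((2 * M + 1) * b) := by gcongr; linarith
    linarith
  choose! I hI using hH
  have hα : α * b = a + τ * b := by rw [hτ]; field_simp; ring
  -- the integer `a h - b I h` is small
  have key : ∀ h ∈ H, |((a * h - b * I h : ℤ) : ℝ)| < ε * b + 1 / 2 := by
    intro h hh
    have h1 : ((a * h - b * I h : ℤ) : ℝ) = b * (α * h - I h) - τ * b * h := by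
      push_cast
      linear_combination (-(h : ℝ)) * hα
    rw [h1]
    have h2 : |τ * b * h| < 1 / 2 := by
      rw [abs_mul, abs_mul, Nat.abs_cast, Nat.abs_cast]
      have hhM : (h : ℝ) < M := by exact_mod_cast hHM h hh
      rcases eq_or_lt_of_le (abs_nonneg τ) with h0 | h0
      · rw [← h0]; norm_num
      · have : |τ| * b * h < |τ| * b * M := by gcongr
        linarith
    calc _ ≤ |b * (α * h - I h)| + |τ * b * h| := abs_sub _ _
      _ < b * ε + 1 / 2 := by
        rw [abs_mul, Nat.abs_cast]
        have := mul_le_mul_of_nonneg_left (hI h hh) hbR.le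
        linarith
      _ = _ := by ring
  set L : ℕ := ⌊ε * b + 1 / 2⌋₊ with hL
  have hLle : (L : ℝ) ≤ ε * b + 1 / 2 := Nat.floor_le (by positivity)
  have key2 : ∀ h ∈ H, (a * h - b * I h) ∈ Finset.Icc (-(L : ℤ)) L := by
    intro h hh
    have h1 := (key h hh).le
    have h2 : (a * h - b * I h).natAbs ≤ L := by
      apply Nat.le_floor
      rwa [Nat.cast_natAbs, Int.cast_abs]
    rw [Finset.mem_Icc]
    omega
  have hcardH : H.card ≤ (M / b + 1) * (2 * L + 1) := by
    have h1 : H.card ≤ ((Finset.range (M / b + 1)) ×ˢ (Finset.Icc (-(L : ℤ)) L)).card := by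
      apply Finset.card_le_card_of_injOn (fun h => (h / b, a * h - b * I h))
      · intro h hh
        rw [Finset.mem_coe, Finset.mem_product]
        refine ⟨?_, key2 h hh⟩
        rw [Finset.mem_range]
        exact Nat.lt_succ_of_le (Nat.div_le_div_right (hHM h hh).le)
      · intro h hh h' hh' heq
        simp only [Prod.mk.injEq] at heq
        obtain ⟨e1, e2⟩ := heq
        have h3 : (b : ℤ) ∣ a * (h - h') := ⟨I h - I h', by linarith⟩
        have h4 : (b : ℤ) ∣ (h - h' : ℤ) := hcop.symm.dvd_of_dvd_mul_left h3
        have h5 : h % b = h' % b := by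
          have : (h' : ℤ) ≡ h [ZMOD b] := (Int.modEq_iff_dvd).mpr h4
          exact ((Int.natCast_modEq_iff).mp this).symm
        rw [← Nat.div_add_mod h b, ← Nat.div_add_mod h' b, e1, h5]
    refine h1.trans (le_of_eq ?_)
    rw [Finset.card_product, Finset.card_range, Int.card_Icc]
    congr 1
    omega
  have hbM : (b : ℝ) ≤ 2 * M := by exact_mod_cast hq2
  have hcard2 : (b : ℝ) ≤ 3 * K * (2 * L + 1) := by
    have h1 : (H.card : ℝ) ≤ (M / b + 1) * (2 * L + 1) := by
      have h2 : (H.card : ℝ) ≤ ((M / b : ℕ) + 1) * (2 * L + 1) := by exact_mod_cast hcardH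
      have h3 : ((M / b : ℕ) : ℝ) ≤ M / b := Nat.cast_div_le
      refine h2.trans ?_
      gcongr
    have h4 : (M / b + 1 : ℝ) * b ≤ 3 * M := by
      field_simp
      linarith
    have h5 : (M : ℝ) * b ≤ 3 * M * (2 * L + 1) * K := by
      calc (M : ℝ) * b ≤ (H.card * K) * b := by gcongr
        _ ≤ ((M / b + 1) * (2 * L + 1) * K) * b := by gcongr
        _ = ((M / b + 1) * b) * (2 * L + 1) * K := by ring
        _ ≤ 3 * M * (2 * L + 1) * K := by gcongr
    nlinarith
  have hL0 : L = 0 := by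
    by_contra hne
    have h1 : (1 : ℝ) ≤ L := by exact_mod_cast Nat.one_le_iff_ne_zero.mpr hne
    have h2 : (b : ℝ) ≤ 3 * K * (6 * (ε * b)) := by
      refine hcard2.trans ?_
      gcongr
      linarith
    have h3 : 3 * K * (6 * (ε * b)) = (ε * (24 * K)) * (3 / 4 * b) := by ring
    rw [h3] at h2
    have h4 : (ε * (24 * K)) * (3 / 4 * b) ≤ 1 * (3 / 4 * b) := by gcongr
    linarith
  rw [hL0] at hcard2 key2
  have hb3 : (b : ℝ) ≤ 3 * K := by simpa using hcard2
  have hτh : ∀ h ∈ H, |τ| * h ≤ ε := by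
    intro h hh
    have h1 : a * h - b * I h = 0 := by
      have := key2 h hh
      simpa using this
    have h2 : α * h - I h = τ * h := by
      have h3 : (a : ℝ) * h - b * I h = 0 := by exact_mod_cast h1
      have h4 : b * (α * h - I h) = b * (τ * h) := by
        linear_combination (h : ℝ) * hα + h3
      exact mul_left_cancel₀ hbR.ne' h4
    have h5 := hI h hh
    rwa [h2, abs_mul, Nat.abs_cast] at h5
  refine ⟨b, hb0, by linarith, a, ?_⟩
  -- a large element of `H`
  obtain ⟨h, hh, hbig⟩ : ∃ h ∈ H, H.card ≤ h + 1 := by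
    by_contra hcon
    push Not at hcon
    have hne : 0 < H.card := by
      rw [Nat.pos_iff_ne_zero]
      intro h0
      rw [h0] at hcard
      simp at hcard
      omega
    have hsub : H ⊆ Finset.range (H.card - 1) := by
      intro h hh
      have := hcon h hh
      rw [Finset.mem_range]
      omega
    have := Finset.card_le_card hsub
    rw [Finset.card_range] at this
    omega
  have h1 : (M : ℝ) ≤ 2 * K * h := by
    have h2 : (H.card : ℝ) ≤ h + 1 := by exact_mod_cast hbig
    have h3 : (M : ℝ) ≤ (h + 1) * K := hcard.trans (by gcongr)
    linarith
  have h2 : b * α - a = b * τ := by linarith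
  rw [h2, abs_mul, Nat.abs_cast]
  calc b * |τ| * M ≤ (3 * K) * |τ| * (2 * K * h) := by gcongr
    _ = 6 * K ^ 2 * (|τ| * h) := by ring
    _ ≤ 6 * K ^ 2 * ε := by gcongr; exact hτh h hh
    _ ≤ 24 * K ^ 2 * ε := by gcongr; norm_num

open Finset in
lemma weyl_differencing (p : ℕ → ℝ) (M : ℕ) :
    ‖∑ x ∈ range M, ee (p x)‖ ^ 2 ≤
      2 * ∑ h ∈ range M, ‖∑ y ∈ range (M - h), ee (p (y + h) - p y)‖ := by
  have h1 : ∀ M : ℕ, ‖∑ x ∈ range M, ee (p x)‖ ^ 2 + M =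
      2 * (∑ x ∈ range M, ∑ y ∈ range (x + 1), ee (p x - p y)).re := by
    intro M
    induction M with
    | zero => simp
    | succ M ih =>
      have h2 : ∑ y ∈ range (M + 1), ee (p M - p y) =
          ee (p M) * (starRingEnd ℂ) (∑ y ∈ range M, ee (p y)) + 1 := by
        rw [sum_range_succ, sub_self, ee_zero, map_sum, mul_sum]
        simp_rw [ee_sub]
      rw [sum_range_succ, sum_range_succ (fun x => ∑ y ∈ range (x + 1), ee (p x - p y)), h2]
      set S := ∑ x ∈ range M, ee (p x)
      have h3 : ‖S + ee (p M)‖ ^ 2 = ‖S‖ ^ 2 + 1 + 2 * (ee (p M) * (starRingEnd ℂ) S).re := by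
        have h4 := Complex.normSq_add (ee (p M)) S
        simp only [Complex.normSq_eq_norm_sq, norm_ee] at h4
        rw [add_comm S, h4]
        ring
      rw [h3]
      push_cast
      simp only [Complex.add_re, Complex.one_re] at ih ⊢
      linarith
  have h2 : ∑ x ∈ range M, ∑ y ∈ range (x + 1), ee (p x - p y) =
      ∑ h ∈ range M, ∑ y ∈ range (M - h), ee (p (y + h) - p y) := by
    rw [← sum_range_diag_flip M (fun h y => ee (p (y + h) - p y))]
    refine sum_congr rfl fun x _ => ?_
    rw [← sum_range_reflect]
    refine sum_congr rfl fun j hj => ?_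
    rw [mem_range] at hj
    have e1 : x + 1 - 1 - j = x - j := by omega
    have e2 : x - j + j = x := by omega
    rw [e1, e2]
  have h3 := h1 M
  rw [h2] at h3
  have h4 := Complex.re_le_norm (∑ h ∈ range M, ∑ y ∈ range (M - h), ee (p (y + h) - p y))
  have h5 := norm_sum_le (range M) (fun h => ∑ y ∈ range (M - h), ee (p (y + h) - p y))
  have h6 : (0 : ℝ) ≤ M := by positivity
  linarith

/-- The inverse Weyl statement in degree `n` with exponent `E`: a polynomial phase with a large
exponential sum has all its nonconstant coefficients close to rationals with a common small
denominator. -/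
def WeylInverse (n E : ℕ) : Prop :=
  ∀ P : Polynomial ℝ, P.natDegree ≤ n → ∀ R : ℝ, 2 ≤ R → ∀ M : ℕ, 0 < M →
    M ≤ R * ‖∑ x ∈ Finset.range M, ee (P.eval (x : ℝ))‖ →
    ∃ b : ℕ, 1 ≤ b ∧ (b : ℝ) ≤ R ^ E ∧
      ∀ j, 1 ≤ j → ∃ a : ℤ, |b * P.coeff j - a| * (M : ℝ) ^ j ≤ R ^ E

lemma weylInverse_one : WeylInverse 1 1 := by
  intro P hP R hR M hM hS
  refine ⟨1, le_rfl, by rw [pow_one]; push_cast; linarith, fun j hj => ?_⟩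
  rcases Nat.lt_or_ge 1 j with hj1 | hj1
  · refine ⟨0, ?_⟩
    rw [Polynomial.coeff_eq_zero_of_natDegree_lt (by omega)]
    simp
    linarith
  · have hj' : j = 1 := le_antisymm hj1 hj
    subst hj'
    refine ⟨round (P.coeff 1), ?_⟩
    have h1 : ∀ x ∈ Finset.range M, ee (P.eval (x : ℝ)) = ee (P.coeff 0) * ee (x * P.coeff 1) := by
      intro x _
      rw [← ee_add]
      congr 1
      rw [Polynomial.eval_eq_sum_range' (n := 2) (by omega)]
      simp [Finset.sum_range_succ]
      ring
    rw [Finset.sum_congr rfl h1, ← Finset.mul_sum, norm_mul, norm_ee, one_mul] at hS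
    have h2 := norm_geom_ee_mul_abs_le M (P.coeff 1)
    simp only [Nat.cast_one, one_mul, pow_one]
    calc |P.coeff 1 - round (P.coeff 1)| * M
        ≤ |P.coeff 1 - round (P.coeff 1)| *
          (R * ‖∑ x ∈ Finset.range M, ee (x * P.coeff 1)‖) := by gcongr
      _ = R * (‖∑ x ∈ Finset.range M, ee (x * P.coeff 1)‖ *
          |P.coeff 1 - round (P.coeff 1)|) := by ring
      _ ≤ R * (1 / 2) := by gcongr
      _ ≤ R := by linarith

lemma natCast_le_pow_of_two_le {R : ℝ} (hR : 2 ≤ R) (n : ℕ) : (n : ℝ) ≤ R ^ n := by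
  have h1 : (n : ℝ) ≤ 2 ^ n := by exact_mod_cast n.lt_two_pow_self.le
  exact h1.trans (by gcongr)

/-- If `f` takes values in `[1, B]` on `H`, some fibre has at least `|H| / B` elements. -/
lemma exists_large_fiber (H : Finset ℕ) (hne : H.Nonempty) (f : ℕ → ℕ) (B : ℝ)
    (hf : ∀ h ∈ H, 1 ≤ f h ∧ (f h : ℝ) ≤ B) :
    ∃ b : ℕ, 1 ≤ b ∧ (b : ℝ) ≤ B ∧ (H.card : ℝ) ≤ (H.filter (fun h => f h = b)).card * B := by
  obtain ⟨h0, hh0⟩ := hne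
  have hB : 1 ≤ B := le_trans (by exact_mod_cast (hf h0 hh0).1) (hf h0 hh0).2
  have hmaps : ∀ h ∈ H, f h ∈ Finset.Icc 1 ⌊B⌋₊ := by
    intro h hh
    rw [Finset.mem_Icc]
    exact ⟨(hf h hh).1, Nat.le_floor (hf h hh).2⟩
  have hfl : (⌊B⌋₊ : ℝ) ≤ B := Nat.floor_le (by linarith)
  have hfp : 0 < ⌊B⌋₊ := Nat.floor_pos.mpr hB
  obtain ⟨b, hb, hb2⟩ := Finset.exists_le_card_fiber_of_nsmul_le_card_of_maps_to (s := H)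
    (t := Finset.Icc 1 ⌊B⌋₊) (f := f) (b := (H.card : ℝ) / ⌊B⌋₊) hmaps ⟨f h0, hmaps h0 hh0⟩ (by
      rw [Nat.card_Icc, Nat.add_sub_cancel, nsmul_eq_mul]
      have : (0 : ℝ) < ⌊B⌋₊ := by exact_mod_cast hfp
      rw [mul_div_cancel₀ _ this.ne'])
  rw [Finset.mem_Icc] at hb
  refine ⟨b, hb.1, le_trans (by exact_mod_cast hb.2) hfl, ?_⟩
  have : (0 : ℝ) < ⌊B⌋₊ := by exact_mod_cast hfp
  rw [div_le_iff₀ this] at hb2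
  exact hb2.trans (by gcongr)

/-- Either `M` is at most a power of `R`, or the conclusion of Weyl's inequality is trivial. -/
lemma coeff_bound_of_small {R : ℝ} {M e j : ℕ} (hM : (M : ℝ) ≤ R ^ e) (α : ℝ) :
    |α - round α| * (M : ℝ) ^ j ≤ R ^ (e * j) := by
  have h1 : |α - round α| ≤ 1 := (abs_sub_round α).trans (by norm_num)
  calc |α - round α| * (M : ℝ) ^ j ≤ 1 * (R ^ e) ^ j := by gcongr
    _ = R ^ (e * j) := by rw [one_mul, ← pow_mul]

open Polynomial in
lemma natDegree_taylor_sub_le {P : Polynomial ℝ} {n : ℕ} (hP : P.natDegree ≤ n + 1) (h : ℝ) :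
    (taylor h P - P).natDegree ≤ n := by
  rw [natDegree_le_iff_coeff_eq_zero]
  intro N hN
  rw [coeff_sub]
  rcases Nat.lt_or_ge (n + 1) N with h1 | h1
  · rw [coeff_eq_zero_of_natDegree_lt (by rw [natDegree_taylor]; omega),
      coeff_eq_zero_of_natDegree_lt (by omega), sub_zero]
  · have hNn : N = n + 1 := by omega
    subst hNn
    rw [taylor_coeff, hasseDeriv_apply, sum_over_range' _ (by simp) (n + 2) (by omega),
      Finset.sum_range_succ, Finset.sum_eq_zero]
    · simp
    · intro i hi
      rw [Finset.mem_range] at hi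
      rw [Nat.choose_eq_zero_of_lt hi]
      simp

open Polynomial in
lemma coeff_taylor_sub {P : Polynomial ℝ} {n : ℕ} (hP : P.natDegree ≤ n + 1) (h : ℝ) :
    (taylor h P - P).coeff n = (n + 1 : ℕ) * h * P.coeff (n + 1) := by
  rw [coeff_sub, taylor_coeff, hasseDeriv_apply, sum_over_range' _ (by simp) (n + 2) (by omega),
    Finset.sum_range_succ, Finset.sum_range_succ, Finset.sum_eq_zero]
  · simp
    ring
  · intro i hi
    rw [Finset.mem_range] at hi
    rw [Nat.choose_eq_zero_of_lt hi]
    simp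

open Finset in
lemma weylInverse_leading {n E1 : ℕ} (ih : WeylInverse (n + 1) E1) :
    ∃ E : ℕ, ∀ P : Polynomial ℝ, P.natDegree ≤ n + 2 → ∀ R : ℝ, 2 ≤ R → ∀ M : ℕ, 0 < M →
      M ≤ R * ‖∑ x ∈ range M, ee (P.eval (x : ℝ))‖ →
      ∃ b : ℕ, 1 ≤ b ∧ (b : ℝ) ≤ R ^ E ∧
        ∃ a : ℤ, |b * P.coeff (n + 2) - a| * (M : ℝ) ^ (n + 2) ≤ R ^ E := by
  set e3 : ℕ := 5 + 4 * (2 * E1 + n + 2) with he3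
  refine ⟨e3 * (n + 2) + (4 + 4 * (E1 + 1) + 4 * E1 + (n + 2)) +
    (5 + 4 * (2 * (E1 + 1)) + 4 * (E1 + n + 1)), ?_⟩
  intro P hP R hR M hM hS
  have hR1' : 1 ≤ R := by linarith
  have hmono : ∀ {i j : ℕ}, i ≤ j → R ^ i ≤ R ^ j := fun h => pow_le_pow_right₀ hR1' h
  set R1 : ℝ := 4 * R ^ 2 with hR1
  have hR1le : R1 ≤ R ^ 4 := by rw [hR1]; nlinarith [sq_nonneg (R ^ 2), pow_le_pow_left₀ (by norm_num : (0:ℝ) ≤ 2) hR 2]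
  have hR12 : 2 ≤ R1 := by rw [hR1]; nlinarith
  have hR1pos : 0 < R1 := by linarith
  have hR1one : 1 ≤ R1 := by linarith
  have hR1pow : ∀ i, R1 ^ i ≤ R ^ (4 * i) := fun i => by
    rw [pow_mul]; gcongr
  by_cases hMsmall : (M : ℝ) ≤ 24 * R1 ^ (2 * E1 + n + 2)
  · refine ⟨1, le_rfl, ?_, round (P.coeff (n + 2)), ?_⟩
    · simpa using one_le_pow₀ hR1'
    · have h1 : (M : ℝ) ≤ R ^ e3 := by
        refine hMsmall.trans ?_
        rw [he3, pow_add R]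
        have : (24 : ℝ) ≤ R ^ 5 := by
          calc (24 : ℝ) ≤ 2 ^ 5 := by norm_num
            _ ≤ R ^ 5 := by gcongr
        have := hR1pow (2 * E1 + n + 2)
        gcongr
      have := coeff_bound_of_small h1 (j := n + 2) (P.coeff (n + 2))
      simp only [Nat.cast_one, one_mul]
      exact this.trans (hmono (by omega))
  · push Not at hMsmall
    have hMR : (0 : ℝ) < M := by exact_mod_cast hM
    -- many good differences
    set S : ℕ → ℝ := fun h => ‖∑ y ∈ range (M - h), ee (P.eval ((y + h : ℕ) : ℝ) - P.eval (y : ℝ))‖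
      with hSdef
    have hSle : ∀ h, S h ≤ (M - h : ℕ) := by
      intro h
      have := norm_sum_ee_le (range (M - h)) (fun y => P.eval ((y + h : ℕ) : ℝ) - P.eval (y : ℝ))
      rwa [card_range] at this
    have hdiff := weyl_differencing (fun x => P.eval (x : ℝ)) M
    set H := (range M).filter (fun h => (M : ℝ) ≤ R1 * S h) with hH
    have hHcard : (M : ℝ) ≤ H.card * R1 := by
      have h1 : ∑ h ∈ range M, S h ≤ H.card * M + M * (M / R1) := by
        rw [← sum_filter_add_sum_filter_not (range M) (fun h => (M : ℝ) ≤ R1 * S h)]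
        apply add_le_add
        · refine (sum_le_card_nsmul _ _ (M : ℝ) fun h _ => ?_).trans (by rw [nsmul_eq_mul])
          exact (hSle h).trans (by exact_mod_cast Nat.sub_le M h)
        · refine (sum_le_card_nsmul _ _ ((M : ℝ) / R1) fun h hh => ?_).trans ?_
          · rw [mem_filter] at hh
            rw [le_div_iff₀ hR1pos]
            linarith [hh.2]
          · rw [nsmul_eq_mul]
            gcongr
            exact (card_filter_le _ _).trans (by rw [card_range])
      have h2 : (M : ℝ) ^ 2 ≤ R ^ 2 * (2 * (H.card * M + M * (M / R1))) := by
        calc (M : ℝ) ^ 2 ≤ (R * ‖∑ x ∈ range M, ee (P.eval (x : ℝ))‖) ^ 2 := by gcongr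
          _ = R ^ 2 * ‖∑ x ∈ range M, ee (P.eval (x : ℝ))‖ ^ 2 := by ring
          _ ≤ R ^ 2 * (2 * (H.card * M + M * (M / R1))) := by
            have hdiff' : ‖∑ x ∈ range M, ee (P.eval (x : ℝ))‖ ^ 2 ≤ 2 * ∑ h ∈ range M, S h := hdiff
            have : 2 * ∑ h ∈ range M, S h ≤ 2 * (H.card * M + M * (M / R1)) := by linarith
            exact mul_le_mul_of_nonneg_left (hdiff'.trans this) (by positivity)
      have h3 : R ^ 2 * (2 * (M * (M / R1))) = (M : ℝ) ^ 2 / 2 := by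
        rw [hR1]
        field_simp
        norm_num
      have h4 : (M : ℝ) ^ 2 ≤ M * (H.card * R1) := by
        rw [hR1]
        nlinarith
      nlinarith
    have hHne : H.Nonempty := by
      rw [← card_pos, Nat.pos_iff_ne_zero]
      intro h0
      rw [h0] at hHcard
      simp at hHcard
      omega
    -- apply the induction hypothesis to each good difference
    have hgood : ∀ h ∈ H, ∃ b : ℕ, (1 ≤ b ∧ (b : ℝ) ≤ R1 ^ E1) ∧ ∃ a : ℤ,
        |b * ((n + 2 : ℕ) * h * P.coeff (n + 2)) - a| ≤ R1 ^ (E1 + n + 1) / M ^ (n + 1) := by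
      intro h hh
      rw [hH, mem_filter, mem_range] at hh
      obtain ⟨hhM, hh2⟩ := hh
      have h1 : (M : ℝ) ≤ R1 * (M - h : ℕ) := hh2.trans (by gcongr; exact hSle h)
      have h2 : ((M - h : ℕ) : ℝ) ≤ M := by exact_mod_cast Nat.sub_le M h
      obtain ⟨b, hb1, hb2, hb3⟩ := ih (Polynomial.taylor (h : ℝ) P - P)
        (natDegree_taylor_sub_le hP h) R1 hR12 (M - h) (by omega) (by
          refine h2.trans (hh2.trans (le_of_eq ?_))
          rw [hSdef]
          simp only
          congr 3
          funext y
          congr 1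
          rw [Polynomial.eval_sub, Polynomial.taylor_eval]
          push_cast
          rfl)
      refine ⟨b, ⟨hb1, hb2⟩, ?_⟩
      obtain ⟨a, ha⟩ := hb3 (n + 1) (by omega)
      refine ⟨a, ?_⟩
      rw [coeff_taylor_sub hP] at ha
      rw [le_div_iff₀ (by positivity)]
      calc _ ≤ |b * ((n + 1 + 1 : ℕ) * h * P.coeff (n + 1 + 1)) - a| *
            (R1 * (M - h : ℕ)) ^ (n + 1) := by gcongr
        _ = (|b * ((n + 1 + 1 : ℕ) * h * P.coeff (n + 1 + 1)) - a| *
            ((M - h : ℕ) : ℝ) ^ (n + 1)) * R1 ^ (n + 1) := by rw [mul_pow]; ring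
        _ ≤ R1 ^ E1 * R1 ^ (n + 1) := by gcongr
        _ = R1 ^ (E1 + n + 1) := by rw [← pow_add]; rfl
    choose! f hf1 hf2 using hgood
    obtain ⟨bs, hbs1, hbs2, hbs3⟩ := exists_large_fiber H hHne f (R1 ^ E1) hf1
    set K2 : ℝ := R1 ^ (E1 + 1) with hK2
    have hK21 : 1 ≤ K2 := one_le_pow₀ hR1one
    have hMn : (M : ℝ) ≤ M ^ (n + 1) := le_self_pow₀ (by exact_mod_cast hM) (by omega)
    obtain ⟨b, hb1, hb2, a, ha⟩ := vinogradov (M := M) (K := K2)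
      (ε := R1 ^ (E1 + n + 1) / M ^ (n + 1)) (α := bs * ((n + 2 : ℕ) * P.coeff (n + 2))) hK21
      (by
        refine le_trans ?_ hMsmall.le
        have : K2 ≤ R1 ^ (2 * E1 + n + 2) := pow_le_pow_right₀ hR1one (by omega)
        linarith)
      (by positivity)
      (by
        rw [div_mul_eq_mul_div, div_le_one (by positivity)]
        refine le_trans (le_of_eq ?_) (hMsmall.le.trans hMn)
        rw [hK2]
        ring)
      (H.filter (fun h => f h = bs))
      (by
        intro h hh
        rw [mem_filter, hH, mem_filter, mem_range] at hh
        exact hh.1.1)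
      (by
        calc (M : ℝ) ≤ H.card * R1 := hHcard
          _ ≤ ((H.filter (fun h => f h = bs)).card * R1 ^ E1) * R1 := by gcongr
          _ = _ := by rw [hK2]; ring)
      (by
        intro h hh
        rw [mem_filter] at hh
        obtain ⟨a, ha⟩ := hf2 h hh.1
        refine ⟨a, ?_⟩
        rw [hh.2] at ha
        refine le_trans (le_of_eq ?_) ha
        congr 1
        ring)
    have hK2le : K2 ≤ R ^ (4 * (E1 + 1)) := hR1pow _
    refine ⟨b * bs * (n + 2), ?_, ?_, a, ?_⟩
    · exact Nat.one_le_iff_ne_zero.mpr (by positivity)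
    · push_cast
      have h12 : (12 : ℝ) ≤ R ^ 4 := by
        calc (12 : ℝ) ≤ 2 ^ 4 := by norm_num
          _ ≤ R ^ 4 := by gcongr
      have hn := natCast_le_pow_of_two_le hR (n + 2)
      push_cast at hn
      have hE := hR1pow E1
      calc (b : ℝ) * bs * (n + 2) ≤ (R ^ 4 * R ^ (4 * (E1 + 1))) * R ^ (4 * E1) * R ^ (n + 2) := by
            gcongr
            · exact hb2.trans (by gcongr)
            · exact hbs2.trans hE
        _ = R ^ (4 + 4 * (E1 + 1) + 4 * E1 + (n + 2)) := by ring
        _ ≤ _ := hmono (by omega)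
    · have h1 : ((b * bs * (n + 2) : ℕ) : ℝ) * P.coeff (n + 2) - a =
          b * (bs * ((n + 2 : ℕ) * P.coeff (n + 2))) - a := by push_cast; ring
      rw [h1]
      have h24 : (24 : ℝ) ≤ R ^ 5 := by
        calc (24 : ℝ) ≤ 2 ^ 5 := by norm_num
          _ ≤ R ^ 5 := by gcongr
      calc _ = (|b * (bs * ((n + 2 : ℕ) * P.coeff (n + 2))) - a| * M) * (M : ℝ) ^ (n + 1) := by
            ring
        _ ≤ (24 * K2 ^ 2 * (R1 ^ (E1 + n + 1) / M ^ (n + 1))) * (M : ℝ) ^ (n + 1) := by gcongr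
        _ = 24 * R1 ^ (2 * (E1 + 1)) * R1 ^ (E1 + n + 1) := by
            rw [hK2]; field_simp; ring
        _ ≤ R ^ 5 * R ^ (4 * (2 * (E1 + 1))) * R ^ (4 * (E1 + n + 1)) := by
            gcongr
            · exact hR1pow _
            · exact hR1pow _
        _ = R ^ (5 + 4 * (2 * (E1 + 1)) + 4 * (E1 + n + 1)) := by ring
        _ ≤ _ := hmono (by omega)

open Finset in
lemma norm_sum_shift_sub_le (f : ℕ → ℂ) (hf : ∀ x, ‖f x‖ ≤ 1) (M t : ℕ) :
    ‖∑ x ∈ range M, f x - ∑ x ∈ range M, f (x + t)‖ ≤ 2 * t := by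
  have h1 : ∑ x ∈ range M, f x + ∑ x ∈ range t, f (M + x) =
      ∑ x ∈ range t, f x + ∑ x ∈ range M, f (x + t) := by
    rw [← sum_range_add f M t, add_comm M t, sum_range_add f t M]
    simp_rw [add_comm t]
  have h2 : ∑ x ∈ range M, f x - ∑ x ∈ range M, f (x + t) =
      ∑ x ∈ range t, f x - ∑ x ∈ range t, f (M + x) := by
    linear_combination h1
  have h3 : ∀ g : ℕ → ℂ, (∀ x, ‖g x‖ ≤ 1) → ‖∑ x ∈ range t, g x‖ ≤ t := by
    intro g hg
    refine (norm_sum_le_of_le _ fun x _ => hg x).trans ?_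
    simp
  rw [h2]
  refine (norm_sub_le _ _).trans ?_
  have := h3 f hf
  have := h3 (fun x => f (M + x)) (fun x => hf _)
  linarith

open Finset in
lemma exists_large_progression_sum (f : ℕ → ℂ) (hf : ∀ x, ‖f x‖ ≤ 1) {M : ℕ} (hM : 0 < M)
    (b l : ℕ) : ∃ x0 < M, l * ‖∑ x ∈ range M, f x‖ ≤
      M * ‖∑ z ∈ range l, f (x0 + b * z)‖ + 2 * b * l ^ 2 := by
  obtain ⟨x0, hx0, hmax⟩ := exists_max_image (range M)
    (fun x => ‖∑ z ∈ range l, f (x + b * z)‖) ⟨0, mem_range.mpr hM⟩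
  refine ⟨x0, mem_range.mp hx0, ?_⟩
  have h1 : l * ‖∑ x ∈ range M, f x‖ = ‖∑ z ∈ range l, ∑ x ∈ range M, f x‖ := by
    simp
  have h2 : ∑ z ∈ range l, ∑ x ∈ range M, f x =
      ∑ x ∈ range M, ∑ z ∈ range l, f (x + b * z) +
        ∑ z ∈ range l, (∑ x ∈ range M, f x - ∑ x ∈ range M, f (x + b * z)) := by
    rw [sum_comm (s := range M) (t := range l), ← sum_add_distrib]
    simp
  rw [h1, h2]
  refine (norm_add_le _ _).trans (add_le_add ?_ ?_)
  · refine (norm_sum_le_of_le _ hmax).trans ?_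
    simp
  · calc _ ≤ ∑ z ∈ range l, (2 * b * l : ℝ) := by
          refine norm_sum_le_of_le _ fun z hz => ?_
          refine (norm_sum_shift_sub_le f hf M (b * z)).trans ?_
          have : (z : ℝ) ≤ l := by exact_mod_cast (mem_range.mp hz).le
          push_cast
          rw [← mul_assoc]
          gcongr
      _ = _ := by simp; ring

/-- Removing the leading term along a suitable progression. -/
lemma norm_ee_leading_sub_le {α R : ℝ} {M l b0 x0 k : ℕ} {a0 : ℤ} (hM : 0 < M)
    (hx0 : x0 ≤ M) (hbl : b0 * l ≤ M) (hα : |b0 * α - a0| * (M : ℝ) ^ (k + 1) ≤ R)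
    {z : ℕ} (hz : z ≤ l) :
    ‖ee (α * ((x0 + b0 * z : ℕ) : ℝ) ^ (k + 1) - α * (x0 : ℝ) ^ (k + 1)) - 1‖ * M ≤
      7 * (R * l * ((k + 1) * 2 ^ k)) := by
  set V : ℕ := ∑ i ∈ Finset.range (k + 1), (x0 + b0 * z) ^ i * x0 ^ (k - i) with hV
  have h1 : (V : ℤ) * (b0 * z) = ((x0 + b0 * z : ℕ) : ℤ) ^ (k + 1) - (x0 : ℤ) ^ (k + 1) := by
    have h := (Commute.all ((x0 + b0 * z : ℕ) : ℤ) (x0 : ℤ)).geom_sum₂_mul (k + 1)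
    rw [← h, hV]
    push_cast
    congr 1
    ring
  have h1R : (V : ℝ) * (b0 * z) = ((x0 + b0 * z : ℕ) : ℝ) ^ (k + 1) - (x0 : ℝ) ^ (k + 1) := by
    exact_mod_cast h1
  have h2 : α * ((x0 + b0 * z : ℕ) : ℝ) ^ (k + 1) - α * (x0 : ℝ) ^ (k + 1) =
      (b0 * α - a0) * (z * V) + ((a0 * (z * V) : ℤ) : ℝ) := by
    rw [← mul_sub, ← h1R]
    push_cast
    ring
  rw [h2, ee_add_int]
  have hbz : b0 * z ≤ M := (Nat.mul_le_mul_left _ hz).trans hbl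
  have hVle : (V : ℝ) ≤ (k + 1) * (2 ^ k * (M : ℝ) ^ k) := by
    have : V ≤ (k + 1) * (2 ^ k * M ^ k) := by
      rw [hV]
      refine (Finset.sum_le_card_nsmul _ _ (2 ^ k * M ^ k) fun i hi => ?_).trans (by simp)
      rw [Finset.mem_range] at hi
      calc (x0 + b0 * z) ^ i * x0 ^ (k - i) ≤ (2 * M) ^ i * (2 * M) ^ (k - i) := by
            gcongr
            · omega
            · omega
        _ = (2 * M) ^ k := by rw [← pow_add]; congr 1; omega
        _ = _ := by rw [mul_pow]
    exact_mod_cast this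
  have hzl : (z : ℝ) ≤ l := by exact_mod_cast hz
  calc _ ≤ 7 * |(b0 * α - a0) * (z * V)| * M := by gcongr; exact norm_ee_sub_one_le _
    _ = 7 * (|b0 * α - a0| * M) * (z * V) := by
      rw [abs_mul, abs_of_nonneg (by positivity : (0 : ℝ) ≤ z * V)]; ring
    _ ≤ 7 * (|b0 * α - a0| * M) * (l * ((k + 1) * (2 ^ k * (M : ℝ) ^ k))) := by gcongr
    _ = 7 * ((|b0 * α - a0| * (M : ℝ) ^ (k + 1)) * l * ((k + 1) * 2 ^ k)) := by ring
    _ ≤ _ := by gcongr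

open Polynomial in
/-- Recovering the coefficients of `Q` from those of `Q (x0 + b0 X)`. -/
lemma coeff_of_comp {Q : ℝ[X]} {n : ℕ} (hQ : Q.natDegree ≤ n) {b0 x0 : ℝ} (hb0 : b0 ≠ 0) (j : ℕ) :
    b0 ^ (n + 1) * Q.coeff j = ∑ i ∈ Finset.range (n + 1),
      (Q.comp (C b0 * X + C x0)).coeff i * b0 ^ (n + 1 - i) * ((-x0) ^ (i - j) * i.choose j) := by
  set Q1 := Q.comp (C b0 * X + C x0) with hQ1
  have hdeg : Q1.natDegree < n + 1 := by
    have h1 := natDegree_comp_le (p := Q) (q := C b0 * X + C x0)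
    have h2 : (C b0 * X + C x0 : ℝ[X]).natDegree ≤ 1 := natDegree_linear_le
    have : Q.natDegree * (C b0 * X + C x0 : ℝ[X]).natDegree ≤ n * 1 := Nat.mul_le_mul hQ h2
    rw [hQ1]
    omega
  have h1 : Q = Q1.comp (C b0⁻¹ * (X + C (-x0))) := by
    rw [hQ1, comp_assoc]
    have : (C b0 * X + C x0 : ℝ[X]).comp (C b0⁻¹ * (X + C (-x0))) = X := by
      simp only [add_comp, mul_comp, C_comp, X_comp]
      rw [← mul_assoc, ← C_mul, mul_inv_cancel₀ hb0]
      simp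
    rw [this, comp_X]
  have h2 : Q.coeff j = ∑ i ∈ Finset.range (n + 1),
      Q1.coeff i * (b0⁻¹ ^ i * ((-x0) ^ (i - j) * i.choose j)) := by
    conv_lhs => rw [h1]
    rw [comp, eval₂_eq_sum_range' _ hdeg, finsetSum_coeff]
    refine Finset.sum_congr rfl fun i _ => ?_
    rw [mul_pow, ← C_pow, coeff_C_mul, coeff_C_mul, coeff_X_add_C_pow]
  rw [h2, Finset.mul_sum]
  refine Finset.sum_congr rfl fun i hi => ?_
  rw [Finset.mem_range] at hi
  have h3 : b0 ^ (n + 1) * b0⁻¹ ^ i = b0 ^ (n + 1 - i) := by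
    rw [inv_pow, ← div_eq_mul_inv, div_eq_iff (pow_ne_zero _ hb0), ← pow_add]
    congr 1
    omega
  rw [← h3]
  ring

open Finset in
lemma weylInverse_succ {n E1 : ℕ} (ih : WeylInverse (n + 1) E1) :
    ∃ E, WeylInverse (n + 2) E := by
  obtain ⟨E0, hlead⟩ := weylInverse_leading ih
  set E2 : ℕ := E0 + 1 + 5 + (n + 2) + (n + 1) with hE2
  refine ⟨E2 * (n + 2) + (E0 * (n + 2) + 3 * E1) +
    ((n + 2) + (3 * E1 + (E2 + 1) * (n + 2) + E0 * (n + 2) + (n + 2))), ?_⟩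
  intro P hP R hR M hM hS
  have hR1 : 1 ≤ R := by linarith
  have hR0 : 0 < R := by linarith
  have hmono : ∀ {i j : ℕ}, i ≤ j → R ^ i ≤ R ^ j := fun h => pow_le_pow_right₀ hR1 h
  have hMR : (0 : ℝ) < M := by exact_mod_cast hM
  rcases Nat.eq_zero_or_pos ⌊(M : ℝ) / R ^ E2⌋₊ with hl0 | hlpos
  · rw [Nat.floor_eq_zero, div_lt_one (by positivity)] at hl0
    refine ⟨1, le_rfl, by simpa using one_le_pow₀ hR1, fun j hj => ?_⟩
    rcases Nat.lt_or_ge (n + 2) j with hj1 | hj1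
    · refine ⟨0, ?_⟩
      rw [Polynomial.coeff_eq_zero_of_natDegree_lt (by omega)]
      simp only [mul_zero, Int.cast_zero, sub_zero, abs_zero, zero_mul]
      positivity
    · refine ⟨round (P.coeff j), ?_⟩
      simp only [Nat.cast_one, one_mul]
      refine (coeff_bound_of_small hl0.le (P.coeff j)).trans (hmono ?_)
      have := Nat.mul_le_mul_left E2 hj1
      omega
  obtain ⟨l, hl⟩ : ∃ l, l = ⌊(M : ℝ) / R ^ E2⌋₊ := ⟨_, rfl⟩
  rw [← hl] at hlpos
  have hlR : (1 : ℝ) ≤ l := by exact_mod_cast hlpos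
  have hlM : l * R ^ E2 ≤ M := by
    rw [← le_div_iff₀ (by positivity), hl]
    exact Nat.floor_le (by positivity)
  have hMl : (M : ℝ) ≤ 2 * R ^ E2 * l := by
    have h1 := Nat.lt_floor_add_one ((M : ℝ) / R ^ E2)
    rw [← hl, div_lt_iff₀ (by positivity)] at h1
    have : (l + 1) * R ^ E2 ≤ (2 * l) * R ^ E2 := by gcongr; linarith
    linarith
  obtain ⟨b0, hb01, hb02, a0, ha0⟩ := hlead P hP R hR M hM hS
  have hb0pos : (0 : ℝ) < b0 := by exact_mod_cast hb01
  set K : ℝ := (n + 2 : ℕ) * 2 ^ (n + 1) with hK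
  have hK1 : 1 ≤ K := by
    rw [hK]
    have : (1 : ℝ) ≤ 2 ^ (n + 1) := one_le_pow₀ (by norm_num)
    have : (1 : ℝ) ≤ (n + 2 : ℕ) := by exact_mod_cast (by omega : 1 ≤ n + 2)
    nlinarith
  have hKE : R ^ E0 * R * 32 * K ≤ R ^ E2 := by
    rw [hE2, pow_add, pow_add, pow_add, pow_add, pow_one, hK, ← mul_assoc]
    have h32 : (32 : ℝ) ≤ R ^ 5 := by
      calc (32 : ℝ) = 2 ^ 5 := by norm_num
        _ ≤ R ^ 5 := by gcongr
    have := natCast_le_pow_of_two_le hR (n + 2)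
    gcongr
  have hlK : R ^ E0 * R * 32 * K * l ≤ M := by
    calc _ ≤ R ^ E2 * l := by gcongr
      _ ≤ M := by linarith
  have hb0l : 4 * R * (b0 * l) ≤ M := by
    calc 4 * R * (b0 * l) ≤ 4 * R * (R ^ E0 * l) := by gcongr
      _ ≤ (R ^ E0 * R * l) * (32 * K) := by
        have : 0 ≤ R ^ E0 * R * l := by positivity
        nlinarith
      _ ≤ M := by linarith
  have hb0lM : b0 * l ≤ M := by
    have : (b0 * l : ℝ) ≤ M := by
      have : (0 : ℝ) ≤ b0 * l := by positivity
      nlinarith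
    exact_mod_cast this
  -- pass to a progression of step `b0`
  obtain ⟨x0, hx0, hprog⟩ := exists_large_progression_sum (fun x => ee (P.eval (x : ℝ)))
    (fun x => (norm_ee _).le) hM b0 l
  set T := ‖∑ z ∈ range l, ee (P.eval ((x0 + b0 * z : ℕ) : ℝ))‖ with hT
  have hTl : (l : ℝ) ≤ 2 * (R * T) := by
    have h1 : (l : ℝ) * M ≤ R * (M * T + 2 * b0 * l ^ 2) := by
      calc (l : ℝ) * M ≤ l * (R * ‖∑ x ∈ range M, ee (P.eval (x : ℝ))‖) := by gcongr
        _ = R * (l * ‖∑ x ∈ range M, ee (P.eval (x : ℝ))‖) := by ring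
        _ ≤ _ := by gcongr
    have h2 : R * (2 * b0 * l ^ 2) ≤ l * M / 2 := by
      calc R * (2 * b0 * l ^ 2) = l * (4 * R * (b0 * l)) / 2 := by ring
        _ ≤ l * M / 2 := by gcongr
    have h3 : M * (l : ℝ) ≤ M * (2 * (R * T)) := by linarith
    exact le_of_mul_le_mul_left h3 hMR
  -- remove the leading coefficient
  set α := P.coeff (n + 2) with hα
  set Q : Polynomial ℝ := P - Polynomial.C α * Polynomial.X ^ (n + 2) with hQ
  have hQdeg : Q.natDegree ≤ n + 1 := by
    rw [Polynomial.natDegree_le_iff_coeff_eq_zero]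
    intro N hN
    rw [hQ, Polynomial.coeff_sub, Polynomial.coeff_C_mul, Polynomial.coeff_X_pow]
    split_ifs with h
    · rw [h, hα]; ring
    · rw [Polynomial.coeff_eq_zero_of_natDegree_lt (by omega)]; ring
  have hPQ : ∀ x : ℝ, P.eval x = α * x ^ (n + 2) + Q.eval x := by
    intro x
    rw [hQ]
    simp
  set T' := ‖∑ z ∈ range l, ee (Q.eval ((x0 + b0 * z : ℕ) : ℝ))‖ with hT'
  have hTT' : T ≤ T' + l / (4 * R) := by
    have h1 : T = ‖∑ z ∈ range l, ee (α * ((x0 + b0 * z : ℕ) : ℝ) ^ (n + 2) -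
        α * (x0 : ℝ) ^ (n + 2)) * ee (Q.eval ((x0 + b0 * z : ℕ) : ℝ))‖ := by
      rw [hT, ← one_mul ‖∑ z ∈ range l, ee (α * _ - _) * _‖, ← norm_ee (α * (x0 : ℝ) ^ (n + 2)),
        ← norm_mul, mul_sum]
      congr 1
      refine sum_congr rfl fun z _ => ?_
      rw [← ee_add, ← ee_add, hPQ]
      congr 1
      ring
    have h2 : ∑ z ∈ range l, ee (α * ((x0 + b0 * z : ℕ) : ℝ) ^ (n + 2) -
        α * (x0 : ℝ) ^ (n + 2)) * ee (Q.eval ((x0 + b0 * z : ℕ) : ℝ)) =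
        ∑ z ∈ range l, ee (Q.eval ((x0 + b0 * z : ℕ) : ℝ)) + ∑ z ∈ range l,
          (ee (α * ((x0 + b0 * z : ℕ) : ℝ) ^ (n + 2) - α * (x0 : ℝ) ^ (n + 2)) - 1) *
            ee (Q.eval ((x0 + b0 * z : ℕ) : ℝ)) := by
      rw [← sum_add_distrib]
      exact sum_congr rfl fun z _ => by ring
    rw [h1, h2]
    refine (norm_add_le _ _).trans (add_le_add le_rfl ?_)
    have h3 : ∀ z ∈ range l, ‖(ee (α * ((x0 + b0 * z : ℕ) : ℝ) ^ (n + 2) -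
        α * (x0 : ℝ) ^ (n + 2)) - 1) * ee (Q.eval ((x0 + b0 * z : ℕ) : ℝ))‖ ≤ 1 / (4 * R) := by
      intro z hz
      rw [norm_mul, norm_ee, mul_one]
      have h4 := norm_ee_leading_sub_le (k := n + 1) hM hx0.le hb0lM ha0 (mem_range.mp hz).le
      rw [le_div_iff₀ (by positivity)]
      have h5 : 7 * (R ^ E0 * l * (((n + 1 : ℕ) + 1) * 2 ^ (n + 1))) * (4 * R) ≤ 1 * M := by
        have : 7 * (R ^ E0 * l * (((n + 1 : ℕ) + 1) * 2 ^ (n + 1))) * (4 * R) =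
            (R ^ E0 * R * K * l) * 28 := by
          rw [hK]; push_cast; ring
        rw [this]
        have : 0 ≤ R ^ E0 * R * K * l := by positivity
        nlinarith
      have h6 : ‖ee (α * ((x0 + b0 * z : ℕ) : ℝ) ^ (n + 2) - α * (x0 : ℝ) ^ (n + 2)) - 1‖ *
          (4 * R) * M ≤ 1 * M := by
        refine le_trans ?_ h5
        calc _ = (‖ee (α * ((x0 + b0 * z : ℕ) : ℝ) ^ (n + 2) - α * (x0 : ℝ) ^ (n + 2)) - 1‖ * M) *
              (4 * R) := by ring
          _ ≤ _ := by gcongr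
      exact le_of_mul_le_mul_right h6 hMR
    refine (norm_sum_le_of_le _ h3).trans ?_
    rw [sum_const, card_range, nsmul_eq_mul, mul_one_div]
  have hT'l : (l : ℝ) ≤ 4 * R * T' := by
    have h1 : 2 * (R * (l / (4 * R))) = (l : ℝ) / 2 := by field_simp; ring
    have h2 : 2 * (R * T) ≤ 2 * (R * (T' + l / (4 * R))) := by gcongr
    linarith
  obtain ⟨b1, hb11, hb12, hb13⟩ := ih (Q.comp (Polynomial.C (b0 : ℝ) * Polynomial.X +
      Polynomial.C (x0 : ℝ))) (by
        have h1 := Polynomial.natDegree_comp_le (p := Q)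
          (q := Polynomial.C (b0 : ℝ) * Polynomial.X + Polynomial.C (x0 : ℝ))
        have h2 : (Polynomial.C (b0 : ℝ) * Polynomial.X + Polynomial.C (x0 : ℝ)).natDegree ≤ 1 :=
          Polynomial.natDegree_linear_le
        have := Nat.mul_le_mul hQdeg h2
        omega) (4 * R) (by linarith) l hlpos (by
      refine hT'l.trans (le_of_eq ?_)
      rw [hT']
      congr 2
      refine sum_congr rfl fun z _ => ?_
      congr 1
      simp
      congr 1
      ring)
  have h4R : (4 * R) ^ E1 ≤ R ^ (3 * E1) := by
    rw [pow_mul]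
    gcongr
    nlinarith [mul_self_nonneg (R - 2), mul_pos hR0 hR0]
  have hbE : ((b0 ^ (n + 2) * b1 : ℕ) : ℝ) ≤ R ^ (E0 * (n + 2) + 3 * E1) := by
    push_cast
    rw [pow_add R, pow_mul]
    gcongr
    exact hb12.trans h4R
  refine ⟨b0 ^ (n + 2) * b1, Nat.one_le_iff_ne_zero.mpr (by positivity),
    hbE.trans (hmono (by omega)), fun j hj => ?_⟩
  rcases Nat.lt_or_ge (n + 2) j with hj1 | hj1
  · refine ⟨0, ?_⟩
    rw [Polynomial.coeff_eq_zero_of_natDegree_lt (by omega)]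
    simp only [mul_zero, Int.cast_zero, sub_zero, abs_zero, zero_mul]
    positivity
  rcases Nat.eq_or_lt_of_le hj1 with hj2 | hj2
  · subst hj2
    refine ⟨b0 ^ (n + 1) * b1 * a0, ?_⟩
    have h1 : ((b0 ^ (n + 2) * b1 : ℕ) : ℝ) * P.coeff (n + 2) - ((b0 ^ (n + 1) * b1 * a0 : ℤ) : ℝ) =
        (b0 ^ (n + 1) * b1) * (b0 * α - a0) := by
      push_cast
      rw [hα]
      ring
    rw [h1, abs_mul, abs_of_nonneg (by positivity : (0 : ℝ) ≤ b0 ^ (n + 1) * b1)]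
    calc (b0 ^ (n + 1) * b1 : ℝ) * |b0 * α - a0| * (M : ℝ) ^ (n + 2)
        = (b0 ^ (n + 1) * b1 : ℝ) * (|b0 * α - a0| * (M : ℝ) ^ (n + 2)) := by ring
      _ ≤ ((R ^ E0) ^ (n + 1) * R ^ (3 * E1)) * R ^ E0 := by
        gcongr
        exact hb12.trans h4R
      _ = R ^ (E0 * (n + 2) + 3 * E1) := by ring
      _ ≤ _ := hmono (by omega)
  · have hj3 : j < n + 2 := hj2
    have hQP : P.coeff j = Q.coeff j := by
      rw [hQ, Polynomial.coeff_sub, Polynomial.coeff_C_mul, Polynomial.coeff_X_pow,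
        if_neg (by omega)]
      ring
    set q : ℕ → ℝ := fun i => (Q.comp (Polynomial.C (b0 : ℝ) * Polynomial.X +
      Polynomial.C (x0 : ℝ))).coeff i with hq
    have hq' : ∀ i, ∃ a : ℤ, 1 ≤ i → |b1 * q i - a| * (l : ℝ) ^ i ≤ (4 * R) ^ E1 := by
      intro i
      by_cases hi : 1 ≤ i
      · obtain ⟨a, ha⟩ := hb13 i hi
        exact ⟨a, fun _ => ha⟩
      · exact ⟨0, fun h => absurd h hi⟩
    choose a ha using hq'
    refine ⟨∑ i ∈ range (n + 2), a i * b0 ^ (n + 2 - i) * ((-x0) ^ (i - j) * i.choose j), ?_⟩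
    have h1 := coeff_of_comp hQdeg (b0 := b0) (x0 := x0) hb0pos.ne' j
    have h2 : ((b0 ^ (n + 2) * b1 : ℕ) : ℝ) * P.coeff j - ((∑ i ∈ range (n + 2),
        a i * b0 ^ (n + 2 - i) * ((-x0) ^ (i - j) * i.choose j) : ℤ) : ℝ) =
        ∑ i ∈ range (n + 2), (b1 * q i - a i) * (b0 : ℝ) ^ (n + 2 - i) *
          ((-x0 : ℝ) ^ (i - j) * i.choose j) := by
      rw [hQP]
      have : ((b0 ^ (n + 2) * b1 : ℕ) : ℝ) * Q.coeff j =
        b1 * ((b0 : ℝ) ^ (n + 1 + 1) * Q.coeff j) := by push_cast; ring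
      rw [this, h1]
      push_cast
      rw [mul_sum, ← sum_sub_distrib]
      refine sum_congr rfl fun i _ => ?_
      rw [hq]
      ring
    rw [h2]
    set B : ℝ := R ^ (3 * E1 + (E2 + 1) * (n + 2) + E0 * (n + 2) + (n + 2)) with hB
    have h3 : ∀ i ∈ range (n + 2), ‖(b1 * q i - a i) * (b0 : ℝ) ^ (n + 2 - i) *
          ((-x0 : ℝ) ^ (i - j) * i.choose j) * (M : ℝ) ^ j‖ ≤ B := by
      intro i hi
      rw [mem_range] at hi
      rcases Nat.lt_or_ge i j with hij | hij
      · rw [Nat.choose_eq_zero_of_lt hij]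
        simp
        positivity
      · have hx0M : (x0 : ℝ) ≤ M := by exact_mod_cast hx0.le
        have hch : ((i.choose j : ℕ) : ℝ) ≤ R ^ (n + 2) := by
          have h5 : ((i.choose j : ℕ) : ℝ) ≤ 2 ^ i := by exact_mod_cast Nat.choose_le_two_pow i j
          calc ((i.choose j : ℕ) : ℝ) ≤ 2 ^ i := h5
            _ ≤ R ^ i := by gcongr
            _ ≤ _ := hmono (by omega)
        have hMi : (M : ℝ) ^ i ≤ R ^ ((E2 + 1) * (n + 2)) * (l : ℝ) ^ i := by
          calc (M : ℝ) ^ i ≤ (R ^ (E2 + 1) * l) ^ i := by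
                gcongr
                refine hMl.trans ?_
                rw [pow_succ' R]
                gcongr
            _ = R ^ ((E2 + 1) * i) * (l : ℝ) ^ i := by rw [mul_pow, ← pow_mul]
            _ ≤ _ := by
              gcongr
        have hb0i : (b0 : ℝ) ^ (n + 2 - i) ≤ R ^ (E0 * (n + 2)) := by
          calc (b0 : ℝ) ^ (n + 2 - i) ≤ (R ^ E0) ^ (n + 2 - i) := by gcongr
            _ ≤ (R ^ E0) ^ (n + 2) := pow_le_pow_right₀ (one_le_pow₀ hR1) (by omega)
            _ = _ := by rw [← pow_mul]
        rw [norm_mul, norm_mul, norm_mul, norm_mul, norm_pow, norm_pow, norm_pow, norm_neg,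
          Real.norm_natCast, Real.norm_natCast, Real.norm_natCast, Real.norm_natCast,
          Real.norm_eq_abs]
        calc |b1 * q i - a i| * (b0 : ℝ) ^ (n + 2 - i) * ((x0 : ℝ) ^ (i - j) * i.choose j) *
              (M : ℝ) ^ j
            ≤ |b1 * q i - a i| * (b0 : ℝ) ^ (n + 2 - i) * ((M : ℝ) ^ (i - j) * i.choose j) *
              (M : ℝ) ^ j := by gcongr
          _ = |b1 * q i - a i| * (M : ℝ) ^ i * (b0 : ℝ) ^ (n + 2 - i) * i.choose j := by
              have : (M : ℝ) ^ i = (M : ℝ) ^ (i - j) * (M : ℝ) ^ j := by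
                rw [← pow_add]; congr 1; omega
              rw [this]; ring
          _ ≤ |b1 * q i - a i| * (R ^ ((E2 + 1) * (n + 2)) * (l : ℝ) ^ i) *
              R ^ (E0 * (n + 2)) * R ^ (n + 2) := by gcongr
          _ = (|b1 * q i - a i| * (l : ℝ) ^ i) * (R ^ ((E2 + 1) * (n + 2)) *
              R ^ (E0 * (n + 2)) * R ^ (n + 2)) := by ring
          _ ≤ R ^ (3 * E1) * (R ^ ((E2 + 1) * (n + 2)) *
              R ^ (E0 * (n + 2)) * R ^ (n + 2)) := by
              gcongr
              exact (ha i (by omega)).trans h4R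
          _ = B := by rw [hB]; ring
    calc _ = ‖∑ i ∈ range (n + 2), (b1 * q i - a i) * (b0 : ℝ) ^ (n + 2 - i) *
          ((-x0 : ℝ) ^ (i - j) * i.choose j) * (M : ℝ) ^ j‖ := by
          rw [← sum_mul, norm_mul, norm_pow, Real.norm_natCast, Real.norm_eq_abs]
      _ ≤ ((n + 2 : ℕ) : ℝ) * B := by
          refine (norm_sum_le_of_le _ h3).trans ?_
          simp
      _ ≤ R ^ (n + 2) * B := by
          gcongr
          exact natCast_le_pow_of_two_le hR _
      _ ≤ _ := by
          rw [hB, ← pow_add]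
          exact hmono (by omega)

/-- Inverse Weyl theorem, with polynomial dependence in every degree. -/
lemma exists_weylInverse (n : ℕ) : ∃ E, WeylInverse (n + 1) E := by
  induction n with
  | zero => exact ⟨1, weylInverse_one⟩
  | succ n ih =>
    obtain ⟨E, hE⟩ := ih
    exact weylInverse_succ hE

lemma dvd_of_forall_dvd_mul {F : Polynomial ℤ}
    (hgcd : ∀ d : ℕ, (∀ j, 1 ≤ j → (d : ℤ) ∣ F.coeff j) → d = 1) {b c : ℕ} (hb : 0 < b)
    (h : ∀ j, 1 ≤ j → (b : ℤ) ∣ c * F.coeff j) : b ∣ c := by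
  have hg : 0 < Nat.gcd b c := Nat.gcd_pos_of_pos_left _ hb
  have h1 : b / Nat.gcd b c = 1 := by
    apply hgcd
    intro j hj
    have hco : Nat.Coprime (b / Nat.gcd b c) (c / Nat.gcd b c) := Nat.coprime_div_gcd_div_gcd hg
    apply IsCoprime.dvd_of_dvd_mul_left (Nat.isCoprime_iff_coprime.mpr hco)
    have h3 := h j hj
    set g := Nat.gcd b c
    have hbg : (b : ℤ) = g * (b / g : ℕ) := by
      exact_mod_cast (Nat.mul_div_cancel' (Nat.gcd_dvd_left b c)).symm
    have hcg : (c : ℤ) = g * (c / g : ℕ) := by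
      exact_mod_cast (Nat.mul_div_cancel' (Nat.gcd_dvd_right b c)).symm
    rw [hbg, hcg, mul_assoc] at h3
    exact Int.dvd_of_mul_dvd_mul_left (by omega) h3
  have h2 : b = Nat.gcd b c := by
    have := Nat.div_mul_cancel (Nat.gcd_dvd_left b c)
    rw [h1, one_mul] at this
    exact this.symm
  rw [h2]
  exact Nat.gcd_dvd_right b c

open Finset Polynomial in
/-- Major arc structure of the exponential sums of integer polynomials whose nonconstant
coefficients are jointly coprime. -/
lemma exists_major_arc {k E : ℕ} (hE : WeylInverse k E) (hk : 1 ≤ k) {F : ℤ[X]}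
    (hdeg : F.natDegree ≤ k) (hlead : F.coeff k ≠ 0)
    (hgcd : ∀ d : ℕ, (∀ j, 1 ≤ j → (d : ℤ) ∣ F.coeff j) → d = 1)
    {H R : ℝ} (hH1 : 1 ≤ H) (hH : ∀ j, |(F.coeff j : ℝ)| ≤ H) (hR : 2 ≤ R) {M : ℕ}
    (hM : 2 * R ^ (3 * E) * H ^ 2 < M) (α : ℝ)
    (hS : M < R * ‖∑ x ∈ range M, ee (α * (F.eval (x : ℤ) : ℤ))‖) :
    ∃ b : ℕ, 1 ≤ b ∧ (b : ℝ) ≤ R ^ E ∧ ∃ a : ℤ, IsCoprime a (b : ℤ) ∧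
      |α - a / b| * (|(F.coeff k : ℝ)| * (M : ℝ) ^ k) ≤ R ^ E ∧
      b * ‖∑ x ∈ range M, ee (α * (F.eval (x : ℤ) : ℤ))‖ ^ E ≤ (2 * M) ^ E := by
  set S := ‖∑ x ∈ range M, ee (α * (F.eval (x : ℤ) : ℤ))‖ with hSdef
  have hMR : (0 : ℝ) < M := lt_of_le_of_lt (by positivity) hM
  have hM1 : (1 : ℝ) ≤ M := by exact_mod_cast hMR
  have hSpos : 0 < S := by
    by_contra h
    have : R * S ≤ 0 := mul_nonpos_of_nonneg_of_nonpos (by linarith) (by linarith)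
    linarith
  have hSM : S ≤ M := by
    have := norm_sum_ee_le (range M) (fun x => α * (F.eval (x : ℤ) : ℤ))
    rwa [card_range] at this
  obtain ⟨R', hR', hR'R, hMS, hSR'⟩ : ∃ R' : ℝ, 2 ≤ R' ∧ R' ≤ R ∧ M ≤ R' * S ∧ R' * S ≤ 2 * M := by
    refine ⟨max 2 (M / S), le_max_left _ _, max_le hR ?_, ?_, ?_⟩
    · rw [div_le_iff₀ hSpos]; exact hS.le
    · rw [← div_le_iff₀ hSpos]; exact le_max_right _ _
    · rw [← le_div_iff₀ hSpos, max_le_iff]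
      constructor
      · rw [le_div_iff₀ hSpos]; linarith
      · gcongr; linarith
  have hR1 : 1 ≤ R := by linarith
  have hRE : R' ^ E ≤ R ^ E := by gcongr
  obtain ⟨b0, hb01, hb02, hb03⟩ := hE (C α * F.map (Int.castRingHom ℝ))
    ((natDegree_C_mul_le _ _).trans (natDegree_map_le.trans hdeg)) R' hR' M
    (by exact_mod_cast hMR) (by
      refine hMS.trans (le_of_eq ?_)
      rw [hSdef]
      congr 2
      refine sum_congr rfl fun x _ => ?_
      congr 1
      rw [eval_mul, eval_C]
      congr 1
      simp)
  have hcoeff : ∀ j, (C α * F.map (Int.castRingHom ℝ)).coeff j = α * F.coeff j := by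
    intro j
    rw [coeff_C_mul, coeff_map]
    rfl
  simp only [hcoeff] at hb03
  have hb0R : (1 : ℝ) ≤ b0 := by exact_mod_cast hb01
  obtain ⟨c, hc⟩ := hb03 k hk
  have hbk : (1 : ℝ) ≤ |(F.coeff k : ℝ)| := by
    rw [← Int.cast_abs]
    exact_mod_cast Int.one_le_abs hlead
  set q : ℚ := c / (b0 * F.coeff k) with hq
  set b := q.den with hb
  set a := q.num with ha
  have hbpos : 0 < b := q.den_pos
  have hbR : (0 : ℝ) < b := by exact_mod_cast hbpos
  have hqR : (a / b : ℝ) = c / (b0 * F.coeff k) := by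
    have : (a / b : ℚ) = c / (b0 * F.coeff k) := by rw [← hq]; exact Rat.num_div_den q
    exact_mod_cast this
  have hcop : IsCoprime a (b : ℤ) := by
    rw [Int.isCoprime_iff_gcd_eq_one]
    exact q.reduced
  have hbdvd : (b : ℤ) ∣ b0 * F.coeff k := by
    have := Rat.den_dvd c (b0 * F.coeff k)
    rw [hb, hq]
    rw [Rat.divInt_eq_div] at this
    exact_mod_cast this
  have hbk0 : (F.coeff k : ℝ) ≠ 0 := by exact_mod_cast hlead
  have hbH : (b : ℝ) ≤ R ^ E * H := by
    have h1 : (b : ℤ) ≤ |b0 * F.coeff k| := by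
      apply Int.le_of_dvd
      · rw [abs_pos]
        exact mul_ne_zero (by exact_mod_cast (by omega : b0 ≠ 0)) hlead
      · rwa [dvd_abs]
    have h2 : (b : ℝ) ≤ |(b0 : ℝ) * F.coeff k| := by exact_mod_cast h1
    rw [abs_mul, Nat.abs_cast] at h2
    refine h2.trans ?_
    gcongr
    · exact hb02.trans hRE
    · exact hH k
  have hβ : |α - a / b| * (b0 * |(F.coeff k : ℝ)|) * (M : ℝ) ^ k ≤ R' ^ E := by
    rw [hqR]
    refine le_trans (le_of_eq ?_) hc
    congr 1
    rw [← Nat.abs_cast b0, ← abs_mul, ← abs_mul, Nat.abs_cast]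
    congr 1
    field_simp
  have hβ2 : |α - a / b| * (|(F.coeff k : ℝ)| * (M : ℝ) ^ k) ≤ R' ^ E := by
    refine le_trans ?_ hβ
    rw [mul_assoc]
    gcongr
    exact le_mul_of_one_le_left (abs_nonneg _) hb0R
  have hβ3 : |α - a / b| * M ≤ R ^ E := by
    refine le_trans ?_ (hβ2.trans hRE)
    gcongr
    calc (M : ℝ) ≤ 1 * M ^ k := by rw [one_mul]; exact le_self_pow₀ hM1 (by omega)
      _ ≤ _ := by gcongr
  have hdvd : b ∣ b0 := by
    apply dvd_of_forall_dvd_mul hgcd hbpos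
    intro j hj
    have h1 : (b : ℤ) ∣ (b0 * F.coeff j) * a := by
      obtain ⟨n, hn⟩ := hb03 j hj
      have h2 : |((b0 * F.coeff j * a - b * n : ℤ) : ℝ)| < 1 := by
        have e1 : ((b0 * F.coeff j * a - b * n : ℤ) : ℝ) =
            b * (b0 * (α * F.coeff j) - n) - b * ((b0 * F.coeff j) * (α - a / b)) := by
          push_cast
          field_simp
          ring
        rw [e1]
        have hMj : (M : ℝ) ≤ M ^ j := le_self_pow₀ hM1 (by omega)
        have e2 : |b0 * (α * F.coeff j) - n| * M ≤ R ^ E := by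
          calc _ ≤ |b0 * (α * F.coeff j) - n| * (M : ℝ) ^ j := by gcongr
            _ ≤ R ^ E := hn.trans hRE
        have e3 : |(b0 * F.coeff j) * (α - a / b)| * M ≤ R ^ E * H * R ^ E := by
          rw [abs_mul, abs_mul, Nat.abs_cast, mul_assoc]
          gcongr
          · exact hb02.trans hRE
          · exact hH j
        have e4 : |b * (b0 * (α * F.coeff j) - n) - b * ((b0 * F.coeff j) * (α - a / b))| * M ≤
            R ^ E * H * (R ^ E + R ^ E * H * R ^ E) := by
          rw [← mul_sub, abs_mul, Nat.abs_cast]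
          calc _ ≤ b * (|b0 * (α * F.coeff j) - n| + |(b0 * F.coeff j) * (α - a / b)|) * M := by
                gcongr
                exact abs_sub _ _
            _ = b * (|b0 * (α * F.coeff j) - n| * M + |(b0 * F.coeff j) * (α - a / b)| * M) := by
                ring
            _ ≤ _ := by gcongr
        have e5 : R ^ E * H * (R ^ E + R ^ E * H * R ^ E) ≤ 2 * R ^ (3 * E) * H ^ 2 := by
          have hx : 1 ≤ R ^ E := one_le_pow₀ hR1
          have : R ^ (3 * E) = R ^ E * R ^ E * R ^ E := by ring
          rw [this]
          have h3 : R ^ E ≤ R ^ E * H * R ^ E := by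
            have : 1 ≤ H * R ^ E := one_le_mul_of_one_le_of_one_le hH1 hx
            nlinarith
          calc R ^ E * H * (R ^ E + R ^ E * H * R ^ E)
              ≤ R ^ E * H * (R ^ E * H * R ^ E + R ^ E * H * R ^ E) := by gcongr
            _ = _ := by ring
        nlinarith
      have h3 : b0 * F.coeff j * a - b * n = 0 := by
        rw [← Int.abs_lt_one_iff]
        exact_mod_cast h2
      exact ⟨n, by linarith⟩
    exact hcop.symm.dvd_of_dvd_mul_right h1
  have hbb0 : (b : ℝ) ≤ R' ^ E := by
    refine le_trans ?_ hb02
    exact_mod_cast Nat.le_of_dvd (by omega) hdvd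
  refine ⟨b, hbpos, hbb0.trans hRE, a, hcop, hβ2.trans hRE, ?_⟩
  calc b * S ^ E ≤ R' ^ E * S ^ E := by gcongr
    _ = (R' * S) ^ E := by rw [mul_pow]
    _ ≤ (2 * M) ^ E := by gcongr

lemma abs_pow_remainder_le {X u v : ℝ} (hX : 0 ≤ X) (huv : |u| ≤ v) (k : ℕ) :
    |(X + u) ^ k - X ^ k - k * X ^ (k - 1) * u| ≤ (X + v) ^ k - X ^ k - k * X ^ (k - 1) * v := by
  have hv : 0 ≤ v := (abs_nonneg u).trans huv
  induction k with
  | zero => simp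
  | succ k ih =>
    have hrec : ∀ w : ℝ, (X + w) ^ (k + 1) - X ^ (k + 1) - (k + 1 : ℕ) * X ^ (k + 1 - 1) * w =
        (X + w) * ((X + w) ^ k - X ^ k - k * X ^ (k - 1) * w) + k * X ^ (k - 1) * w ^ 2 := by
      intro w
      rcases Nat.eq_zero_or_pos k with h | h
      · subst h; simp
      · obtain ⟨m, rfl⟩ : ∃ m, k = m + 1 := ⟨k - 1, by omega⟩
        simp only [Nat.add_sub_cancel]
        push_cast
        ring
    rw [hrec u, hrec v]
    refine (abs_add_le _ _).trans ?_
    rw [abs_mul]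
    have h1 : |X + u| ≤ X + v := by
      refine (abs_add_le _ _).trans ?_
      rw [abs_of_nonneg hX]
      linarith
    have h2 : |k * X ^ (k - 1) * u ^ 2| ≤ k * X ^ (k - 1) * v ^ 2 := by
      rw [abs_of_nonneg (by positivity), ← sq_abs u]
      gcongr
    gcongr

lemma pow_remainder_le {A y : ℝ} (hA : 0 ≤ A) (hy : 0 ≤ y) {r : ℕ} (hr : 2 ≤ r) :
    (A + y) ^ r - A ^ r - r * A ^ (r - 1) * y ≤ A ^ (r - 2) * (2 * r * y) ^ 2 + (2 * r * y) ^ r := by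
  have hr0 : (0 : ℝ) < r := by positivity
  rcases le_or_gt (r * y) A with h | h
  · rcases eq_or_lt_of_le hA with hA0 | hApos
    · subst hA0
      have hy0 : y = 0 := by nlinarith
      subst hy0
      simp
    · set x := r * y / A with hx
      have hx0 : 0 ≤ x := by positivity
      have hx1 : x ≤ 1 := by rw [hx, div_le_one hApos]; exact h
      have h1 : (A + y) ^ r ≤ A ^ r * Real.exp x := by
        have h2 : A + y ≤ A * Real.exp (y / A) := by
          have := Real.add_one_le_exp (y / A)
          calc A + y = A * (y / A + 1) := by field_simp; ring
            _ ≤ _ := by gcongr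
        calc (A + y) ^ r ≤ (A * Real.exp (y / A)) ^ r := by gcongr
          _ = A ^ r * Real.exp x := by
            rw [mul_pow, ← Real.exp_nat_mul, hx, mul_div_assoc]
      have h3 : Real.exp x - 1 - x ≤ x ^ 2 := by
        have := Real.abs_exp_sub_one_sub_id_le (x := x) (by rw [abs_of_nonneg hx0]; exact hx1)
        exact (le_abs_self _).trans this
      obtain ⟨m, rfl⟩ : ∃ m, r = m + 2 := ⟨r - 2, by omega⟩
      have e1 : A ^ (m + 2) * x = (m + 2 : ℕ) * A ^ (m + 2 - 1) * y := by
        rw [hx]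
        simp only [show m + 2 - 1 = m + 1 by omega]
        field_simp
        ring
      have e2 : A ^ (m + 2) * x ^ 2 = A ^ (m + 2 - 2) * ((m + 2 : ℕ) * y) ^ 2 := by
        rw [hx]
        simp only [Nat.add_sub_cancel]
        field_simp
        ring
      have h4 : A ^ (m + 2) * Real.exp x ≤ A ^ (m + 2) * (1 + x + x ^ 2) := by
        gcongr
        linarith
      have h5 : A ^ (m + 2 - 2) * ((m + 2 : ℕ) * y) ^ 2 ≤
          A ^ (m + 2 - 2) * (2 * (m + 2 : ℕ) * y) ^ 2 := by
        gcongr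
        have : (0:ℝ) ≤ (m + 2 : ℕ) * y := by positivity
        linarith
      have h6 : (0 : ℝ) ≤ (2 * (m + 2 : ℕ) * y) ^ (m + 2) := by positivity
      nlinarith
  · have hy0 : 0 < y := by
      by_contra hcon
      have : r * y ≤ 0 := mul_nonpos_of_nonneg_of_nonpos hr0.le (by linarith)
      linarith
    have h1 : (A + y) ^ r ≤ (r * y) ^ r * 4 := by
      have h2 : A + y ≤ (r * y) * Real.exp (1 / r) := by
        have := Real.add_one_le_exp (1 / (r : ℝ))
        calc A + y ≤ r * y + y := by linarith
          _ = (r * y) * (1 / r + 1) := by field_simp; ring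
          _ ≤ _ := by gcongr
      calc (A + y) ^ r ≤ ((r * y) * Real.exp (1 / r)) ^ r := by gcongr
        _ = (r * y) ^ r * Real.exp 1 := by
          rw [mul_pow, ← Real.exp_nat_mul, mul_one_div_cancel hr0.ne']
        _ ≤ (r * y) ^ r * 4 := by
          gcongr
          linarith [Real.exp_one_lt_d9]
    have h3 : (r * y) ^ r * 4 ≤ (2 * r * y) ^ r := by
      have h4 : (4 : ℝ) ≤ 2 ^ r := by
        calc (4 : ℝ) = 2 ^ 2 := by norm_num
          _ ≤ 2 ^ r := pow_le_pow_right₀ (by norm_num) hr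
      calc (r * y) ^ r * 4 ≤ (r * y) ^ r * 2 ^ r := by gcongr
        _ = _ := by rw [← mul_pow]; congr 1; ring
    have h5 : 0 ≤ A ^ r := by positivity
    have h6 : 0 ≤ r * A ^ (r - 1) * y := by positivity
    have h7 : 0 ≤ A ^ (r - 2) * (2 * r * y) ^ 2 := by positivity
    linarith

section OneCoordinate

variable {V : Type*} [NormedAddCommGroup V] [InnerProductSpace ℝ V]

lemma norm_add_smul_pow_le (a b : V) {ρ τ : ℝ} (hρ : 0 ≤ ρ) (hτ : τ ≤ 1) {k : ℕ} (hk : 1 ≤ k)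
    (hρτ : 4 * k * ρ ≤ τ) :
    (‖a + ρ • b‖ ^ 2) ^ k ≤ (‖a‖ ^ 2) ^ k + 2 * k * ρ * (‖a‖ ^ 2) ^ (k - 1) * inner ℝ a b +
      (‖a‖ ^ 2) ^ (k - 1) * ‖b‖ ^ 2 + (τ ^ 2) ^ k * (‖b‖ ^ 2) ^ k := by
  set A := ‖a‖ with hA
  set s := ‖b‖ with hs
  set t : ℝ := inner ℝ a b with ht
  have hA0 : 0 ≤ A := norm_nonneg _
  have hs0 : 0 ≤ s := norm_nonneg _
  have hτ0 : 0 ≤ τ := le_trans (by positivity) hρτ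
  have h1 : ‖a + ρ • b‖ ^ 2 = A ^ 2 + (2 * ρ * t + ρ ^ 2 * s ^ 2) := by
    rw [norm_add_sq_real, inner_smul_right, norm_smul, Real.norm_eq_abs, mul_pow, sq_abs]
    ring
  have hts : |t| ≤ A * s := abs_real_inner_le_norm a b
  have huv : |2 * ρ * t + ρ ^ 2 * s ^ 2| ≤ 2 * ρ * (A * s) + ρ ^ 2 * s ^ 2 := by
    refine (abs_add_le _ _).trans ?_
    rw [abs_mul, abs_of_nonneg (by positivity : 0 ≤ 2 * ρ),
      abs_of_nonneg (by positivity : 0 ≤ ρ ^ 2 * s ^ 2)]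
    gcongr
  have h2 := (le_abs_self _).trans (abs_pow_remainder_le (sq_nonneg A) huv k)
  have h3 : A ^ 2 + (2 * ρ * (A * s) + ρ ^ 2 * s ^ 2) = (A + ρ * s) ^ 2 := by ring
  rw [h3] at h2
  have h4 := pow_remainder_le hA0 (mul_nonneg hρ hs0) (r := 2 * k) (by omega)
  obtain ⟨m, rfl⟩ : ∃ m, k = m + 1 := ⟨k - 1, by omega⟩
  simp only [Nat.add_sub_cancel] at h2 ⊢
  have e1 : 2 * (m + 1) - 2 = 2 * m := by omega
  have e2 : 2 * (m + 1) - 1 = 2 * m + 1 := by omega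
  rw [e1, e2, pow_mul (A + ρ * s), pow_mul A, pow_mul A] at h4
  have h5 : 2 * ((2 * (m + 1) : ℕ) : ℝ) * (ρ * s) ≤ τ * s := by
    have : 2 * ((2 * (m + 1) : ℕ) : ℝ) * (ρ * s) = (4 * (m + 1 : ℕ) * ρ) * s := by push_cast; ring
    rw [this]
    gcongr
  have h6 : (2 * ((2 * (m + 1) : ℕ) : ℝ) * (ρ * s)) ^ (2 * (m + 1)) ≤
      (τ ^ 2) ^ (m + 1) * (s ^ 2) ^ (m + 1) := by
    rw [← mul_pow, ← mul_pow, ← pow_mul]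
    gcongr
  have h7 : (A ^ 2) ^ m * (2 * ((2 * (m + 1) : ℕ) : ℝ) * (ρ * s)) ^ 2 ≤ (A ^ 2) ^ m * s ^ 2 := by
    gcongr
    refine h5.trans ?_
    exact mul_le_of_le_one_left hs0 hτ
  rw [h1]
  have h8 : (A ^ 2) ^ m * A = A ^ (2 * m + 1) := by rw [← pow_mul, pow_succ]
  have h9 : ((2 * (m + 1) : ℕ) : ℝ) * A ^ (2 * m + 1) * (ρ * s) =
      2 * (m + 1 : ℕ) * (A ^ 2) ^ m * (ρ * (A * s)) := by
    rw [← h8]; push_cast; ring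
  rw [h9] at h4
  have h10 : ((m + 1 : ℕ) : ℝ) * (A ^ 2) ^ m * (2 * ρ * t + ρ ^ 2 * s ^ 2) =
      2 * (m + 1 : ℕ) * ρ * (A ^ 2) ^ m * t + (m + 1 : ℕ) * (A ^ 2) ^ m * (ρ ^ 2 * s ^ 2) := by ring
  have h11 : ((m + 1 : ℕ) : ℝ) * (A ^ 2) ^ m * (2 * ρ * (A * s) + ρ ^ 2 * s ^ 2) =
      2 * (m + 1 : ℕ) * (A ^ 2) ^ m * (ρ * (A * s)) +
        (m + 1 : ℕ) * (A ^ 2) ^ m * (ρ ^ 2 * s ^ 2) := by ring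
  linarith

open Finset in
/-- One-coordinate hypercontractive inequality. -/
lemma sum_norm_add_smul_pow_le {X : Type*} [Fintype X] [Nonempty X] (a : V) (b : X → V)
    (hb : ∑ x, b x = 0) {ρ τ : ℝ} (hρ : 0 ≤ ρ) (hτ : τ ≤ 1) {k : ℕ} (hk : 1 ≤ k)
    (hρτ : 4 * k * ρ ≤ τ) :
    𝔼 x, (‖a + ρ • b x‖ ^ 2) ^ k ≤ (‖a‖ ^ 2 + 𝔼 x, ‖b x‖ ^ 2) ^ k +
      (τ ^ 2) ^ k * 𝔼 x, (‖b x‖ ^ 2) ^ k := by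
  have h1 : 𝔼 x, (‖a + ρ • b x‖ ^ 2) ^ k ≤ 𝔼 x, ((‖a‖ ^ 2) ^ k +
      2 * k * ρ * (‖a‖ ^ 2) ^ (k - 1) * inner ℝ a (b x) +
      (‖a‖ ^ 2) ^ (k - 1) * ‖b x‖ ^ 2 + (τ ^ 2) ^ k * (‖b x‖ ^ 2) ^ k) :=
    expect_le_expect fun x _ => norm_add_smul_pow_le a (b x) hρ hτ hk hρτ
  have h2 : 𝔼 x, (inner ℝ a (b x) : ℝ) = 0 := by
    rw [Fintype.expect_eq_sum_div_card, ← inner_sum, hb]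
    simp
  rw [expect_add_distrib, expect_add_distrib, expect_add_distrib, Fintype.expect_const,
    ← mul_expect, ← mul_expect, ← mul_expect, h2, mul_zero, add_zero] at h1
  refine h1.trans (add_le_add ?_ le_rfl)
  set σ := 𝔼 x, ‖b x‖ ^ 2 with hσ
  have hσ0 : 0 ≤ σ := expect_nonneg fun x _ => by positivity
  have h3 := (abs_nonneg _).trans
    (abs_pow_remainder_le (sq_nonneg ‖a‖) (u := σ) (v := σ) (abs_of_nonneg hσ0).le k)
  have h4 : (‖a‖ ^ 2) ^ (k - 1) * σ ≤ k * (‖a‖ ^ 2) ^ (k - 1) * σ := by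
    rw [mul_assoc]
    exact le_mul_of_one_le_left (by positivity) (by exact_mod_cast hk)
  linarith

end OneCoordinate

open Finset in
lemma one_coordinate_sum {X J : Type*} [Fintype X] [Nonempty X] [Fintype J] (a : J → ℝ)
    (b : X → J → ℝ) (hb : ∀ j, ∑ x, b x j = 0) {ρ τ : ℝ} (hρ : 0 ≤ ρ) (hτ : τ ≤ 1) {k : ℕ}
    (hk : 1 ≤ k) (hρτ : 4 * k * ρ ≤ τ) :
    𝔼 x, (∑ j, (a j + ρ * b x j) ^ 2) ^ k ≤ (∑ j, a j ^ 2 + ∑ j, 𝔼 x, b x j ^ 2) ^ k +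
      (τ ^ 2) ^ k * 𝔼 x, (∑ j, b x j ^ 2) ^ k := by
  have h := sum_norm_add_smul_pow_le (V := EuclideanSpace ℝ J) (WithLp.toLp 2 a)
    (fun x => WithLp.toLp 2 (b x)) (by
      ext j
      simp [hb]) hρ hτ hk hρτ
  simp only [EuclideanSpace.norm_sq_eq, Real.norm_eq_abs, sq_abs] at h
  simp only [PiLp.add_apply, PiLp.smul_apply, smul_eq_mul] at h
  rw [expect_sum_comm] at h
  exact h

open Finset in
lemma one_coordinate_expect {X σ Ω : Type*} [Fintype X] [Nonempty X] [Fintype Ω]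
    (T : Finset σ) (a : σ → Ω → ℝ)
    (b : X → σ → Ω → ℝ) (hb : ∀ S ∈ T, ∀ w, ∑ x, b x S w = 0) {ρ τ : ℝ} (hρ : 0 ≤ ρ) (hτ : τ ≤ 1)
    {k : ℕ} (hk : 1 ≤ k) (hρτ : 4 * k * ρ ≤ τ) :
    𝔼 x, (∑ S ∈ T, 𝔼 w, (a S w + ρ * b x S w) ^ 2) ^ k ≤
      (∑ S ∈ T, 𝔼 w, a S w ^ 2 + ∑ S ∈ T, 𝔼 w, 𝔼 x, b x S w ^ 2) ^ k +
      (τ ^ 2) ^ k * 𝔼 x, (∑ S ∈ T, 𝔼 w, b x S w ^ 2) ^ k := by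
  have hsum : ∀ f : σ → Ω → ℝ, ∑ S ∈ T, 𝔼 w, f S w =
      (∑ j : T × Ω, f j.1 j.2) * (Fintype.card Ω : ℝ)⁻¹ := by
    intro f
    rw [Fintype.sum_prod_type, ← sum_coe_sort, sum_mul]
    refine sum_congr rfl fun S _ => ?_
    rw [Fintype.expect_eq_sum_div_card, div_eq_mul_inv]
  have h := one_coordinate_sum (J := T × Ω) (fun j => a j.1 j.2) (fun x j => b x j.1 j.2)
    (fun j => hb _ j.1.2 _) hρ hτ hk hρτ
  simp only [hsum, mul_pow, ← expect_mul, ← add_mul]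
  have h2 := mul_le_mul_of_nonneg_right h (by positivity : 0 ≤ (Fintype.card Ω : ℝ)⁻¹ ^ k)
  refine h2.trans (le_of_eq ?_)
  ring

section Product

lemma piecewise_congr_finset {ι : Type*} [DecidableEq ι] {G : ι → Type*} {s t : Finset ι}
    (h : s = t) (w z : ∀ i, G i) : s.piecewise w z = t.piecewise w z := by
  subst h; rfl

section

variable {ι : Type*} [DecidableEq ι] {G : ι → Type*}

lemma piecewise_update_left {K : Finset ι} {n : ι} (hn : n ∉ K) (w z : ∀ i, G i) (x : G n) :
    K.piecewise w (Function.update z n x) = Function.update (K.piecewise w z) n x := by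
  funext i
  by_cases hi : i = n
  · subst hi; simp [hn]
  · by_cases hK : i ∈ K <;> simp [hi, hK]

lemma insert_piecewise_update {K : Finset ι} {n : ι} (hn : n ∉ K) (w z : ∀ i, G i) (x : G n) :
    (insert n K).piecewise (Function.update w n x) z =
      Function.update (K.piecewise w z) n x := by
  funext i
  by_cases hi : i = n
  · subst hi; simp
  · by_cases hK : i ∈ K <;> simp [hi, hK]

end

variable {ι : Type*} [DecidableEq ι] [Fintype ι] {G : ι → Type*} [∀ i, Fintype (G i)]

lemma expect_update (n : ι) (f : (∀ i, G i) → ℝ) [∀ i, Nonempty (G i)] :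
    𝔼 z, f z = 𝔼 z, 𝔼 x, f (Function.update z n x) := by
  let e : ((∀ i, G i) × G n) ≃ ((∀ i, G i) × G n) :=
    { toFun := fun p => (Function.update p.1 n p.2, p.1 n)
      invFun := fun p => (Function.update p.1 n p.2, p.1 n)
      left_inv := fun p => by simp
      right_inv := fun p => by simp }
  have h1 : ∑ p : (∀ i, G i) × G n, f p.1 = ∑ p : (∀ i, G i) × G n,
      f (Function.update p.1 n p.2) := by
    rw [← Equiv.sum_comp e]
    rfl
  rw [Fintype.sum_prod_type, Fintype.sum_prod_type] at h1
  simp only [Finset.sum_const, Finset.card_univ, nsmul_eq_mul] at h1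
  rw [← Finset.mul_sum] at h1
  simp only [Fintype.expect_eq_sum_div_card]
  rw [← Finset.sum_div, ← h1, mul_comm, mul_div_assoc, div_self, mul_one]
  exact_mod_cast Fintype.card_ne_zero

open Finset in
/-- Hypercontractive inequality on a product space, in terms of derivative norms. -/
theorem hypercontractive [∀ i, Nonempty (G i)] {ρ τ : ι → ℝ} {k : ℕ} (hk : 1 ≤ k)
    (hρ : ∀ i, 0 ≤ ρ i) (hτ : ∀ i, τ i ≤ 1) (hρτ : ∀ i, 4 * k * ρ i ≤ τ i) (I : Finset ι) :
    ∀ F : Finset ι → (∀ i, G i) → ℝ,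
    (∀ S ⊆ I, ∀ i ∈ I, i ∉ S → ∀ z a, F S (Function.update z i a) = F S z) →
    (∀ S ⊆ I, ∀ i ∈ S, ∀ z, ∑ a, F S (Function.update z i a) = 0) →
    𝔼 z, ((∑ S ∈ I.powerset, (∏ i ∈ S, ρ i) * F S z) ^ 2) ^ k ≤
      ∑ U ∈ I.powerset, (∏ i ∈ U, τ i ^ 2) ^ k *
        𝔼 z, (∑ S ∈ I.powerset with U ⊆ S, 𝔼 w, F S ((I \ U).piecewise w z) ^ 2) ^ k := by
  induction I using Finset.induction_on with
  | empty =>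
    intro F _ _
    simp [Finset.filter_singleton, piecewise_congr_finset (empty_sdiff (∅ : Finset ι))]
  | insert n I hn ih =>
    intro F hind hmean
    have hnS : ∀ {S}, S ∈ I.powerset → n ∉ S := fun hS h => hn (mem_powerset.mp hS h)
    set F' : Finset ι → (∀ i, G i) → ℝ := fun S z => F S z + ρ n * F (insert n S) z with hF'
    have hL : ∀ z, ∑ S ∈ (insert n I).powerset, (∏ i ∈ S, ρ i) * F S z =
        ∑ S ∈ I.powerset, (∏ i ∈ S, ρ i) * F' S z := by
      intro z
      rw [sum_powerset_insert hn, ← sum_add_distrib]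
      refine sum_congr rfl fun S hS => ?_
      rw [prod_insert (hnS hS), hF']
      ring
    simp only [hL]
    refine (ih F' ?_ ?_).trans ?_
    · intro S hS i hi hiS z a
      have hin : i ≠ n := fun h => hn (h ▸ hi)
      rw [hF']
      simp only
      rw [hind S (hS.trans (subset_insert _ _)) i (mem_insert_of_mem hi) hiS,
        hind (insert n S) (insert_subset_insert _ hS) i (mem_insert_of_mem hi)
          (by simp [hin, hiS])]
    · intro S hS i hi z
      rw [hF']
      simp only
      rw [sum_add_distrib, ← mul_sum, hmean S (hS.trans (subset_insert _ _)) i hi,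
        hmean (insert n S) (insert_subset_insert _ hS) i (mem_insert_of_mem hi)]
      ring
    rw [sum_powerset_insert hn, ← sum_add_distrib]
    refine sum_le_sum fun U hU => ?_
    have hUI := mem_powerset.mp hU
    have hnU := hnS hU
    have hnK : n ∉ I \ U := fun h => hn (mem_sdiff.mp h).1
    have hK1 : insert n I \ U = insert n (I \ U) := insert_sdiff_of_notMem _ hnU
    have hK2 : insert n I \ insert n U = I \ U := by
      ext i
      simp only [mem_sdiff, mem_insert]
      constructor
      · rintro ⟨h1 | h1, h2⟩
        · exact absurd (Or.inl h1) h2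
        · exact ⟨h1, fun h => h2 (Or.inr h)⟩
      · rintro ⟨h1, h2⟩
        refine ⟨Or.inr h1, ?_⟩
        rintro (h | h)
        · exact hn (h ▸ h1)
        · exact h2 h
    set T := I.powerset.filter (fun S => U ⊆ S) with hT
    have hTI : ∀ {S}, S ∈ T → S ∈ I.powerset := fun hS => (mem_filter.mp hS).1
    have hsum1 : ∀ f : Finset ι → ℝ, ∑ S ∈ (insert n I).powerset with U ⊆ S, f S =
        ∑ S ∈ T, f S + ∑ S ∈ T, f (insert n S) := by
      intro f
      rw [sum_filter, sum_powerset_insert hn, hT, sum_filter, sum_filter]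
      congr 1
      refine sum_congr rfl fun S _ => ?_
      simp only [subset_insert_iff_of_notMem hnU]
    have hsum2 : ∀ f : Finset ι → ℝ, ∑ S ∈ (insert n I).powerset with insert n U ⊆ S, f S =
        ∑ S ∈ T, f (insert n S) := by
      intro f
      rw [sum_filter, sum_powerset_insert hn, hT, sum_filter, sum_eq_zero, zero_add]
      · refine sum_congr rfl fun S hS => ?_
        simp only [insert_subset_insert_iff hnU]
      · intro S hS
        rw [if_neg]
        intro h
        exact hnS hS (h (mem_insert_self _ _))
    simp only [hsum1, hsum2, piecewise_congr_finset hK1, piecewise_congr_finset hK2]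
    rw [prod_insert hnU, mul_pow]
    set a : (∀ i, G i) → Finset ι → (∀ i, G i) → ℝ := fun z S w => F S ((I \ U).piecewise w z)
      with ha
    set b : (∀ i, G i) → G n → Finset ι → (∀ i, G i) → ℝ := fun z x S w =>
      F (insert n S) (Function.update ((I \ U).piecewise w z) n x) with hb
    have hmain : ∀ z, 𝔼 x, (∑ S ∈ T, 𝔼 w, (a z S w + ρ n * b z x S w) ^ 2) ^ k ≤
      (∑ S ∈ T, 𝔼 w, a z S w ^ 2 + ∑ S ∈ T, 𝔼 w, 𝔼 x, b z x S w ^ 2) ^ k +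
      (τ n ^ 2) ^ k * 𝔼 x, (∑ S ∈ T, 𝔼 w, b z x S w ^ 2) ^ k := by
      intro z
      refine one_coordinate_expect T (a z) (b z) ?_ (hρ n) (hτ n) hk (hρτ n)
      intro S hS w
      exact hmean _ (insert_subset_insert _ (mem_powerset.mp (hTI hS))) n (mem_insert_self _ _) _
    have e1 : 𝔼 z, (∑ S ∈ T, 𝔼 w, F' S ((I \ U).piecewise w z) ^ 2) ^ k =
        𝔼 z, 𝔼 x, (∑ S ∈ T, 𝔼 w, (a z S w + ρ n * b z x S w) ^ 2) ^ k := by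
      rw [expect_update n]
      refine expect_congr rfl fun z _ => expect_congr rfl fun x _ => ?_
      congr 1
      refine sum_congr rfl fun S hS => expect_congr rfl fun w _ => ?_
      rw [piecewise_update_left hnK]
      simp only [hF', ha, hb]
      rw [hind S ((mem_powerset.mp (hTI hS)).trans (subset_insert _ _)) n (mem_insert_self _ _)
        (hnS (hTI hS))]
    have e2 : ∀ z, ∑ S ∈ T, 𝔼 w, F S ((insert n (I \ U)).piecewise w z) ^ 2 =
        ∑ S ∈ T, 𝔼 w, a z S w ^ 2 := by
      intro z
      refine sum_congr rfl fun S hS => ?_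
      rw [expect_update n]
      refine expect_congr rfl fun w _ => ?_
      rw [← Fintype.expect_const (ι := G n) (a z S w ^ 2)]
      refine expect_congr rfl fun x _ => ?_
      rw [insert_piecewise_update hnK, hind S ((mem_powerset.mp (hTI hS)).trans
        (subset_insert _ _)) n (mem_insert_self _ _) (hnS (hTI hS))]
    have e3 : ∀ z, ∑ S ∈ T, 𝔼 w, F (insert n S) ((insert n (I \ U)).piecewise w z) ^ 2 =
        ∑ S ∈ T, 𝔼 w, 𝔼 x, b z x S w ^ 2 := by
      intro z
      refine sum_congr rfl fun S hS => ?_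
      rw [expect_update n]
      refine expect_congr rfl fun w _ => expect_congr rfl fun x _ => ?_
      rw [insert_piecewise_update hnK]
    have e4 : 𝔼 z, (∑ S ∈ T, 𝔼 w, F (insert n S) ((I \ U).piecewise w z) ^ 2) ^ k =
        𝔼 z, 𝔼 x, (∑ S ∈ T, 𝔼 w, b z x S w ^ 2) ^ k := by
      rw [expect_update n]
      refine expect_congr rfl fun z _ => expect_congr rfl fun x _ => ?_
      congr 1
      refine sum_congr rfl fun S hS => expect_congr rfl fun w _ => ?_
      rw [piecewise_update_left hnK]
    rw [e1, e4]
    simp only [e2, e3]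
    have hτk : 0 ≤ (∏ i ∈ U, τ i ^ 2) ^ k :=
      pow_nonneg (prod_nonneg fun i _ => sq_nonneg _) _
    calc _ ≤ (∏ i ∈ U, τ i ^ 2) ^ k * 𝔼 z, ((∑ S ∈ T, 𝔼 w, a z S w ^ 2 +
          ∑ S ∈ T, 𝔼 w, 𝔼 x, b z x S w ^ 2) ^ k +
          (τ n ^ 2) ^ k * 𝔼 x, (∑ S ∈ T, 𝔼 w, b z x S w ^ 2) ^ k) := by
          refine mul_le_mul_of_nonneg_left ?_ hτk
          exact expect_le_expect fun z _ => hmain z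
      _ = _ := by
          rw [expect_add_distrib, ← mul_expect]
          ring

end Product

section Kernel

/-- The reproducing kernel of the mean-zero functions on a finite set. -/
noncomputable def mker {β : Type*} [Fintype β] [DecidableEq β] (a b : β) : ℝ :=
  (Fintype.card β : ℝ) * (if a = b then 1 else 0) - 1

variable {β : Type*} [Fintype β] [DecidableEq β]

lemma mker_comm (a b : β) : mker a b = mker b a := by
  simp [mker, eq_comm]

lemma sum_mker (a : β) : ∑ b, mker a b = 0 := by
  simp [mker, Finset.sum_sub_distrib]

lemma expect_mker_mul [Nonempty β] (a a' : β) : 𝔼 b, mker a b * mker a' b = mker a a' := by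
  have h : ∀ b, mker a b * mker a' b =
      (Fintype.card β : ℝ) * ((if a = b then 1 else 0) * mker a' b) - mker a' b := by
    intro b; rw [mker]; ring
  have hc : (Fintype.card β : ℝ) ≠ 0 := by exact_mod_cast Fintype.card_ne_zero
  rw [Fintype.expect_eq_sum_div_card]
  simp only [h, Finset.sum_sub_distrib, sum_mker, ← Finset.mul_sum]
  simp only [ite_mul, one_mul, zero_mul, Finset.sum_ite_eq, Finset.mem_univ, if_true, sub_zero]
  rw [mker_comm]
  field_simp

lemma abs_mker_le (a b : β) :
    |mker a b| ≤ (Fintype.card β : ℝ) * (if a = b then 1 else 0) + 1 := by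
  rw [mker]
  refine (abs_sub _ _).trans ?_
  rw [abs_of_nonneg (by positivity), abs_one]

lemma abs_mker_le' (a b : β) : |mker a b| ≤ (Fintype.card β : ℝ) + 1 := by
  refine (abs_mker_le a b).trans ?_
  split_ifs <;> simp

variable {ι : Type*} [DecidableEq ι] [Fintype ι] {G : ι → Type*} [∀ i, Fintype (G i)]

lemma expect_prod_apply (f : ∀ i, G i → ℝ) :
    𝔼 z : ∀ i, G i, ∏ i, f i (z i) = ∏ i, 𝔼 a, f i a := by
  simp only [Fintype.expect_eq_sum_div_card]
  rw [Finset.prod_div_distrib, Finset.prod_univ_sum, Fintype.piFinset_univ, Fintype.card_pi]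
  push_cast
  rfl

lemma expect_prod_apply_finset [∀ i, Nonempty (G i)] (S : Finset ι) (f : ∀ i, G i → ℝ) :
    𝔼 z : ∀ i, G i, ∏ i ∈ S, f i (z i) = ∏ i ∈ S, 𝔼 a, f i a := by
  have h := expect_prod_apply (fun i a => if i ∈ S then f i a else 1)
  have e : ∀ i, 𝔼 a, (if i ∈ S then f i a else 1) = if i ∈ S then 𝔼 a, f i a else 1 := by
    intro i
    split_ifs
    · rfl
    · exact Fintype.expect_const _
  simp only [e] at h
  simpa [Finset.prod_ite_mem] using h

end Kernel

section Cylinder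

variable {ι : Type*} [DecidableEq ι] [Fintype ι] {G : ι → Type*} [∀ i, DecidableEq (G i)]

/-- Combinations of indicators of cylinders on coordinates outside `U`, with total weight `B`. -/
inductive CylSum (U : Finset ι) : ((∀ i, G i) → ℝ) → ℝ → Prop
  | cyl (Y : Finset ι) (hY : Disjoint U Y) (b : ∀ i, G i) (c : ℝ) :
      CylSum U (fun z => c * if ∀ i ∈ Y, z i = b i then 1 else 0) |c|
  | zero : CylSum U (fun _ => 0) 0
  | add {f g : (∀ i, G i) → ℝ} {B C : ℝ} : CylSum U f B → CylSum U g C →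
      CylSum U (fun z => f z + g z) (B + C)

namespace CylSum

variable {U : Finset ι}

lemma const [∀ i, Nonempty (G i)] (c : ℝ) : CylSum (G := G) U (fun _ => c) |c| := by
  have := CylSum.cyl (G := G) (U := U) ∅ (by simp) (fun i => Classical.arbitrary _) c
  simpa using this

lemma nonneg {f : (∀ i, G i) → ℝ} {B : ℝ} (h : CylSum U f B) : 0 ≤ B := by
  induction h with
  | cyl => exact abs_nonneg _
  | zero => exact le_rfl
  | add _ _ h1 h2 => exact add_nonneg h1 h2

lemma cyl_mul {g : (∀ i, G i) → ℝ} {C : ℝ} (hg : CylSum U g C) (Y : Finset ι)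
    (hY : Disjoint U Y) (b : ∀ i, G i) (c : ℝ) :
    ∃ C' ≤ |c| * C, CylSum U (fun z => (c * if ∀ i ∈ Y, z i = b i then 1 else 0) * g z) C' := by
  induction hg with
  | cyl Y' hY' b' c' =>
    by_cases hc : ∀ i ∈ Y, i ∈ Y' → b i = b' i
    · refine ⟨|c * c'|, (abs_mul _ _).le, ?_⟩
      convert CylSum.cyl (Y ∪ Y') (Finset.disjoint_union_right.mpr ⟨hY, hY'⟩)
        (Y.piecewise b b') (c * c') using 2 with z
      have : (∀ i ∈ Y ∪ Y', z i = Y.piecewise b b' i) ↔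
          (∀ i ∈ Y, z i = b i) ∧ (∀ i ∈ Y', z i = b' i) := by
        constructor
        · intro h
          refine ⟨fun i hi => by simpa [hi] using h i (Finset.mem_union_left _ hi),
            fun i hi => ?_⟩
          have h1 := h i (Finset.mem_union_right _ hi)
          by_cases hiY : i ∈ Y
          · rw [h1, Finset.piecewise_eq_of_mem _ _ _ hiY, hc i hiY hi]
          · rw [h1, Finset.piecewise_eq_of_notMem _ _ _ hiY]
        · rintro ⟨h1, h2⟩ i hi
          by_cases hiY : i ∈ Y
          · rw [Finset.piecewise_eq_of_mem _ _ _ hiY, h1 i hiY]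
          · rw [Finset.piecewise_eq_of_notMem _ _ _ hiY]
            exact h2 i ((Finset.mem_union.mp hi).resolve_left hiY)
      simp only [this]
      by_cases h1 : ∀ i ∈ Y, z i = b i
      · by_cases h2 : ∀ i ∈ Y', z i = b' i
        · rw [if_pos h1, if_pos h2, if_pos ⟨h1, h2⟩]; ring
        · rw [if_neg h2, if_neg (not_and_of_not_right _ h2)]; ring
      · rw [if_neg h1, if_neg (not_and_of_not_left _ h1)]; ring
    · refine ⟨0, by positivity, ?_⟩
      convert CylSum.zero (G := G) (U := U) using 2 with z
      beta_reduce
      by_cases h1 : ∀ i ∈ Y, z i = b i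
      · rw [if_neg (c := ∀ i ∈ Y', z i = b' i)]
        · simp
        · intro h2
          exact hc fun i hi hi' => (h1 i hi).symm.trans (h2 i hi')
      · rw [if_neg h1]; simp
  | zero => exact ⟨0, by simp, by simpa using CylSum.zero⟩
  | add _ _ h1 h2 =>
    obtain ⟨C1, hC1, h1⟩ := h1
    obtain ⟨C2, hC2, h2⟩ := h2
    refine ⟨C1 + C2, by linarith, ?_⟩
    simpa only [mul_add] using h1.add h2

lemma mul {f g : (∀ i, G i) → ℝ} {B C : ℝ} (hf : CylSum U f B) (hg : CylSum U g C) :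
    ∃ C' ≤ B * C, CylSum U (fun z => f z * g z) C' := by
  induction hf with
  | cyl Y hY b c => exact cyl_mul hg Y hY b c
  | zero => exact ⟨0, by simp, by simpa using CylSum.zero⟩
  | add _ _ h1 h2 =>
    obtain ⟨C1, hC1, h1⟩ := h1
    obtain ⟨C2, hC2, h2⟩ := h2
    refine ⟨C1 + C2, by linarith, ?_⟩
    simpa only [add_mul] using h1.add h2

lemma pow [∀ i, Nonempty (G i)] {f : (∀ i, G i) → ℝ} {B : ℝ} (hf : ∃ B' ≤ B, CylSum U f B')
    (k : ℕ) : ∃ C ≤ B ^ k, CylSum U (fun z => f z ^ k) C := by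
  obtain ⟨B', hB', hf⟩ := hf
  induction k with
  | zero => exact ⟨1, by simp, by simpa using CylSum.const (U := U) (G := G) 1⟩
  | succ k ih =>
    obtain ⟨C, hC, h⟩ := ih
    obtain ⟨C', hC', h'⟩ := h.mul hf
    refine ⟨C', hC'.trans ?_, by simpa only [pow_succ] using h'⟩
    rw [pow_succ]
    exact mul_le_mul hC hB' hf.nonneg (h.nonneg.trans hC)

lemma sum {σ : Type*} (T : Finset σ) (f : σ → (∀ i, G i) → ℝ) (B : σ → ℝ)
    (h : ∀ s ∈ T, ∃ C ≤ B s, CylSum U (f s) C) :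
    ∃ C ≤ ∑ s ∈ T, B s, CylSum U (fun z => ∑ s ∈ T, f s z) C := by
  classical
  induction T using Finset.induction_on with
  | empty => exact ⟨0, by simp, by simpa using CylSum.zero⟩
  | insert a T ha ih =>
    obtain ⟨C, hC, h1⟩ := ih fun s hs => h s (Finset.mem_insert_of_mem hs)
    obtain ⟨C', hC', h2⟩ := h a (Finset.mem_insert_self _ _)
    refine ⟨C' + C, ?_, ?_⟩
    · rw [Finset.sum_insert ha]; exact add_le_add hC' hC
    · simpa only [Finset.sum_insert ha] using h2.add h1

lemma const_mul [∀ i, Nonempty (G i)] {f : (∀ i, G i) → ℝ} {B : ℝ}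
    (hf : ∃ B' ≤ B, CylSum U f B') (c : ℝ) :
    ∃ C ≤ |c| * B, CylSum U (fun z => c * f z) C := by
  obtain ⟨B', hB', hf⟩ := hf
  obtain ⟨C, hC, h⟩ := (CylSum.const (U := U) (G := G) c).mul hf
  exact ⟨C, hC.trans (mul_le_mul_of_nonneg_left hB' (abs_nonneg _)), h⟩

lemma prod_mker [∀ i, Nonempty (G i)] [∀ i, Fintype (G i)] (u : ∀ i, G i) (S : Finset ι)
    (hS : Disjoint U S) :
    ∃ C ≤ ∏ i ∈ S, ((Fintype.card (G i) : ℝ) + 1),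
      CylSum U (fun z => ∏ i ∈ S, mker (u i) (z i)) C := by
  induction S using Finset.induction_on with
  | empty => exact ⟨1, by simp, by simpa using CylSum.const (U := U) (G := G) 1⟩
  | insert a S ha ih =>
    rw [Finset.disjoint_insert_right] at hS
    obtain ⟨C, hC, h⟩ := ih hS.2
    have h1 : CylSum U (fun z => mker (u a) (z a)) ((Fintype.card (G a) : ℝ) + 1) := by
      have := (CylSum.cyl (U := U) {a} (by simpa using hS.1) u (Fintype.card (G a) : ℝ)).add
        (CylSum.const (-1))
      simp only [abs_neg, abs_one, Nat.abs_cast, Finset.mem_singleton, forall_eq] at this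
      convert this using 2 with z
      simp only [mker, eq_comm (a := u a)]
      ring
    obtain ⟨C', hC', h2⟩ := h1.mul h
    refine ⟨C', hC'.trans ?_, ?_⟩
    · rw [Finset.prod_insert ha]
      exact mul_le_mul_of_nonneg_left hC (by positivity)
    · simpa only [Finset.prod_insert ha] using h2

/-- Averages of cylinder sums over an equidistributed family are close to their expectation. -/
lemma sum_le_expect [∀ i, Nonempty (G i)] [∀ i, Fintype (G i)] {X : Type*} [Fintype X]
    [Nonempty X] (φ : X → ∀ i, G i)
    (heq : ∀ (V : Finset ι) (y : ∀ i, G i), |((Finset.univ.filter fun x => ∀ i ∈ V, φ x i = y i).card : ℝ)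
      - (Fintype.card X : ℝ) / ∏ i ∈ V, (Fintype.card (G i) : ℝ)| ≤ 1)
    {f : (∀ i, G i) → ℝ} {B : ℝ} (hf : CylSum U f B) {V : Finset ι} (hV : V ⊆ U) (y : ∀ i, G i) :
    |(∏ i ∈ V, (Fintype.card (G i) : ℝ)) / Fintype.card X *
      (∑ x with ∀ i ∈ V, φ x i = y i, f (φ x)) - 𝔼 z, f z| ≤
      (∏ i ∈ V, (Fintype.card (G i) : ℝ)) / Fintype.card X * B := by
  have hX : (0 : ℝ) < Fintype.card X := by exact_mod_cast Fintype.card_pos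
  have hc : ∀ i, (0 : ℝ) < Fintype.card (G i) := fun i => by exact_mod_cast Fintype.card_pos
  induction hf with
  | zero => simp
  | @add f g B C _ _ h1 h2 =>
    rw [Finset.sum_add_distrib, Finset.expect_add_distrib, mul_add, mul_add]
    refine le_trans (le_of_eq ?_) ((abs_add_le _ _).trans (add_le_add h1 h2))
    congr 1
    ring
  | cyl Y hY b c =>
    have hVY : Disjoint V Y := Finset.disjoint_of_subset_left hV hY
    have h1 := heq (V ∪ Y) (V.piecewise y b)
    have hcond : ∀ x, (∀ i ∈ V ∪ Y, φ x i = V.piecewise y b i) ↔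
        (∀ i ∈ V, φ x i = y i) ∧ (∀ i ∈ Y, φ x i = b i) := by
      intro x
      constructor
      · intro h
        refine ⟨fun i hi => by simpa [hi] using h i (Finset.mem_union_left _ hi),
            fun i hi => ?_⟩
        have := h i (Finset.mem_union_right _ hi)
        rwa [Finset.piecewise_eq_of_notMem _ _ _ (Finset.disjoint_right.mp hVY hi)] at this
      · rintro ⟨h1, h2⟩ i hi
        rcases Finset.mem_union.mp hi with hi | hi
        · rw [Finset.piecewise_eq_of_mem _ _ _ hi, h1 i hi]
        · rw [Finset.piecewise_eq_of_notMem _ _ _ (Finset.disjoint_right.mp hVY hi), h2 i hi]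
    simp only [hcond] at h1
    have h2 : ∑ x with ∀ i ∈ V, φ x i = y i, (c * if ∀ i ∈ Y, φ x i = b i then (1 : ℝ) else 0) =
        c * ((Finset.univ.filter fun x => (∀ i ∈ V, φ x i = y i) ∧
          ∀ i ∈ Y, φ x i = b i).card : ℝ) := by
      rw [← Finset.mul_sum, ← Finset.sum_filter, Finset.filter_filter]
      simp
    have h3 : 𝔼 z : ∀ i, G i, (c * if ∀ i ∈ Y, z i = b i then (1 : ℝ) else 0) =
        c * (∏ i ∈ Y, (Fintype.card (G i) : ℝ))⁻¹ := by
      rw [← Finset.mul_expect]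
      congr 1
      have := expect_prod_apply_finset (G := G) Y (fun i a => if a = b i then (1 : ℝ) else 0)
      simp only [Fintype.expect_eq_sum_div_card, Finset.sum_ite_eq', Finset.mem_univ, if_true,
        one_div, Finset.prod_inv_distrib] at this
      rw [← this, Fintype.expect_eq_sum_div_card]
      congr 1
      refine Finset.sum_congr rfl fun z _ => ?_
      rw [Finset.prod_ite_zero]
      simp
    beta_reduce
    rw [h2, h3]
    rw [Finset.prod_union hVY] at h1
    set N := ((Finset.univ.filter fun x => (∀ i ∈ V, φ x i = y i) ∧
          ∀ i ∈ Y, φ x i = b i).card : ℝ)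
    have hmV : 0 < ∏ i ∈ V, (Fintype.card (G i) : ℝ) := Finset.prod_pos fun i _ => hc i
    have hmY : 0 < ∏ i ∈ Y, (Fintype.card (G i) : ℝ) := Finset.prod_pos fun i _ => hc i
    set mV := ∏ i ∈ V, (Fintype.card (G i) : ℝ)
    set mY := ∏ i ∈ Y, (Fintype.card (G i) : ℝ)
    have e : mV / Fintype.card X * (c * N) - c * mY⁻¹ =
        (mV / Fintype.card X * c) * (N - Fintype.card X / (mV * mY)) := by
      field_simp
    rw [e, abs_mul, abs_mul, abs_of_pos (div_pos hmV hX)]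
    calc _ ≤ mV / Fintype.card X * |c| * 1 := by gcongr
      _ = _ := mul_one _

end CylSum

end Cylinder

set_option linter.unusedSectionVars false

section KernelAverage

variable {ι : Type*} [DecidableEq ι] {G : ι → Type*} [∀ i, Fintype (G i)]
  [∀ i, DecidableEq (G i)] {X : Type*} [Fintype X] (φ : X → ∀ i, G i) (A : Finset X)

/-- The component of the distribution of `A` depending exactly on the coordinates in `S`. -/
noncomputable def kerAvg (S : Finset ι) (z : ∀ i, G i) : ℝ :=
  (∑ x ∈ A, ∏ i ∈ S, mker (φ x i) (z i)) / Fintype.card X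

lemma kerAvg_congr {S : Finset ι} {z z' : ∀ i, G i} (h : ∀ i ∈ S, z i = z' i) :
    kerAvg φ A S z = kerAvg φ A S z' := by
  unfold kerAvg
  congr 1
  refine Finset.sum_congr rfl fun x _ => Finset.prod_congr rfl fun i hi => ?_
  rw [h i hi]

lemma sum_kerAvg_update {S : Finset ι} {i : ι} (hi : i ∈ S) (z : ∀ i, G i) :
    ∑ a, kerAvg φ A S (Function.update z i a) = 0 := by
  unfold kerAvg
  rw [← Finset.sum_div, Finset.sum_comm, Finset.sum_eq_zero, zero_div]
  intro x _
  have : ∀ a, ∏ j ∈ S, mker (φ x j) (Function.update z i a j) =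
      mker (φ x i) a * ∏ j ∈ S.erase i, mker (φ x j) (z j) := by
    intro a
    rw [← Finset.mul_prod_erase _ _ hi, Function.update_self]
    congr 1
    refine Finset.prod_congr rfl fun j hj => ?_
    rw [Function.update_of_ne (Finset.ne_of_mem_erase hj)]
  simp only [this, ← Finset.sum_mul, sum_mker, zero_mul]

lemma kerAvg_piecewise {U S : Finset ι} (hUS : Disjoint U S) (y z : ∀ i, G i) :
    kerAvg φ A (U ∪ S) (U.piecewise y z) =
      (∑ x ∈ A, (∏ i ∈ U, mker (φ x i) (y i)) * ∏ i ∈ S, mker (φ x i) (z i)) /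
        Fintype.card X := by
  unfold kerAvg
  congr 1
  refine Finset.sum_congr rfl fun x _ => ?_
  rw [Finset.prod_union hUS]
  congr 1
  · refine Finset.prod_congr rfl fun i hi => ?_
    rw [Finset.piecewise_eq_of_mem _ _ _ hi]
  · refine Finset.prod_congr rfl fun i hi => ?_
    rw [Finset.piecewise_eq_of_notMem _ _ _ (Finset.disjoint_right.mp hUS hi)]

variable [Fintype ι] [∀ i, Nonempty (G i)]

lemma expect_kerAvg_sq {U S : Finset ι} (hUS : Disjoint U S) (y : ∀ i, G i) :
    𝔼 z, kerAvg φ A (U ∪ S) (U.piecewise y z) ^ 2 =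
      (∑ x ∈ A, (∏ i ∈ U, mker (φ x i) (y i)) * kerAvg φ A (U ∪ S) (U.piecewise y (φ x))) /
        Fintype.card X := by
  set n : ℝ := (Fintype.card X : ℝ)
  set c : X → ℝ := fun x => ∏ i ∈ U, mker (φ x i) (y i)
  have h1 : ∀ z, kerAvg φ A (U ∪ S) (U.piecewise y z) ^ 2 =
      ∑ x ∈ A, ∑ x' ∈ A, (c x * c x' / n ^ 2) *
        ∏ i ∈ S, mker (φ x i) (z i) * mker (φ x' i) (z i) := by
    intro z
    rw [kerAvg_piecewise φ A hUS, div_pow, sq, Finset.sum_mul_sum, Finset.sum_div]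
    refine Finset.sum_congr rfl fun x _ => ?_
    rw [Finset.sum_div]
    refine Finset.sum_congr rfl fun x' _ => ?_
    rw [Finset.prod_mul_distrib]
    ring
  have h2 : ∀ x x', 𝔼 z : ∀ i, G i, ∏ i ∈ S, mker (φ x i) (z i) * mker (φ x' i) (z i) =
      ∏ i ∈ S, mker (φ x i) (φ x' i) := by
    intro x x'
    rw [expect_prod_apply_finset S fun i a => mker (φ x i) a * mker (φ x' i) a]
    simp only [expect_mker_mul]
  simp only [h1]
  rw [Finset.expect_sum_comm, Finset.sum_div]
  refine Finset.sum_congr rfl fun x _ => ?_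
  rw [Finset.expect_sum_comm]
  simp only [← Finset.mul_expect, h2]
  rw [kerAvg_piecewise φ A hUS, mul_div_assoc', div_div, Finset.mul_sum, Finset.sum_div]
  refine Finset.sum_congr rfl fun x' _ => ?_
  have : ∏ i ∈ S, mker (φ x i) (φ x' i) = ∏ i ∈ S, mker (φ x' i) (φ x i) :=
    Finset.prod_congr rfl fun i _ => mker_comm _ _
  rw [this]
  ring

lemma cylSum_kerAvg [Nonempty X] {U S : Finset ι} (hUS : Disjoint U S) (y : ∀ i, G i) :
    ∃ C ≤ ∏ i ∈ U ∪ S, ((Fintype.card (G i) : ℝ) + 1),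
      CylSum U (fun z => kerAvg φ A (U ∪ S) (U.piecewise y z)) C := by
  have hX : (0 : ℝ) < Fintype.card X := by exact_mod_cast Fintype.card_pos
  have h := CylSum.sum A (fun x z => (∏ i ∈ U, mker (φ x i) (y i)) / Fintype.card X *
    ∏ i ∈ S, mker (φ x i) (z i)) (fun _ => (∏ i ∈ U ∪ S, ((Fintype.card (G i) : ℝ) + 1)) /
      Fintype.card X) (U := U) ?_
  · obtain ⟨C, hC, h⟩ := h
    refine ⟨C, hC.trans ?_, ?_⟩
    · rw [Finset.sum_const, nsmul_eq_mul, mul_div_assoc', div_le_iff₀ hX, mul_comm]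
      refine mul_le_mul_of_nonneg_left ?_ (Finset.prod_nonneg fun i _ => by positivity)
      exact_mod_cast Finset.card_le_univ A
    · convert h using 2 with z
      rw [kerAvg_piecewise φ A hUS, Finset.sum_div]
      refine Finset.sum_congr rfl fun x _ => ?_
      ring
  · intro x _
    obtain ⟨C, hC, h⟩ := CylSum.const_mul (CylSum.prod_mker (φ x) S hUS)
      ((∏ i ∈ U, mker (φ x i) (y i)) / Fintype.card X)
    refine ⟨C, hC.trans ?_, h⟩
    rw [abs_div, abs_of_pos hX, div_mul_eq_mul_div, Finset.prod_union hUS]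
    gcongr
    rw [Finset.abs_prod]
    exact Finset.prod_le_prod (fun i _ => abs_nonneg _) fun i _ => abs_mker_le' _ _

variable (ρ : ι → ℝ) (d : ℕ)

/-- Truncated weighted components of the derivative of `A` at `y` in the directions `U`. -/
noncomputable def truncFam (U : Finset ι) (y : ∀ i, G i) (S : Finset ι) (z : ∀ i, G i) : ℝ :=
  if U.card + S.card ≤ d then (∏ i ∈ S, ρ i) * kerAvg φ A (U ∪ S) (U.piecewise y z) else 0

/-- Weighted square norm of the derivative of `A` at `y` in the directions `U`. -/
noncomputable def derivNorm (U : Finset ι) (y : ∀ i, G i) : ℝ :=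
  ∑ S ∈ Uᶜ.powerset, 𝔼 z, truncFam φ A ρ d U y S z ^ 2

/-- The dual function of `derivNorm`. -/
noncomputable def derivDual (U : Finset ι) (y : ∀ i, G i) (z : ∀ i, G i) : ℝ :=
  ∑ S ∈ Uᶜ.powerset, (∏ i ∈ S, ρ i) * truncFam φ A ρ d U y S z

lemma disjoint_of_mem_compl_powerset {U S : Finset ι} (hS : S ∈ Uᶜ.powerset) : Disjoint U S :=
  Finset.disjoint_left.mpr fun _ hi hiS => (Finset.mem_compl.mp (Finset.mem_powerset.mp hS hiS)) hi

lemma derivNorm_nonneg (U : Finset ι) (y : ∀ i, G i) : 0 ≤ derivNorm φ A ρ d U y :=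
  Finset.sum_nonneg fun _ _ => Finset.expect_nonneg fun _ _ => sq_nonneg _

lemma derivNorm_eq (U : Finset ι) (y : ∀ i, G i) :
    derivNorm φ A ρ d U y =
      (∑ x ∈ A, (∏ i ∈ U, mker (φ x i) (y i)) * derivDual φ A ρ d U y (φ x)) /
        Fintype.card X := by
  unfold derivNorm derivDual
  simp only [Finset.mul_sum]
  rw [Finset.sum_comm, Finset.sum_div]
  refine Finset.sum_congr rfl fun S hS => ?_
  have hUS := disjoint_of_mem_compl_powerset hS
  unfold truncFam
  split_ifs with h
  · simp only [mul_pow]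
    rw [← Finset.mul_expect, expect_kerAvg_sq φ A hUS, mul_div_assoc', Finset.mul_sum]
    congr 1
    refine Finset.sum_congr rfl fun x _ => ?_
    ring
  · simp

lemma cylSum_derivDual [Nonempty X] (hρ0 : ∀ i, 0 ≤ ρ i) (hρ1 : ∀ i, ρ i ≤ 1) (U : Finset ι)
    (y : ∀ i, G i) :
    ∃ C ≤ ∑ S : Finset ι with S.card ≤ d, ∏ i ∈ S, ((Fintype.card (G i) : ℝ) + 1),
      CylSum U (derivDual φ A ρ d U y) C := by
  have h := CylSum.sum (U := U) Uᶜ.powerset (fun S z => (∏ i ∈ S, ρ i) * truncFam φ A ρ d U y S z)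
    (fun S => if U.card + S.card ≤ d then ∏ i ∈ U ∪ S, ((Fintype.card (G i) : ℝ) + 1) else 0) ?_
  · obtain ⟨C, hC, h⟩ := h
    refine ⟨C, hC.trans ?_, h⟩
    rw [← Finset.sum_filter]
    have hinj : Set.InjOn (fun S => U ∪ S) (Uᶜ.powerset.filter fun S => U.card + S.card ≤ d :
        Finset (Finset ι)) := by
      intro S hS S' hS' e
      have h1 := disjoint_of_mem_compl_powerset (Finset.mem_filter.mp hS).1
      have h2 := disjoint_of_mem_compl_powerset (Finset.mem_filter.mp hS').1
      have e : U ∪ S = U ∪ S' := e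
      rw [← Finset.union_sdiff_cancel_left h1, e, Finset.union_sdiff_cancel_left h2]
    rw [← Finset.sum_image (f := fun S => ∏ i ∈ S, ((Fintype.card (G i) : ℝ) + 1)) hinj]
    refine Finset.sum_le_sum_of_subset_of_nonneg ?_ fun S _ _ =>
      Finset.prod_nonneg fun i _ => by positivity
    intro T hT
    obtain ⟨S, hS, rfl⟩ := Finset.mem_image.mp hT
    rw [Finset.mem_filter] at hS ⊢
    exact ⟨Finset.mem_univ _, (Finset.card_union_le _ _).trans hS.2⟩
  · intro S hS
    have hUS := disjoint_of_mem_compl_powerset hS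
    have hp0 : 0 ≤ ∏ i ∈ S, ρ i := Finset.prod_nonneg fun i _ => hρ0 i
    have hp1 : ∏ i ∈ S, ρ i ≤ 1 := Finset.prod_le_one (fun i _ => hρ0 i) fun i _ => hρ1 i
    unfold truncFam
    split_ifs with hd
    · obtain ⟨C, hC, h⟩ := CylSum.const_mul (cylSum_kerAvg φ A hUS y)
        ((∏ i ∈ S, ρ i) * ∏ i ∈ S, ρ i)
      refine ⟨C, hC.trans ?_, by simpa only [mul_assoc] using h⟩
      rw [abs_of_nonneg (by positivity)]
      refine mul_le_of_le_one_left (Finset.prod_nonneg fun i _ => by positivity) ?_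
      exact mul_le_one₀ hp1 hp0 hp1
    · exact ⟨0, le_rfl, by simpa using CylSum.zero⟩

lemma expect_derivDual_pow_le {τ : ι → ℝ} {k : ℕ} (hk : 1 ≤ k) (hρ : ∀ i, 0 ≤ ρ i)
    (hτ : ∀ i, τ i ≤ 1) (hρτ : ∀ i, 4 * k * ρ i ≤ τ i)
    (hsum : ∑ i, (4 * τ i ^ 2) ^ k ≤ 1 / 2) {Ψ : ℝ}
    (hΨ : ∀ U y, derivNorm φ A ρ d U y ≤ 4 ^ U.card * Ψ) (U : Finset ι) (y : ∀ i, G i) :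
    𝔼 z, (derivDual φ A ρ d U y z ^ 2) ^ k ≤ 2 * (4 ^ U.card * Ψ) ^ k := by
  have hρ1 : ∀ i, ρ i ≤ 1 := by
    intro i
    have h1 : (1 : ℝ) ≤ k := by exact_mod_cast hk
    nlinarith [hρ i, hτ i, hρτ i]
  refine (hypercontractive hk hρ hτ hρτ Uᶜ (truncFam φ A ρ d U y) ?_ ?_).trans ?_
  · intro S hS i hi hiS z a
    unfold truncFam
    split_ifs
    · congr 1
      refine kerAvg_congr φ A fun j hj => ?_
      have hij : j ≠ i := by
        rintro rfl
        rcases Finset.mem_union.mp hj with h | h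
        · exact Finset.mem_compl.mp hi h
        · exact hiS h
      by_cases hjU : j ∈ U <;> simp [hjU, hij]
    · rfl
  · intro S hS i hi z
    unfold truncFam
    split_ifs
    · rw [← Finset.mul_sum]
      have hiU : i ∉ U := Finset.mem_compl.mp (hS hi)
      simp only [piecewise_update_left hiU]
      rw [sum_kerAvg_update φ A (Finset.mem_union_right _ hi), mul_zero]
    · simp
  · have key : ∀ V ∈ Uᶜ.powerset, ∀ z, (∑ S ∈ Uᶜ.powerset with V ⊆ S,
        𝔼 w, truncFam φ A ρ d U y S ((Uᶜ \ V).piecewise w z) ^ 2) ≤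
          4 ^ V.card * (4 ^ U.card * Ψ) := by
      intro V hV z
      have hUV := disjoint_of_mem_compl_powerset hV
      have h1 := hΨ (U ∪ V) (U.piecewise y z)
      rw [Finset.card_union_of_disjoint hUV, pow_add] at h1
      refine le_trans ?_ (h1.trans (le_of_eq (by ring)))
      unfold derivNorm
      have himg : Uᶜ.powerset.filter (fun S => V ⊆ S) = (U ∪ V)ᶜ.powerset.image (fun S => V ∪ S) := by
        ext S
        simp only [Finset.mem_filter, Finset.mem_powerset, Finset.mem_image]
        constructor
        · rintro ⟨h1, h2⟩
          refine ⟨S \ V, ?_, Finset.union_sdiff_of_subset h2⟩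
          intro i hi
          rw [Finset.mem_sdiff] at hi
          have := Finset.mem_compl.mp (h1 hi.1)
          simp [this, hi.2]
        · rintro ⟨S', h1, rfl⟩
          refine ⟨Finset.union_subset (Finset.mem_powerset.mp hV) fun i hi => ?_,
            Finset.subset_union_left⟩
          have := h1 hi
          simp only [Finset.mem_compl, Finset.mem_union, not_or] at this
          exact Finset.mem_compl.mpr this.1
      have hdis : ∀ S ∈ (U ∪ V)ᶜ.powerset, Disjoint V S := fun S hS =>
        Finset.disjoint_of_subset_left Finset.subset_union_right
          (disjoint_of_mem_compl_powerset hS)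
      have hinj : Set.InjOn (fun S => V ∪ S) ((U ∪ V)ᶜ.powerset : Finset (Finset ι)) := by
        intro S hS S' hS' e
        have e : V ∪ S = V ∪ S' := e
        rw [← Finset.union_sdiff_cancel_left (hdis S hS), e,
          Finset.union_sdiff_cancel_left (hdis S' hS')]
      rw [himg, Finset.sum_image hinj]
      refine Finset.sum_le_sum fun S hS => Finset.expect_le_expect fun w _ => ?_
      unfold truncFam
      have hcard : U.card + (V ∪ S).card = (U ∪ V).card + S.card := by
        rw [Finset.card_union_of_disjoint (hdis S hS), Finset.card_union_of_disjoint hUV, add_assoc]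
      rw [hcard]
      split_ifs
      · rw [mul_pow, mul_pow]
        have e : kerAvg φ A (U ∪ (V ∪ S)) (U.piecewise y ((Uᶜ \ V).piecewise w z)) =
            kerAvg φ A (U ∪ V ∪ S) ((U ∪ V).piecewise (U.piecewise y z) w) := by
          rw [Finset.union_assoc]
          refine kerAvg_congr φ A fun i hi => ?_
          by_cases h1 : i ∈ U
          · simp [h1]
          · by_cases h2 : i ∈ V <;> simp [h1, h2]
        rw [e]
        refine mul_le_mul_of_nonneg_right ?_ (sq_nonneg _)
        refine pow_le_pow_left₀ (Finset.prod_nonneg fun i _ => hρ i) ?_ 2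
        rw [Finset.prod_union (hdis S hS)]
        refine mul_le_of_le_one_left (Finset.prod_nonneg fun i _ => hρ i) ?_
        exact Finset.prod_le_one (fun i _ => hρ i) fun i _ => hρ1 i
      · exact le_rfl
    have hW : 0 ≤ (4 ^ U.card * Ψ) ^ k :=
      pow_nonneg ((derivNorm_nonneg φ A ρ d U y).trans (hΨ U y)) _
    calc _ ≤ ∑ V ∈ Uᶜ.powerset, (∏ i ∈ V, τ i ^ 2) ^ k * (4 ^ V.card * (4 ^ U.card * Ψ)) ^ k := by
          refine Finset.sum_le_sum fun V hV => mul_le_mul_of_nonneg_left ?_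
            (pow_nonneg (Finset.prod_nonneg fun i _ => sq_nonneg _) _)
          refine Finset.expect_le Finset.univ_nonempty fun z _ => ?_
          refine pow_le_pow_left₀ (Finset.sum_nonneg fun _ _ =>
            Finset.expect_nonneg fun _ _ => sq_nonneg _) (key V hV z) _
      _ = (∏ i ∈ Uᶜ, (1 + (4 * τ i ^ 2) ^ k)) * (4 ^ U.card * Ψ) ^ k := by
          rw [Finset.prod_one_add, Finset.sum_mul]
          refine Finset.sum_congr rfl fun V _ => ?_
          rw [Finset.prod_pow V k fun i => 4 * τ i ^ 2, Finset.prod_mul_distrib, Finset.prod_const]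
          ring
      _ ≤ 2 * (4 ^ U.card * Ψ) ^ k := by
          refine mul_le_mul_of_nonneg_right ?_ hW
          have hpos : ∀ i, 0 ≤ (4 * τ i ^ 2) ^ k := fun i => by positivity
          calc ∏ i ∈ Uᶜ, (1 + (4 * τ i ^ 2) ^ k) ≤ ∏ i ∈ Uᶜ, Real.exp ((4 * τ i ^ 2) ^ k) :=
                Finset.prod_le_prod (fun i _ => by linarith [hpos i]) fun i _ => by
                  rw [add_comm]; exact Real.add_one_le_exp _
            _ = Real.exp (∑ i ∈ Uᶜ, (4 * τ i ^ 2) ^ k) := (Real.exp_sum _ _).symm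
            _ ≤ Real.exp (1 / 2) := by
                refine Real.exp_le_exp.mpr (le_trans ?_ hsum)
                exact Finset.sum_le_sum_of_subset_of_nonneg (Finset.subset_univ _)
                  fun i _ _ => hpos i
            _ ≤ 2 := by
                have h1 := Real.exp_one_lt_d9
                have h2 : Real.exp (1 / 2) ^ 2 = Real.exp 1 := by
                  rw [← Real.exp_nat_mul]; norm_num
                nlinarith [Real.exp_pos (1 / 2 : ℝ)]

end KernelAverage

section RoughEnergy

lemma pow_sum_le_card_pow_mul {X : Type*} (s : Finset X) (f : X → ℝ) (hf : ∀ x ∈ s, 0 ≤ f x)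
    (j : ℕ) : (∑ x ∈ s, f x) ^ (j + 1) ≤ (s.card : ℝ) ^ j * ∑ x ∈ s, f x ^ (j + 1) := by
  rcases s.eq_empty_or_nonempty with rfl | hs
  · simp
  · have h := pow_sum_div_card_le_sum_pow (s := s) hf j
    have hc : (0 : ℝ) < s.card := by exact_mod_cast hs.card_pos
    rwa [div_le_iff₀ (by positivity), mul_comm] at h

variable {ι : Type*} [DecidableEq ι] [Fintype ι] {G : ι → Type*} [∀ i, Fintype (G i)]
  [∀ i, DecidableEq (G i)] [∀ i, Nonempty (G i)] {X : Type*} [Fintype X] [Nonempty X]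
  (φ : X → ∀ i, G i) (A : Finset X) (ρ : ι → ℝ) (d : ℕ)

/-- Global sets have small weighted low-degree energy. -/
theorem sum_expect_kerAvg_sq_le
    (heq : ∀ (V : Finset ι) (y : ∀ i, G i),
      |((Finset.univ.filter fun x => ∀ i ∈ V, φ x i = y i).card : ℝ)
        - (Fintype.card X : ℝ) / ∏ i ∈ V, (Fintype.card (G i) : ℝ)| ≤ 1)
    {δ : ℝ} (hδ : 0 < δ)
    (hA : ∀ (V : Finset ι), V.card ≤ d → ∀ y : ∀ i, G i,
      (∏ i ∈ V, (Fintype.card (G i) : ℝ)) * ((A.filter fun x => ∀ i ∈ V, φ x i = y i).card : ℝ) ≤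
        δ * Fintype.card X)
    {τ : ι → ℝ} {k : ℕ} (hk : 1 ≤ k) (hρ : ∀ i, 0 ≤ ρ i)
    (hτ : ∀ i, τ i ≤ 1) (hρτ : ∀ i, 4 * k * ρ i ≤ τ i)
    (hsum : ∑ i, (4 * τ i ^ 2) ^ k ≤ 1 / 2) (hkδ : 3 ≤ δ * 4 ^ (2 * k))
    {B : ℝ} (hB : ∑ S : Finset ι with S.card ≤ d, ∏ i ∈ S, ((Fintype.card (G i) : ℝ) + 1) ≤ B)
    (hX : B ^ (2 * k + 1) ≤ δ ^ (2 * k) * Fintype.card X) :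
    ∑ S : Finset ι with S.card ≤ d, (∏ i ∈ S, ρ i) ^ 2 * 𝔼 z, kerAvg φ A S z ^ 2 ≤
      16 * δ ^ 2 := by
  have hn : (0 : ℝ) < Fintype.card X := by exact_mod_cast Fintype.card_pos
  have hc : ∀ i, (0 : ℝ) < Fintype.card (G i) := fun i => by exact_mod_cast Fintype.card_pos
  have hρ1 : ∀ i, ρ i ≤ 1 := by
    intro i
    have h1 : (1 : ℝ) ≤ k := by exact_mod_cast hk
    nlinarith [hρ i, hτ i, hρτ i]
  obtain ⟨⟨U, y⟩, hmax⟩ := Finite.exists_max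
    (fun p : Finset ι × (∀ i, G i) => derivNorm φ A ρ d p.1 p.2 / 4 ^ p.1.card)
  set Ψ := derivNorm φ A ρ d U y / 4 ^ U.card with hΨdef
  have hΨ : ∀ U y, derivNorm φ A ρ d U y ≤ 4 ^ U.card * Ψ := by
    intro U' y'
    have := hmax (U', y')
    rw [div_le_iff₀ (by positivity), mul_comm] at this
    exact this
  have hΨ0 : 0 ≤ Ψ := div_nonneg (derivNorm_nonneg φ A ρ d U y) (by positivity)
  have hmain : Ψ ≤ 16 * δ ^ 2 := by
    by_contra hlt
    push Not at hlt
    have hUd : U.card ≤ d := by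
      by_contra hU
      have : derivNorm φ A ρ d U y = 0 := by
        unfold derivNorm truncFam
        refine Finset.sum_eq_zero fun S _ => ?_
        have : ¬ U.card + S.card ≤ d := by omega
        simp [this]
      rw [hΨdef, this, zero_div] at hlt
      nlinarith
    set H := derivDual φ A ρ d U y with hH
    set Φ := Real.sqrt Ψ with hΦ
    have hΦ2 : Φ ^ 2 = Ψ := Real.sq_sqrt hΨ0
    have hΦδ : 4 * δ < Φ := by
      rw [hΦ]
      refine Real.lt_sqrt_of_sq_lt ?_
      nlinarith
    set K := 2 ^ U.card * Φ with hK
    have hKδ : δ ≤ K := by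
      have : (1 : ℝ) ≤ 2 ^ U.card := one_le_pow₀ (by norm_num)
      nlinarith
    obtain ⟨j, hj⟩ : ∃ j, 2 * k = j + 1 := ⟨2 * k - 1, by omega⟩
    have hEH : 𝔼 z, |H z| ^ (j + 1) ≤ 2 * K ^ (j + 1) := by
      have h := expect_derivDual_pow_le φ A ρ d hk hρ hτ hρτ hsum hΨ U y
      have e1 : ∀ z, |H z| ^ (j + 1) = (H z ^ 2) ^ k := by
        intro z
        rw [← hj, pow_mul, sq_abs]
      have e2 : K ^ (j + 1) = (4 ^ U.card * Ψ) ^ k := by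
        rw [← hj, pow_mul, hK, mul_pow, hΦ2, ← pow_mul, mul_comm U.card, pow_mul]
        norm_num
      simp only [e1, e2]
      exact h
    have hBS : ∀ S : Finset ι, S.card ≤ d → ∏ i ∈ S, ((Fintype.card (G i) : ℝ) + 1) ≤ B := by
      intro S hS
      refine le_trans ?_ hB
      exact Finset.single_le_sum (f := fun S => ∏ i ∈ S, ((Fintype.card (G i) : ℝ) + 1))
        (fun i _ => Finset.prod_nonneg fun i _ => by positivity) (by simpa using hS)
    have hB0 : 0 ≤ B := (Finset.prod_nonneg fun i _ => by positivity).trans (hBS ∅ (by simp))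
    have hT : ∀ V ⊆ U, (∏ i ∈ V, (Fintype.card (G i) : ℝ)) / Fintype.card X *
        (∑ x ∈ A with ∀ i ∈ V, φ x i = y i, |H (φ x)|) ≤ 4 * δ * K := by
      intro V hV
      have hVd : V.card ≤ d := (Finset.card_le_card hV).trans hUd
      have hmV : 0 < ∏ i ∈ V, (Fintype.card (G i) : ℝ) := Finset.prod_pos fun i _ => hc i
      have hmB : ∏ i ∈ V, (Fintype.card (G i) : ℝ) ≤ B :=
        (Finset.prod_le_prod (fun i _ => (hc i).le) fun i _ => by linarith).trans (hBS V hVd)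
      have h0 := hA V hVd y
      set mV := ∏ i ∈ V, (Fintype.card (G i) : ℝ)
      set n : ℝ := (Fintype.card X : ℝ)
      set AV := A.filter fun x => ∀ i ∈ V, φ x i = y i
      have ha : 0 < mV / n := div_pos hmV hn
      have h1 : mV / n * AV.card ≤ δ := by
        rw [div_mul_eq_mul_div, div_le_iff₀ hn]; exact h0
      have h2 := pow_sum_le_card_pow_mul AV (fun x => |H (φ x)|) (fun x _ => abs_nonneg _) j
      have h3 : mV / n * ∑ x with ∀ i ∈ V, φ x i = y i, |H (φ x)| ^ (j + 1) ≤ 3 * K ^ (j + 1) := by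
        obtain ⟨C, hC, hcyl⟩ := CylSum.pow (cylSum_derivDual φ A ρ d hρ hρ1 U y) (2 * k)
        have h4 := CylSum.sum_le_expect φ heq hcyl hV y
        have e1 : ∀ z, H z ^ (2 * k) = |H z| ^ (j + 1) := fun z => by
          rw [← hj, pow_mul, pow_mul, sq_abs]
        rw [← hH] at h4
        simp only [e1] at h4
        have h5 := (abs_le.mp h4).2
        have hCB : C ≤ B ^ (j + 1) := by
          rw [← hj]
          refine hC.trans (pow_le_pow_left₀ ?_ hB _)
          exact Finset.sum_nonneg fun S _ => Finset.prod_nonneg fun i _ => by positivity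
        have h6 : mV / n * C ≤ K ^ (j + 1) := by
          calc mV / n * C ≤ B / n * B ^ (j + 1) := by
                refine mul_le_mul (by gcongr) hCB hcyl.nonneg (by positivity)
            _ = B ^ (2 * k + 1) / n := by rw [hj]; ring
            _ ≤ δ ^ (j + 1) := by rw [div_le_iff₀ hn, ← hj]; exact hX
            _ ≤ K ^ (j + 1) := pow_le_pow_left₀ hδ.le hKδ _
        have h7 : mV / n * ∑ x with ∀ i ∈ V, φ x i = y i, |H (φ x)| ^ (j + 1) -
          𝔼 z, |H z| ^ (j + 1) ≤ mV / n * C := h5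
        linarith
      have hsub : ∑ x ∈ AV, |H (φ x)| ^ (j + 1) ≤
          ∑ x with ∀ i ∈ V, φ x i = y i, |H (φ x)| ^ (j + 1) := by
        refine Finset.sum_le_sum_of_subset_of_nonneg ?_ fun _ _ _ => by positivity
        exact Finset.filter_subset_filter _ (Finset.subset_univ _)
      have hs0 : 0 ≤ ∑ x ∈ AV, |H (φ x)| := Finset.sum_nonneg fun _ _ => abs_nonneg _
      have hK0 : 0 < K := hδ.trans_le hKδ
      refine le_of_pow_le_pow_left₀ (n := j + 1) (by omega) (by positivity) ?_
      calc (mV / n * ∑ x ∈ AV, |H (φ x)|) ^ (j + 1)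
          = (mV / n) ^ (j + 1) * (∑ x ∈ AV, |H (φ x)|) ^ (j + 1) := mul_pow _ _ _
        _ ≤ (mV / n) ^ (j + 1) * ((AV.card : ℝ) ^ j * ∑ x ∈ AV, |H (φ x)| ^ (j + 1)) := by
            gcongr
        _ = (mV / n * AV.card) ^ j * (mV / n * ∑ x ∈ AV, |H (φ x)| ^ (j + 1)) := by
            ring
        _ ≤ δ ^ j * (3 * K ^ (j + 1)) := by
            refine mul_le_mul (pow_le_pow_left₀ (by positivity) h1 _) ?_ (by positivity)
              (by positivity)
            exact (mul_le_mul_of_nonneg_left hsub ha.le).trans h3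
        _ ≤ δ ^ j * ((δ * 4 ^ (j + 1)) * K ^ (j + 1)) := by
            rw [hj] at hkδ
            gcongr
        _ = (4 * δ * K) ^ (j + 1) := by ring
    have hN : derivNorm φ A ρ d U y ≤ 2 ^ U.card * (4 * δ * K) := by
      rw [derivNorm_eq, div_le_iff₀ hn]
      calc ∑ x ∈ A, (∏ i ∈ U, mker (φ x i) (y i)) * H (φ x)
          ≤ ∑ x ∈ A, ∑ V ∈ U.powerset, (∏ i ∈ V, (Fintype.card (G i) : ℝ)) *
              ((if ∀ i ∈ V, φ x i = y i then 1 else 0) * |H (φ x)|) := by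
            refine Finset.sum_le_sum fun x _ => ?_
            calc _ ≤ |(∏ i ∈ U, mker (φ x i) (y i)) * H (φ x)| := le_abs_self _
              _ = (∏ i ∈ U, |mker (φ x i) (y i)|) * |H (φ x)| := by rw [abs_mul, Finset.abs_prod]
              _ ≤ (∏ i ∈ U, ((Fintype.card (G i) : ℝ) * (if φ x i = y i then 1 else 0) + 1)) *
                  |H (φ x)| := by
                  refine mul_le_mul_of_nonneg_right ?_ (abs_nonneg _)
                  exact Finset.prod_le_prod (fun i _ => abs_nonneg _) fun i _ => abs_mker_le _ _
              _ = _ := by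
                  rw [Finset.prod_add_one, Finset.sum_mul]
                  refine Finset.sum_congr rfl fun V _ => ?_
                  rw [Finset.prod_mul_distrib, Finset.prod_ite_zero, Finset.prod_const_one]
                  ring_nf
        _ = ∑ V ∈ U.powerset, (∏ i ∈ V, (Fintype.card (G i) : ℝ)) *
              (∑ x ∈ A with ∀ i ∈ V, φ x i = y i, |H (φ x)|) := by
            rw [Finset.sum_comm]
            refine Finset.sum_congr rfl fun V _ => ?_
            rw [← Finset.mul_sum, Finset.sum_filter]
            simp
        _ ≤ ∑ V ∈ U.powerset, 4 * δ * K * Fintype.card X := by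
            refine Finset.sum_le_sum fun V hV => ?_
            have := hT V (Finset.mem_powerset.mp hV)
            rwa [div_mul_eq_mul_div, div_le_iff₀ hn] at this
        _ = _ := by
            rw [Finset.sum_const, Finset.card_powerset, nsmul_eq_mul]
            push_cast; ring
    have e : derivNorm φ A ρ d U y = 2 ^ U.card * 2 ^ U.card * Φ ^ 2 := by
      rw [hΦ2, hΨdef, ← mul_pow]
      norm_num
      field_simp
    rw [e, hK] at hN
    have hp : (0 : ℝ) < 2 ^ U.card * 2 ^ U.card * Φ := by
      have : 0 < Φ := by linarith
      positivity
    nlinarith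
  have hfin := hΨ ∅ y
  simp only [Finset.card_empty, pow_zero, one_mul] at hfin
  refine le_trans (le_of_eq ?_) (hfin.trans hmain)
  unfold derivNorm truncFam
  rw [Finset.sum_filter]
  simp only [Finset.compl_empty, Finset.powerset_univ, Finset.card_empty, zero_add,
    Finset.empty_union]
  refine Finset.sum_congr rfl fun S _ => ?_
  split_ifs
  · simp [mul_pow, Finset.mul_expect]
  · simp

end RoughEnergy

section IntervalEnergy

/-- Numerators with support `S` for the moduli `P`. -/
def numTuples {ι : Type*} [DecidableEq ι] [Fintype ι] (P : ι → ℕ) (S : Finset ι) :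
    Finset (ι → ℕ) :=
  Fintype.piFinset fun i => if i ∈ S then Finset.Ico 1 (P i) else {0}

lemma ee_sum {σ : Type*} (s : Finset σ) (f : σ → ℝ) :
    ee (∑ i ∈ s, f i) = ∏ i ∈ s, ee (f i) := by
  classical
  induction s using Finset.induction_on with
  | empty => simp [ee_zero]
  | insert a s ha ih => rw [Finset.sum_insert ha, Finset.prod_insert ha, ee_add, ih]

lemma abs_card_modEq_sub_le (n m : ℕ) (hm : 0 < m) (r : ℕ) :
    |(((Finset.range n).filter fun t => t ≡ r [MOD m]).card : ℝ) - (n : ℝ) / m| ≤ 1 := by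
  have h := Nat.count_modEq_card n hm r
  rw [Nat.count_eq_card_filter_range] at h
  have hm' : (0 : ℝ) < m := by exact_mod_cast hm
  have hd : (n : ℝ) = m * (n / m : ℕ) + (n % m : ℕ) := by exact_mod_cast (Nat.div_add_mod n m).symm
  have hlt : ((n % m : ℕ) : ℝ) < m := by exact_mod_cast Nat.mod_lt n hm
  have h0 : (0 : ℝ) ≤ (n % m : ℕ) := by positivity
  have e : (n : ℝ) / m = (n / m : ℕ) + ((n % m : ℕ) : ℝ) / m := by
    rw [div_eq_iff hm'.ne', add_mul, div_mul_cancel₀ _ hm'.ne']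
    linarith
  have e1 : ((n % m : ℕ) : ℝ) / m < 1 := by rwa [div_lt_one hm']
  have e2 : 0 ≤ ((n % m : ℕ) : ℝ) / m := by positivity
  rw [h, e, abs_le]
  push_cast
  split_ifs <;> constructor <;> norm_num <;> linarith

lemma exists_residue {ι : Type*} {P : ι → ℕ} (hcop : Pairwise (Function.onFun Nat.Coprime P)) {W : ℕ}
    (hW : ∀ i, W.Coprime (P i)) [∀ i, NeZero (P i)] (s : ℤ) (V : Finset ι)
    (y : ∀ i, ZMod (P i)) :
    ∃ r : ℕ, ∀ t : ℕ, (∀ i ∈ V, ((s + W * t : ℤ) : ZMod (P i)) = y i) ↔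
      t ≡ r [MOD ∏ i ∈ V, P i] := by
  let u : ∀ i, (ZMod (P i))ˣ := fun i => ZMod.unitOfCoprime W (hW i)
  let c : ι → ℕ := fun i => (((u i)⁻¹ : (ZMod (P i))ˣ) * (y i - (s : ZMod (P i))) : ZMod (P i)).val
  obtain ⟨r, hr⟩ := Nat.chineseRemainderOfFinset c P V (fun i _ => NeZero.ne _)
    (fun i _ j _ hij => hcop hij)
  refine ⟨r, fun t => ?_⟩
  have h1 : ∀ i, ((s + W * t : ℤ) : ZMod (P i)) = y i ↔ t ≡ c i [MOD P i] := by
    intro i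
    rw [← ZMod.natCast_eq_natCast_iff, ZMod.natCast_zmod_val]
    have hu : ((W : ℕ) : ZMod (P i)) = u i := (ZMod.coe_unitOfCoprime W (hW i)).symm
    push_cast
    rw [hu, Units.eq_inv_mul_iff_mul_eq, ← sub_eq_iff_eq_add'.symm.trans eq_comm]
    exact eq_comm
  have h2 : (∀ i ∈ V, ((s + W * t : ℤ) : ZMod (P i)) = y i) ↔ ∀ i ∈ V, t ≡ r [MOD P i] :=
    forall₂_congr fun i hi => (h1 i).trans
      ⟨fun h => h.trans (hr i hi).symm, fun h => h.trans (hr i hi)⟩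
  rw [h2]
  constructor
  · intro h
    rw [Nat.modEq_iff_dvd]
    push_cast
    refine Finset.prod_dvd_of_coprime (fun i _ j _ hij => ?_) fun i hi =>
      Nat.modEq_iff_dvd.mp (h i hi)
    exact Nat.isCoprime_iff_coprime.mpr (hcop hij)
  · intro h i hi
    exact h.of_dvd (Finset.dvd_prod_of_mem P hi)

variable {ι : Type*} [DecidableEq ι] [Fintype ι]

lemma sum_Ico_ee {P : ℕ} [NeZero P] (a b : ℤ) :
    ∑ j ∈ Finset.Ico 1 P, ee ((j : ℝ) * (((a - b : ℤ) : ℝ) / P)) =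
      ((mker (a : ZMod P) (b : ZMod P) : ℝ) : ℂ) := by
  have hP : 0 < P := Nat.pos_of_ne_zero (NeZero.ne P)
  have h := sum_ee_div hP (a - b)
  rw [Finset.range_eq_Ico, Finset.sum_eq_sum_Ico_succ_bot hP] at h
  simp only [Nat.cast_zero, zero_mul, ee_zero, zero_add] at h
  rw [← eq_sub_iff_add_eq'] at h
  rw [h, mker, ZMod.card]
  have e : ((a : ZMod P) = (b : ZMod P)) ↔ (P : ℤ) ∣ a - b := by
    rw [ZMod.intCast_eq_intCast_iff_dvd_sub, ← dvd_neg, neg_sub]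
  simp only [e]
  split_ifs <;> simp

lemma sum_numTuples_norm_sq (P : ι → ℕ) [∀ i, NeZero (P i)] (S : Finset ι) (A : Finset ℕ)
    (v : ℕ → ℤ) :
    ∑ α ∈ numTuples P S, ‖∑ t ∈ A, ee ((v t : ℝ) * ∑ i, (α i : ℝ) / P i)‖ ^ 2 =
      ∑ t ∈ A, ∑ t' ∈ A, ∏ i ∈ S, mker (v t : ZMod (P i)) (v t' : ZMod (P i)) := by
  have key : ∑ α ∈ numTuples P S, ((‖∑ t ∈ A, ee ((v t : ℝ) * ∑ i, (α i : ℝ) / P i)‖ ^ 2 : ℝ) : ℂ)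
      = ((∑ t ∈ A, ∑ t' ∈ A, ∏ i ∈ S, mker (v t : ZMod (P i)) (v t' : ZMod (P i)) : ℝ) : ℂ) := by
    have h1 : ∀ α : ι → ℕ, ((‖∑ t ∈ A, ee ((v t : ℝ) * ∑ i, (α i : ℝ) / P i)‖ ^ 2 : ℝ) : ℂ) =
        ∑ t ∈ A, ∑ t' ∈ A, ∏ i, ee ((α i : ℝ) * (((v t - v t' : ℤ) : ℝ) / P i)) := by
      intro α
      push_cast
      rw [← Complex.mul_conj', map_sum, Finset.sum_mul_sum]
      refine Finset.sum_congr rfl fun t _ => Finset.sum_congr rfl fun t' _ => ?_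
      rw [← ee_neg, ← ee_add, ← ee_sum]
      congr 1
      rw [← sub_eq_add_neg, ← sub_mul, Finset.mul_sum]
      refine Finset.sum_congr rfl fun i _ => ?_
      ring
    simp only [h1]
    rw [Finset.sum_comm]
    push_cast
    refine Finset.sum_congr rfl fun t _ => ?_
    rw [Finset.sum_comm]
    refine Finset.sum_congr rfl fun t' _ => ?_
    rw [numTuples, ← Finset.prod_univ_sum (fun i => if i ∈ S then Finset.Ico 1 (P i) else {0})
      (fun i (j : ℕ) => ee ((j : ℝ) * ((v t - v t' : ℝ) / P i)))]
    rw [← Finset.prod_subset (Finset.subset_univ S)]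
    · refine Finset.prod_congr rfl fun i hi => ?_
      rw [if_pos hi]
      have := sum_Ico_ee (P := P i) (v t) (v t')
      push_cast at this
      exact this
    · intro i _ hi
      rw [if_neg hi]
      simp [ee_zero]
  exact_mod_cast key

/-- Low-degree Fourier energy of a set that is equidistributed in progressions. -/
theorem interval_energy {P : ι → ℕ} [∀ i, NeZero (P i)]
    (hcop : Pairwise (Function.onFun Nat.Coprime P)) {W : ℕ}
    (hW : ∀ i, W.Coprime (P i)) (s : ℤ) {n : ℕ} (hn : 0 < n) {A : Finset ℕ}
    (hAn : A ⊆ Finset.range n) {ρ τ : ι → ℝ} {d : ℕ} {δ : ℝ} (hδ : 0 < δ)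
    (hA : ∀ V : Finset ι, V.card ≤ d → ∀ r : ℕ,
      ((∏ i ∈ V, P i : ℕ) : ℝ) * ((A.filter fun t => t ≡ r [MOD ∏ i ∈ V, P i]).card : ℝ) ≤ δ * n)
    {k : ℕ} (hk : 1 ≤ k) (hρ : ∀ i, 0 ≤ ρ i)
    (hτ : ∀ i, τ i ≤ 1) (hρτ : ∀ i, 4 * k * ρ i ≤ τ i)
    (hsum : ∑ i, (4 * τ i ^ 2) ^ k ≤ 1 / 2) (hkδ : 3 ≤ δ * 4 ^ (2 * k))
    {B : ℝ} (hB : ∑ S : Finset ι with S.card ≤ d, ∏ i ∈ S, ((P i : ℝ) + 1) ≤ B)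
    (hX : B ^ (2 * k + 1) ≤ δ ^ (2 * k) * n) :
    ∑ S : Finset ι with S.card ≤ d, (∏ i ∈ S, ρ i) ^ 2 *
      ∑ α ∈ numTuples P S, ‖∑ t ∈ A, ee (((s + W * t : ℤ) : ℝ) * ∑ i, (α i : ℝ) / P i)‖ ^ 2 ≤
      16 * δ ^ 2 * n ^ 2 := by
  have : Nonempty (Fin n) := ⟨⟨0, hn⟩⟩
  set φ : Fin n → ∀ i, ZMod (P i) := fun t i => ((s + W * (t : ℕ) : ℤ) : ZMod (P i)) with hφ
  set A' : Finset (Fin n) := Finset.univ.filter fun t => (t : ℕ) ∈ A with hA'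
  have hmap : ∀ q : ℕ → Prop, [DecidablePred q] →
      (Finset.univ.filter fun t : Fin n => q t).card = ((Finset.range n).filter q).card := by
    intro q _
    rw [Finset.card_filter, Finset.card_filter, Fin.sum_univ_eq_sum_range fun t => if q t then 1 else 0]
  have hsumA : ∀ g : ℕ → ℝ, ∑ x ∈ A', g x = ∑ t ∈ A, g t := by
    intro g
    rw [hA', Finset.sum_filter, Fin.sum_univ_eq_sum_range fun t => if t ∈ A then g t else 0,
      ← Finset.sum_filter, Finset.filter_mem_eq_inter, Finset.inter_eq_right.mpr hAn]
  have hn' : (n : ℝ) ≠ 0 := by positivity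
  have hmain := sum_expect_kerAvg_sq_le φ A' ρ d ?_ hδ ?_ hk hρ hτ hρτ hsum hkδ (B := B) ?_ ?_
  · have hE : ∀ S : Finset ι, 𝔼 z, kerAvg φ A' S z ^ 2 =
        (∑ α ∈ numTuples P S, ‖∑ t ∈ A, ee (((s + W * t : ℤ) : ℝ) * ∑ i, (α i : ℝ) / P i)‖ ^ 2) /
          n ^ 2 := by
      intro S
      have h1 := expect_kerAvg_sq φ A' (Finset.disjoint_empty_left S)
        (fun i => Classical.arbitrary (ZMod (P i)))
      simp only [Finset.empty_union, Finset.piecewise_empty, Finset.prod_empty, one_mul,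
        Fintype.card_fin] at h1
      rw [h1, sum_numTuples_norm_sq P S A fun t => s + W * t]
      unfold kerAvg
      rw [Fintype.card_fin, ← Finset.sum_div, div_div, ← sq]
      congr 1
      rw [Finset.sum_comm, hsumA (fun t => ∑ x' ∈ A', ∏ i ∈ S,
        mker ((s + W * t : ℤ) : ZMod (P i)) (φ x' i))]
      refine Finset.sum_congr rfl fun t _ => ?_
      exact hsumA (fun t' => ∏ i ∈ S, mker ((s + W * t : ℤ) : ZMod (P i))
        ((s + W * t' : ℤ) : ZMod (P i)))
    simp only [hE, ← mul_div_assoc] at hmain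
    rw [← Finset.sum_div, div_le_iff₀ (by positivity)] at hmain
    exact hmain
  · intro V y
    obtain ⟨r, hr⟩ := exists_residue hcop hW s V y
    have := abs_card_modEq_sub_le n (∏ i ∈ V, P i)
      (Finset.prod_pos fun i _ => Nat.pos_of_ne_zero (NeZero.ne _)) r
    rw [← hmap] at this
    simp only [hφ, hr, ZMod.card, Fintype.card_fin]
    push_cast at this
    exact this
  · intro V hV y
    obtain ⟨r, hr⟩ := exists_residue hcop hW s V y
    have := hA V hV r
    simp only [hφ, hr, ZMod.card, Fintype.card_fin, hA', Finset.filter_filter]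
    rw [hmap fun t => t ∈ A ∧ t ≡ r [MOD ∏ i ∈ V, P i], ← Finset.filter_filter,
      Finset.filter_mem_eq_inter, Finset.inter_eq_right.mpr hAn]
    push_cast at this
    exact this
  · simpa only [ZMod.card] using hB
  · simpa only [Fintype.card_fin] using hX

end IntervalEnergy

section PartialFractions

lemma exists_split_fraction {m n : ℕ} (hm : 0 < m) (hn : 0 < n) (h : m.Coprime n) (t : ℤ) :
    ∃ x y : ℤ, (t : ℝ) / (m * n : ℝ) = (x : ℝ) / m + (y : ℝ) / n := by
  obtain ⟨x, y, hxy⟩ := Nat.isCoprime_iff_coprime.mpr h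
  refine ⟨t * y, t * x, ?_⟩
  have hm' : (m : ℝ) ≠ 0 := by positivity
  have hn' : (n : ℝ) ≠ 0 := by positivity
  have hxy' : (x : ℝ) * m + y * n = 1 := by exact_mod_cast hxy
  rw [div_add_div _ _ hm' hn']
  congr 1
  push_cast
  linear_combination (-(t : ℝ)) * hxy'

lemma exists_partial_fractions {ι : Type*} [DecidableEq ι] (P : ι → ℕ) (hP : ∀ i, 0 < P i)
    (hcop : Pairwise (Function.onFun Nat.Coprime P)) (T : Finset ι) (t : ℤ) :
    ∃ c : ι → ℤ, ∃ z : ℤ, (t : ℝ) / (∏ i ∈ T, P i : ℕ) = ∑ i ∈ T, (c i : ℝ) / P i + z := by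
  induction T using Finset.induction_on generalizing t with
  | empty => exact ⟨0, t, by simp⟩
  | insert a T ha ih =>
    have hc : (P a).Coprime (∏ i ∈ T, P i) :=
      Nat.Coprime.prod_right fun i hi => hcop fun h => ha (h ▸ hi)
    obtain ⟨x, y, hxy⟩ := exists_split_fraction (hP a) (Finset.prod_pos fun i _ => hP i) hc t
    obtain ⟨c, z, hcz⟩ := ih y
    refine ⟨Function.update c a x, z, ?_⟩
    rw [Finset.prod_insert ha, Finset.sum_insert ha, Function.update_self]
    have : ∑ i ∈ T, ((Function.update c a x i : ℤ) : ℝ) / P i = ∑ i ∈ T, (c i : ℝ) / P i := by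
      refine Finset.sum_congr rfl fun i hi => ?_
      rw [Function.update_of_ne]
      rintro rfl
      exact ha hi
    rw [this, add_assoc, ← hcz, ← hxy]
    push_cast
    ring

lemma div_eq_emod_div_add (c : ℤ) {m : ℕ} (hm : 0 < m) :
    (c : ℝ) / m = ((c % m).toNat : ℝ) / m + ((c / m : ℤ) : ℝ) := by
  have h : (((c % m).toNat : ℤ) : ℝ) = ((c % m : ℤ) : ℝ) := by
    rw [Int.toNat_of_nonneg (Int.emod_nonneg _ (by positivity))]
  have h2 : ((c % m).toNat : ℝ) = ((c % m : ℤ) : ℝ) := by rw [← h]; exact (Int.cast_natCast _).symm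
  rw [h2]
  have h3 : (c : ℝ) = (m : ℝ) * ((c / m : ℤ) : ℝ) + ((c % m : ℤ) : ℝ) := by
    exact_mod_cast (Int.mul_ediv_add_emod c m).symm
  have hm' : (m : ℝ) ≠ 0 := by positivity
  field_simp
  linarith

/-- The smooth modulus: prime powers up to `Q` of the primes up to `w`. -/
def smoothMod (w Q : ℕ) : ℕ := ∏ p ∈ (Finset.Icc 1 w).filter Nat.Prime, p ^ Nat.log p Q

/-- The primes in `(w, Q]`. -/
def roughPrimes (w Q : ℕ) : Finset ℕ := (Finset.Ioc w Q).filter Nat.Prime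

/-- The largest power of `p` up to `Q`. -/
def primePow (w Q : ℕ) (p : roughPrimes w Q) : ℕ := (p : ℕ) ^ Nat.log p Q

variable {w Q : ℕ}

lemma prime_of_roughPrimes (p : roughPrimes w Q) : (p : ℕ).Prime := (Finset.mem_filter.mp p.2).2

lemma lt_of_roughPrimes (p : roughPrimes w Q) : w < (p : ℕ) :=
  (Finset.mem_Ioc.mp (Finset.mem_filter.mp p.2).1).1

lemma le_of_roughPrimes (p : roughPrimes w Q) : (p : ℕ) ≤ Q :=
  (Finset.mem_Ioc.mp (Finset.mem_filter.mp p.2).1).2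

lemma primePow_pos (p : roughPrimes w Q) : 0 < primePow w Q p :=
  pow_pos (prime_of_roughPrimes p).pos _

instance (p : roughPrimes w Q) : NeZero (primePow w Q p) := ⟨(primePow_pos p).ne'⟩

lemma primePow_le (p : roughPrimes w Q) : primePow w Q p ≤ Q :=
  Nat.pow_log_le_self _ (by
    have := le_of_roughPrimes p
    have := (prime_of_roughPrimes p).pos
    omega)

lemma smoothMod_pos : 0 < smoothMod w Q :=
  Finset.prod_pos fun _ hp => pow_pos (Finset.mem_filter.mp hp).2.pos _

lemma primePow_coprime : Pairwise (Function.onFun Nat.Coprime (primePow w Q)) := by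
  intro p q hpq
  refine Nat.Coprime.pow _ _ ((Nat.coprime_primes (prime_of_roughPrimes p)
    (prime_of_roughPrimes q)).mpr ?_)
  exact fun h => hpq (Subtype.ext h)

lemma smoothMod_coprime (p : roughPrimes w Q) : (smoothMod w Q).Coprime (primePow w Q p) := by
  refine Nat.Coprime.prod_left fun q hq => ?_
  rw [Finset.mem_filter, Finset.mem_Icc] at hq
  refine Nat.Coprime.pow _ _ ((Nat.coprime_primes hq.2 (prime_of_roughPrimes p)).mpr ?_)
  have := lt_of_roughPrimes p
  omega

lemma smoothMod_le (hQ : 1 ≤ Q) : smoothMod w Q ≤ Q ^ w := by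
  refine (Finset.prod_le_prod' fun p hp => Nat.pow_log_le_self p (by omega)).trans ?_
  rw [Finset.prod_const]
  refine Nat.pow_le_pow_right hQ ((Finset.card_filter_le _ _).trans ?_)
  simp

lemma dvd_smoothMod_mul {b : ℕ} (hb : 1 ≤ b) (hbQ : b ≤ Q) :
    b ∣ smoothMod w Q * ∏ p : roughPrimes w Q, primePow w Q p := by
  have h1 : ∏ p : roughPrimes w Q, primePow w Q p = ∏ p ∈ roughPrimes w Q, p ^ Nat.log p Q :=
    Finset.prod_coe_sort (roughPrimes w Q) fun p => p ^ Nat.log p Q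
  have hdis : Disjoint ((Finset.Icc 1 w).filter Nat.Prime) (roughPrimes w Q) := by
    refine Finset.disjoint_left.mpr fun p h1 h2 => ?_
    rw [Finset.mem_filter, Finset.mem_Icc] at h1
    rw [roughPrimes, Finset.mem_filter, Finset.mem_Ioc] at h2
    omega
  rw [h1, smoothMod, ← Finset.prod_union hdis]
  conv_lhs => rw [← Nat.prod_factorization_pow_eq_self (n := b) (by omega)]
  have hsub : b.primeFactors ⊆ (Finset.Icc 1 w).filter Nat.Prime ∪ roughPrimes w Q := by
    intro p hp
    have hpp := Nat.prime_of_mem_primeFactors hp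
    have hpb := Nat.le_of_dvd hb (Nat.dvd_of_mem_primeFactors hp)
    rw [roughPrimes, Finset.mem_union, Finset.mem_filter, Finset.mem_filter, Finset.mem_Icc,
      Finset.mem_Ioc]
    have := hpp.pos
    by_cases h : p ≤ w
    · exact Or.inl ⟨⟨this, h⟩, hpp⟩
    · exact Or.inr ⟨⟨by omega, by omega⟩, hpp⟩
  refine dvd_trans (Finset.prod_dvd_prod_of_dvd _ _ fun p hp => ?_)
    (Finset.prod_dvd_prod_of_subset _ _ _ hsub)
  have hpp := Nat.prime_of_mem_primeFactors hp
  refine pow_dvd_pow _ (Nat.le_log_of_pow_le hpp.one_lt ?_)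
  exact (Nat.le_of_dvd hb (Nat.ordProj_dvd b p)).trans hbQ

/-- Decomposition of a fraction into its smooth part and prime power parts. -/
theorem exists_fraction_decomp {a b : ℕ} (hb : 1 ≤ b) (hbQ : b ≤ Q) :
    ∃ j < smoothMod w Q, ∃ S : Finset (roughPrimes w Q), ∃ α ∈ numTuples (primePow w Q) S,
      (∃ z : ℤ, (a : ℝ) / b = (j : ℝ) / smoothMod w Q + ∑ i, (α i : ℝ) / primePow w Q i + z) ∧
      ∏ p ∈ S, (p : ℕ) ∣ b ∧ (a.Coprime b → S = ∅ → b ∣ smoothMod w Q) := by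
  obtain ⟨t0, ht0⟩ := dvd_smoothMod_mul (w := w) hb hbQ
  set W := smoothMod w Q with hWdef
  set P := primePow w Q with hPdef
  have hW : 0 < W := smoothMod_pos
  have hP : ∀ i, 0 < P i := primePow_pos
  have hb' : (b : ℝ) ≠ 0 := by positivity
  have hprod : 0 < ∏ i, P i := Finset.prod_pos fun i _ => hP i
  have hWP : W.Coprime (∏ i, P i) := Nat.Coprime.prod_right fun i _ => smoothMod_coprime i
  obtain ⟨x, y, hxy⟩ := exists_split_fraction hW hprod hWP (a * t0 : ℤ)
  obtain ⟨c, z, hcz⟩ := exists_partial_fractions P hP primePow_coprime Finset.univ y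
  have hfrac : (a : ℝ) / b = ((a * t0 : ℤ) : ℝ) / (W * (∏ i, P i : ℕ) : ℝ) := by
    have h1 : (W : ℝ) * ((∏ i, P i : ℕ) : ℝ) = b * t0 := by exact_mod_cast ht0
    have ht : (t0 : ℝ) ≠ 0 := by
      intro h
      rw [h, mul_zero] at h1
      have : (0 : ℝ) < (W : ℝ) * ((∏ i, P i : ℕ) : ℝ) := by positivity
      linarith
    rw [h1]
    push_cast
    field_simp
  set α : roughPrimes w Q → ℕ := fun i => (c i % (P i : ℤ)).toNat with hα
  set S : Finset (roughPrimes w Q) := Finset.univ.filter fun i => α i ≠ 0 with hS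
  have hαlt : ∀ i, α i < P i := by
    intro i
    have h1 := Int.emod_lt_of_pos (c i) (by exact_mod_cast hP i : (0 : ℤ) < P i)
    have h2 := Int.emod_nonneg (c i) (by exact_mod_cast (hP i).ne' : (P i : ℤ) ≠ 0)
    simp only [hα]
    omega
  have hj : (x % (W : ℤ)).toNat < W := by
    have h1 := Int.emod_lt_of_pos x (by exact_mod_cast hW : (0 : ℤ) < W)
    have h2 := Int.emod_nonneg x (by exact_mod_cast hW.ne' : (W : ℤ) ≠ 0)
    omega
  have hmain : (a : ℝ) / b = ((x % (W : ℤ)).toNat : ℝ) / W + ∑ i, (α i : ℝ) / P i +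
      ((x / W + ∑ i, c i / (P i : ℤ) + z : ℤ) : ℝ) := by
    rw [hfrac, hxy, hcz, div_eq_emod_div_add x hW]
    have : ∑ i, (c i : ℝ) / P i = ∑ i, (α i : ℝ) / P i + ((∑ i, c i / (P i : ℤ) : ℤ) : ℝ) := by
      push_cast
      rw [← Finset.sum_add_distrib]
      exact Finset.sum_congr rfl fun i _ => div_eq_emod_div_add _ (hP i)
    rw [this]
    push_cast
    ring
  set j := (x % (W : ℤ)).toNat
  set Z : ℤ := x / W + ∑ i, c i / (P i : ℤ) + z
  have hWne : (W : ℝ) ≠ 0 := by positivity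
  have hPne : ∀ i, (P i : ℝ) ≠ 0 := fun i => by exact_mod_cast (hP i).ne'
  refine ⟨j, hj, S, α, ?_, ⟨Z, hmain⟩, ?_, ?_⟩
  · rw [numTuples, Fintype.mem_piFinset]
    intro i
    split_ifs with h
    · have : α i ≠ 0 := (Finset.mem_filter.mp h).2
      exact Finset.mem_Ico.mpr ⟨by omega, hαlt i⟩
    · simpa [hS] using h
  · have hdvd : ∀ p ∈ S, (p : ℕ) ∣ b := by
      intro p hp
      by_contra hpb
      have hne : α p ≠ 0 := (Finset.mem_filter.mp hp).2
      set K := b * W * ∏ i ∈ Finset.univ.erase p, P i with hK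
      have hKc : K.Coprime (P p) := by
        refine Nat.Coprime.mul_left (Nat.Coprime.mul_left ?_ (smoothMod_coprime p)) ?_
        · exact Nat.Coprime.pow_right _ (((Nat.Prime.coprime_iff_not_dvd
            (prime_of_roughPrimes p)).mpr hpb).symm)
        · exact Nat.Coprime.prod_left fun i hi => primePow_coprime (Finset.ne_of_mem_erase hi)
      have hz : ∃ z : ℤ, (K : ℝ) * ((α p : ℝ) / P p) = z := by
        refine ⟨W * (∏ i ∈ Finset.univ.erase p, P i : ℕ) * a -
          b * (∏ i ∈ Finset.univ.erase p, P i : ℕ) * j -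
          b * W * ∑ i ∈ Finset.univ.erase p, α i *
            (∏ i' ∈ (Finset.univ.erase p).erase i, P i' : ℕ) - K * Z, ?_⟩
        have h1 : (α p : ℝ) / P p = (a : ℝ) / b - j / W -
            ∑ i ∈ Finset.univ.erase p, (α i : ℝ) / P i - Z := by
          rw [hmain, ← Finset.add_sum_erase _ _ (Finset.mem_univ p)]
          ring
        have h2 : ((∏ i ∈ Finset.univ.erase p, P i : ℕ) : ℝ) *
            ∑ i ∈ Finset.univ.erase p, (α i : ℝ) / P i =
            ∑ i ∈ Finset.univ.erase p, (α i : ℝ) *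
              ((∏ i' ∈ (Finset.univ.erase p).erase i, P i' : ℕ) : ℝ) := by
          rw [Finset.mul_sum]
          refine Finset.sum_congr rfl fun i hi => ?_
          rw [← Finset.mul_prod_erase _ _ hi]
          have := hPne i
          push_cast
          field_simp
        rw [h1]
        push_cast [hK] at h2 ⊢
        rw [← h2]
        field_simp
      obtain ⟨z', hz'⟩ := hz
      have h3 : ((K * α p : ℕ) : ℤ) = z' * P p := by
        have h4 : (K : ℝ) * α p = z' * P p := by
          rw [← hz']
          have := hPne p
          field_simp
        exact_mod_cast h4
      have h5 : P p ∣ K * α p := by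
        have : (P p : ℤ) ∣ ((K * α p : ℕ) : ℤ) := ⟨z', by rw [h3, mul_comm]⟩
        exact_mod_cast this
      have h6 := Nat.le_of_dvd (Nat.pos_of_ne_zero hne) (hKc.symm.dvd_of_dvd_mul_left h5)
      exact absurd (hαlt p) (by omega)
    have h7 : ∏ p ∈ S.map (Function.Embedding.subtype _), p ∣ b := by
      refine Finset.prod_primes_dvd b ?_ ?_
      · intro q hq
        obtain ⟨p, _, rfl⟩ := Finset.mem_map.mp hq
        exact (prime_of_roughPrimes p).prime
      · intro q hq
        obtain ⟨p, hp, rfl⟩ := Finset.mem_map.mp hq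
        exact hdvd p hp
    rwa [Finset.prod_map] at h7
  · intro hab hSe
    have hα0 : ∀ i, α i = 0 := by
      intro i
      by_contra h
      have : i ∈ S := Finset.mem_filter.mpr ⟨Finset.mem_univ _, h⟩
      rw [hSe] at this
      exact absurd this (Finset.notMem_empty _)
    simp only [hα0, Nat.cast_zero, zero_div, Finset.sum_const_zero, add_zero] at hmain
    have h1 : (W : ℝ) * a = b * (j + W * Z) := by
      have : (a : ℝ) = b * (j / W + Z) := by rw [← hmain]; field_simp
      rw [this]; field_simp
    have h2 : (b : ℤ) ∣ ((W * a : ℕ) : ℤ) := ⟨j + W * Z, by exact_mod_cast h1⟩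
    have h3 : b ∣ W * a := by exact_mod_cast h2
    exact hab.symm.dvd_of_dvd_mul_right h3

end PartialFractions

section Parseval

lemma parseval_range {K n : ℕ} (hK : K ≤ n) (f : ℕ → ℂ) :
    ∑ ξ ∈ Finset.range n, ‖∑ s ∈ Finset.range K, f s * ee ((ξ : ℝ) / n * s)‖ ^ 2 =
      n * ∑ s ∈ Finset.range K, ‖f s‖ ^ 2 := by
  rcases Nat.eq_zero_or_pos n with rfl | hn
  · simp
  have hn' : (n : ℝ) ≠ 0 := by positivity
  have key : ∑ ξ ∈ Finset.range n, ((‖∑ s ∈ Finset.range K, f s * ee ((ξ : ℝ) / n * s)‖ : ℂ)) ^ 2 =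
      n * ∑ s ∈ Finset.range K, ((‖f s‖ : ℂ)) ^ 2 := by
    calc _ = ∑ ξ ∈ Finset.range n, ∑ s ∈ Finset.range K, ∑ t ∈ Finset.range K,
          f s * (starRingEnd ℂ) (f t) * ee (ξ * (((s : ℤ) - (t : ℤ) : ℤ) / n : ℝ)) := by
          refine Finset.sum_congr rfl fun ξ _ => ?_
          rw [← Complex.mul_conj', map_sum, Finset.sum_mul_sum]
          refine Finset.sum_congr rfl fun s _ => Finset.sum_congr rfl fun t _ => ?_
          rw [map_mul, ← ee_neg]
          have : ee (ξ * (((s : ℤ) - (t : ℤ) : ℤ) / n : ℝ)) =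
              ee ((ξ : ℝ) / n * s) * ee (-((ξ : ℝ) / n * t)) := by
            rw [← ee_add]
            congr 1
            push_cast
            ring
          rw [this]
          ring
      _ = ∑ s ∈ Finset.range K, ∑ t ∈ Finset.range K,
          f s * (starRingEnd ℂ) (f t) * (if s = t then (n : ℂ) else 0) := by
          rw [Finset.sum_comm]
          refine Finset.sum_congr rfl fun s hs => ?_
          rw [Finset.sum_comm]
          refine Finset.sum_congr rfl fun t ht => ?_
          rw [← Finset.mul_sum, sum_ee_div hn]
          rw [Finset.mem_range] at hs ht
          congr 2
          refine propext ⟨fun h => ?_, fun h => by simp [h]⟩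
          have := Int.eq_zero_of_abs_lt_dvd h (by rw [abs_lt]; constructor <;> omega)
          omega
      _ = _ := by
          rw [Finset.mul_sum]
          refine Finset.sum_congr rfl fun s hs => ?_
          rw [← Complex.mul_conj']
          simp only [mul_ite, mul_zero]
          rw [Finset.sum_ite_eq, if_pos hs]
          ring
  exact_mod_cast key

lemma sum_range_mul_eq {β : Type*} [AddCommMonoid β] (W n : ℕ) (g : ℕ → β) :
    ∑ i ∈ Finset.range (W * n), g i =
      ∑ c ∈ Finset.range W, ∑ t ∈ Finset.range n, g (c + W * t) := by
  rw [Finset.sum_comm]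
  induction n with
  | zero => simp
  | succ n ih =>
    rw [Nat.mul_succ, Finset.sum_range_add, ih, Finset.sum_range_succ]
    congr 1
    exact Finset.sum_congr rfl fun i _ => by rw [add_comm]

lemma window_parseval {W : ℕ} (hW : 0 < W) (n : ℕ) (g : ℕ → ℂ) :
    ∑ j ∈ Finset.range W, ‖∑ i ∈ Finset.range (W * n), g i * ee ((j : ℝ) / W * i)‖ ^ 2 =
      W * ∑ c ∈ Finset.range W, ‖∑ t ∈ Finset.range n, g (c + W * t)‖ ^ 2 := by
  rw [← parseval_range le_rfl]
  refine Finset.sum_congr rfl fun j _ => ?_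
  rw [sum_range_mul_eq]
  congr 2
  refine Finset.sum_congr rfl fun c _ => ?_
  rw [Finset.sum_mul]
  refine Finset.sum_congr rfl fun t _ => ?_
  have hW' : (W : ℝ) ≠ 0 := by positivity
  have : (j : ℝ) / W * ((c + W * t : ℕ) : ℝ) = (j : ℝ) / W * c + ((j * t : ℕ) : ℤ) := by
    push_cast
    field_simp
  rw [this, ee_add_int]

lemma window_energy {L m n : ℕ} (hL : L ≤ n) (f : ℕ → ℂ) (hf0 : ∀ y < m, f y = 0)
    (hfL : ∀ y, L ≤ y → f y = 0) (θ : ℝ) :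
    ∑ ξ ∈ Finset.range n, ‖∑ y ∈ Finset.range L, f y * ee ((ξ : ℝ) / n * y)‖ ^ 2 *
      ‖∑ i ∈ Finset.range m, ee (i * ((ξ : ℝ) / n - θ))‖ ^ 2 =
      n * ∑ u ∈ Finset.range L, ‖∑ i ∈ Finset.range m, f (u + i) * ee (θ * i)‖ ^ 2 := by
  rw [← parseval_range hL]
  refine Finset.sum_congr rfl fun ξ _ => ?_
  rw [← mul_pow, ← Complex.norm_conj (∑ i ∈ Finset.range m, _), ← norm_mul]
  congr 2
  have hshift : ∀ i ∈ Finset.range m,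
      ∑ u ∈ Finset.range L, f (u + i) * ee ((ξ : ℝ) / n * ((u + i : ℕ) : ℝ)) =
        ∑ y ∈ Finset.range L, f y * ee ((ξ : ℝ) / n * y) := by
    intro i hi
    rw [Finset.mem_range] at hi
    have h1 := Finset.sum_range_add (fun y => f y * ee ((ξ : ℝ) / n * y)) i L
    have h2 := Finset.sum_range_add (fun y => f y * ee ((ξ : ℝ) / n * y)) L i
    rw [add_comm i L, h2] at h1
    have h3 : ∑ y ∈ Finset.range i, f y * ee ((ξ : ℝ) / n * y) = 0 :=
      Finset.sum_eq_zero fun y hy => by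
        rw [hf0 y ((Finset.mem_range.mp hy).trans hi), zero_mul]
    have h4 : ∑ y ∈ Finset.range i, f (L + y) * ee ((ξ : ℝ) / n * ((L + y : ℕ) : ℝ)) = 0 :=
      Finset.sum_eq_zero fun y _ => by rw [hfL _ (Nat.le_add_right L y), zero_mul]
    rw [h3, h4, zero_add, add_zero] at h1
    rw [h1]
    exact Finset.sum_congr rfl fun u _ => by rw [add_comm]
  rw [map_sum, Finset.mul_sum]
  conv_rhs => enter [2, u]; rw [Finset.sum_mul]
  rw [Finset.sum_comm]
  refine Finset.sum_congr rfl fun i hi => ?_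
  rw [← hshift i hi, Finset.sum_mul]
  refine Finset.sum_congr rfl fun u _ => ?_
  rw [← ee_neg, mul_assoc, mul_assoc, ← ee_add, ← ee_add]
  congr 2
  push_cast
  ring

end Parseval

section Weights

/-- The real number `b ^ (1 / (8 E))`. -/
noncomputable def rootPow (E b : ℕ) : ℝ := (b : ℝ) ^ ((1 : ℝ) / (8 * E))

variable {E : ℕ}

lemma rootPow_nonneg (b : ℕ) : 0 ≤ rootPow E b := Real.rpow_nonneg (Nat.cast_nonneg b) _

lemma rootPow_pow (hE : 1 ≤ E) (b : ℕ) : rootPow E b ^ (8 * E) = b := by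
  rw [rootPow, ← Real.rpow_natCast, ← Real.rpow_mul (Nat.cast_nonneg b)]
  have : (E : ℝ) ≠ 0 := by positivity
  push_cast
  rw [one_div, inv_mul_cancel₀ (by positivity), Real.rpow_one]

lemma le_rootPow (hE : 1 ≤ E) {b : ℕ} {y : ℝ} (hy : y ^ (8 * E) ≤ b) : y ≤ rootPow E b := by
  by_contra! h
  have := pow_lt_pow_left₀ h (rootPow_nonneg b) (n := 8 * E) (by omega)
  rw [rootPow_pow hE] at this
  linarith

lemma rootPow_mono {a b : ℕ} (h : a ≤ b) : rootPow E a ≤ rootPow E b :=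
  Real.rpow_le_rpow (Nat.cast_nonneg a) (by exact_mod_cast h) (by positivity)

lemma rootPow_prod {ι : Type*} (S : Finset ι) (f : ι → ℕ) :
    rootPow E (∏ i ∈ S, f i) = ∏ i ∈ S, rootPow E (f i) := by
  rw [rootPow, Nat.cast_prod]
  exact (Real.finsetProd_rpow S (fun i => (f i : ℝ)) (fun i _ => Nat.cast_nonneg _) _).symm

lemma one_le_rootPow {b : ℕ} (hb : 1 ≤ b) : 1 ≤ rootPow E b :=
  Real.one_le_rpow (by exact_mod_cast hb) (by positivity)

/-- The weight attached to the denominator `b` in the majorant. -/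
noncomputable def fracWeight (E b : ℕ) : ℝ := min 1 (2 / rootPow E b ^ 8)

lemma fracWeight_nonneg (b : ℕ) : 0 ≤ fracWeight E b :=
  le_min zero_le_one (div_nonneg zero_le_two (pow_nonneg (rootPow_nonneg b) _))

lemma fracWeight_le_one (b : ℕ) : fracWeight E b ≤ 1 := min_le_left _ _

lemma fracWeight_le {w Q k b : ℕ} (hE : 1 ≤ E) (hk : 1 ≤ k) (hw : (8 * k) ^ (8 * E) ≤ w)
    {S : Finset (roughPrimes w Q)} (hS : S.Nonempty) (hb : 1 ≤ b) (hSb : ∏ p ∈ S, (p : ℕ) ∣ b) :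
    fracWeight E b ≤ 2 / (8 * k) ^ 4 * (∏ p ∈ S, (rootPow E p ^ 2)⁻¹) ^ 2 := by
  have hx : ∀ p : roughPrimes w Q, (8 * k : ℝ) ≤ rootPow E p := by
    intro p
    refine le_rootPow hE ?_
    exact_mod_cast hw.trans (lt_of_roughPrimes p).le
  have hk' : (1 : ℝ) ≤ k := by exact_mod_cast hk
  set X := ∏ p ∈ S, rootPow E (p : ℕ) with hX
  have hXb : X ≤ rootPow E b := by
    rw [hX, ← rootPow_prod S (fun p => (p : ℕ))]
    exact rootPow_mono (Nat.le_of_dvd hb hSb)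
  have hX8 : (8 * k : ℝ) ≤ X := by
    obtain ⟨p, hp⟩ := hS
    rw [hX, ← Finset.mul_prod_erase _ _ hp]
    have h1 : (1 : ℝ) ≤ ∏ q ∈ S.erase p, rootPow E (q : ℕ) :=
      Finset.prod_induction _ (fun x : ℝ => 1 ≤ x) (fun a b ha hb => by nlinarith) le_rfl
        fun q _ => by linarith [hx q]
    nlinarith [hx p]
  have hprod : (∏ p ∈ S, (rootPow E p ^ 2)⁻¹) ^ 2 = (X ^ 4)⁻¹ := by
    rw [Finset.prod_inv_distrib, Finset.prod_pow, ← hX]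
    rw [inv_pow, ← pow_mul]
  rw [hprod, fracWeight]
  refine (min_le_right _ _).trans ?_
  have hX0 : 0 < X := by linarith
  have h1 : (8 * k : ℝ) ^ 4 * X ^ 4 ≤ rootPow E b ^ 8 := by
    calc (8 * k : ℝ) ^ 4 * X ^ 4 ≤ X ^ 4 * X ^ 4 := by gcongr
      _ = X ^ 8 := by ring
      _ ≤ _ := by gcongr
  calc 2 / rootPow E b ^ 8 ≤ 2 / ((8 * k : ℝ) ^ 4 * X ^ 4) := by gcongr
    _ = _ := by field_simp

lemma sum_roughPrimes_le {w Q k : ℕ} (hE : 1 ≤ E) (hkE : 8 * E ≤ k)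
    (hw : (8 * k) ^ (8 * E) ≤ w) :
    ∑ p : roughPrimes w Q, (4 * (4 * k * (rootPow E p ^ 2)⁻¹) ^ 2) ^ k ≤ 1 / 2 := by
  have hk : (8 : ℝ) ≤ k := by exact_mod_cast (by omega : 8 ≤ k)
  have hw2 : 2 ≤ w := by
    refine le_trans ?_ hw
    calc 2 ≤ 8 * k := by omega
      _ ≤ (8 * k) ^ (8 * E) := Nat.le_self_pow (by omega) _
  have hterm : ∀ p : roughPrimes w Q,
      (4 * (4 * k * (rootPow E p ^ 2)⁻¹) ^ 2) ^ k ≤ (((p : ℕ) : ℝ) ^ 2)⁻¹ := by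
    intro p
    have hx : (8 * k : ℝ) ≤ rootPow E p := by
      refine le_rootPow hE ?_
      exact_mod_cast hw.trans (lt_of_roughPrimes p).le
    set x := rootPow E (p : ℕ) with hxdef
    have hx0 : 0 < x := by linarith
    have h1 : 4 * (4 * k * (x ^ 2)⁻¹) ^ 2 ≤ (x ^ 2)⁻¹ := by
      have : 4 * (4 * k * (x ^ 2)⁻¹) ^ 2 = (8 * k) ^ 2 * ((x ^ 2)⁻¹ * (x ^ 2)⁻¹) := by ring
      rw [this]
      have h2 : (8 * k : ℝ) ^ 2 ≤ x ^ 2 := by gcongr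
      calc (8 * k : ℝ) ^ 2 * ((x ^ 2)⁻¹ * (x ^ 2)⁻¹)
          ≤ x ^ 2 * ((x ^ 2)⁻¹ * (x ^ 2)⁻¹) := by gcongr
        _ = _ := by field_simp
    have hxp : ((p : ℕ) : ℝ) ^ 2 = (x ^ 2) ^ (8 * E) := by
      rw [← rootPow_pow hE, ← hxdef]; ring
    calc _ ≤ ((x ^ 2)⁻¹) ^ k := by gcongr
      _ ≤ ((x ^ 2)⁻¹) ^ (8 * E) := by
          refine pow_le_pow_of_le_one (by positivity) ?_ hkE
          exact inv_le_one_of_one_le₀ (by nlinarith)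
      _ = _ := by rw [hxp, inv_pow]
  refine (Finset.sum_le_sum fun p _ => hterm p).trans ?_
  rw [Finset.sum_coe_sort (roughPrimes w Q) fun p => (((p : ℕ) : ℝ) ^ 2)⁻¹]
  rcases le_total w Q with h | h
  · calc _ ≤ ∑ p ∈ Finset.Ioc w Q, (((p : ℕ) : ℝ) ^ 2)⁻¹ :=
        Finset.sum_le_sum_of_subset_of_nonneg (Finset.filter_subset _ _)
          fun _ _ _ => by positivity
      _ ≤ (w : ℝ)⁻¹ - (Q : ℝ)⁻¹ := sum_Ioc_inv_sq_le_sub (by omega) h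
      _ ≤ (w : ℝ)⁻¹ := by
          have : (0 : ℝ) ≤ (Q : ℝ)⁻¹ := by positivity
          linarith
      _ ≤ 1 / 2 := by
          rw [one_div]
          exact inv_anti₀ (by norm_num) (by exact_mod_cast hw2)
  · have : roughPrimes w Q = ∅ := by
      rw [roughPrimes, Finset.Ioc_eq_empty (by omega), Finset.filter_empty]
    rw [this, Finset.sum_empty]
    norm_num

lemma card_filter_card_le {ι : Type*} [Fintype ι] [DecidableEq ι] (d : ℕ) :
    ((Finset.univ : Finset (Finset ι)).filter fun S => S.card ≤ d).card ≤
      (Fintype.card ι + 1) ^ d := by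
  have h := Finset.card_le_card_of_surjOn
    (s := (Finset.univ : Finset (Fin d → Option ι)))
    (t := (Finset.univ : Finset (Finset ι)).filter fun S => S.card ≤ d)
    (fun f => Finset.univ.filter fun i => ∃ j, f j = some i) (by
      intro S hS
      have hS' : S.card ≤ d := by simpa using hS
      refine ⟨fun j => if h : (j : ℕ) < S.card then some (S.equivFin.symm ⟨j, h⟩ : ι) else none,
        by simp, ?_⟩
      ext i
      simp only [Finset.mem_filter, Finset.mem_univ, true_and]
      constructor
      · rintro ⟨j, hj⟩
        split_ifs at hj with h
        rw [Option.some.injEq] at hj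
        rw [← hj]
        exact Subtype.coe_prop _
      · intro hi
        refine ⟨⟨S.equivFin ⟨i, hi⟩, (S.equivFin ⟨i, hi⟩).2.trans_le hS'⟩, ?_⟩
        simp)
  simpa [Fintype.card_option] using h

lemma sum_prod_primePow_le {w Q : ℕ} (d : ℕ) :
    ∑ S : Finset (roughPrimes w Q) with S.card ≤ d, ∏ i ∈ S, ((primePow w Q i : ℝ) + 1) ≤
      ((Q : ℝ) + 1) ^ (2 * d) := by
  have hcard : Fintype.card (roughPrimes w Q) ≤ Q := by
    rw [Fintype.card_coe]
    refine (Finset.card_filter_le _ _).trans ?_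
    simp
  calc _ ≤ ∑ S : Finset (roughPrimes w Q) with S.card ≤ d, ((Q : ℝ) + 1) ^ d := by
        refine Finset.sum_le_sum fun S hS => ?_
        calc _ ≤ ∏ i ∈ S, ((Q : ℝ) + 1) := by
              refine Finset.prod_le_prod (fun _ _ => by positivity) fun i _ => ?_
              have : (primePow w Q i : ℝ) ≤ Q := by exact_mod_cast primePow_le i
              linarith
          _ = ((Q : ℝ) + 1) ^ S.card := by rw [Finset.prod_const]
          _ ≤ _ := pow_le_pow_right₀ (by linarith [(Nat.cast_nonneg Q : (0 : ℝ) ≤ Q)])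
              (Finset.mem_filter.mp hS).2
    _ ≤ ((Q : ℝ) + 1) ^ d * ((Q : ℝ) + 1) ^ d := by
        rw [Finset.sum_const, nsmul_eq_mul]
        refine mul_le_mul_of_nonneg_right ?_ (by positivity)
        have h1 := card_filter_card_le (ι := roughPrimes w Q) d
        have h2 : (Fintype.card (roughPrimes w Q) + 1) ^ d ≤ (Q + 1) ^ d :=
          Nat.pow_le_pow_left (by omega) _
        exact_mod_cast h1.trans h2
    _ = _ := by ring

end Weights

section RoughWindow

/-- Reduced fractions `a / b` in `[0, 1)` with `b ≤ Q`, as pairs `(b, a)`. -/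
def fracs (Q : ℕ) : Finset (ℕ × ℕ) :=
  (Finset.Icc 1 Q ×ˢ Finset.range Q).filter fun θ => θ.2 < θ.1 ∧ θ.2.Coprime θ.1

lemma mem_fracs {Q : ℕ} {θ : ℕ × ℕ} :
    θ ∈ fracs Q ↔ 1 ≤ θ.1 ∧ θ.1 ≤ Q ∧ θ.2 < θ.1 ∧ θ.2.Coprime θ.1 := by
  rw [fracs, Finset.mem_filter, Finset.mem_product, Finset.mem_Icc, Finset.mem_range]
  constructor
  · rintro ⟨⟨⟨h1, h2⟩, _⟩, h3, h4⟩
    exact ⟨h1, h2, h3, h4⟩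
  · rintro ⟨h1, h2, h3, h4⟩
    exact ⟨⟨⟨h1, h2⟩, by omega⟩, h3, h4⟩

lemma card_fracs_le (Q : ℕ) : (fracs Q).card ≤ Q ^ 2 := by
  refine (Finset.card_filter_le _ _).trans ?_
  rw [Finset.card_product, Nat.card_Icc, Finset.card_range, Nat.add_sub_cancel, sq]

lemma fracs_eq_of_sub_int {Q : ℕ} {θ θ' : ℕ × ℕ} (hθ : θ ∈ fracs Q) (hθ' : θ' ∈ fracs Q)
    {z : ℤ} (h : (θ.2 : ℝ) / θ.1 - (θ'.2 : ℝ) / θ'.1 = z) : θ = θ' := by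
  obtain ⟨b, a⟩ := θ
  obtain ⟨b', a'⟩ := θ'
  obtain ⟨h1, -, h2, h3⟩ := mem_fracs.mp hθ
  obtain ⟨h1', -, h2', h3'⟩ := mem_fracs.mp hθ'
  simp only at h1 h2 h3 h1' h2' h3' h
  have hb : (0 : ℝ) < b := by exact_mod_cast h1
  have hb' : (0 : ℝ) < b' := by exact_mod_cast h1'
  have u1 : (a : ℝ) / b < 1 := (div_lt_one hb).mpr (by exact_mod_cast h2)
  have u1' : (a' : ℝ) / b' < 1 := (div_lt_one hb').mpr (by exact_mod_cast h2')
  have u0 : 0 ≤ (a : ℝ) / b := by positivity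
  have u0' : 0 ≤ (a' : ℝ) / b' := by positivity
  have hz : z = 0 := by
    have z1 : (z : ℝ) < 1 := by linarith
    have z2 : (-1 : ℝ) < z := by linarith
    have z1' : z < 1 := by exact_mod_cast z1
    have z2' : -1 < z := by exact_mod_cast z2
    omega
  rw [hz, Int.cast_zero, sub_eq_zero, div_eq_div_iff hb.ne' hb'.ne'] at h
  have hm : a * b' = a' * b := by exact_mod_cast h
  have d1 : b ∣ b' := h3.symm.dvd_of_dvd_mul_left ⟨a', by rw [hm, mul_comm]⟩
  have d2 : b' ∣ b := h3'.symm.dvd_of_dvd_mul_left ⟨a, by rw [← hm, mul_comm]⟩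
  have hbb := Nat.dvd_antisymm d1 d2
  subst hbb
  have := Nat.eq_of_mul_eq_mul_right h1 hm
  subst this
  rfl

lemma sum_le_sum_of_injOn' {α β : Type*} [DecidableEq β] {s : Finset α} {t : Finset β} (i : α → β)
    {f : α → ℝ} {g : β → ℝ} (hi : ∀ a ∈ s, i a ∈ t) (hinj : Set.InjOn i s) (hg : ∀ b ∈ t, 0 ≤ g b)
    (hfg : ∀ a ∈ s, f a ≤ g (i a)) : ∑ a ∈ s, f a ≤ ∑ b ∈ t, g b := by
  calc _ ≤ ∑ a ∈ s, g (i a) := Finset.sum_le_sum hfg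
    _ = ∑ b ∈ s.image i, g b := (Finset.sum_image hinj).symm
    _ ≤ _ := Finset.sum_le_sum_of_subset_of_nonneg
      (Finset.image_subset_iff.mpr hi) fun b hb _ => hg b hb

/-- The weighted energy of a window of a set without density increments at fractions whose
denominators do not divide the smooth modulus. -/
theorem rough_window {E k w Q n : ℕ} (hE : 1 ≤ E) (hkE : 8 * E ≤ k)
    (hw : (8 * k) ^ (8 * E) ≤ w) (hn : 0 < n) (A : Finset ℕ) (u : ℕ) {δ : ℝ} (hδ : 0 < δ)
    (hA : ∀ c < smoothMod w Q, ∀ V : Finset (roughPrimes w Q), V.card ≤ Nat.log 2 Q → ∀ r : ℕ,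
      ((∏ i ∈ V, primePow w Q i : ℕ) : ℝ) *
        ((Finset.range n).filter fun t => u + c + smoothMod w Q * t ∈ A ∧
          t ≡ r [MOD ∏ i ∈ V, primePow w Q i]).card ≤ δ * n)
    (hkδ : 3 ≤ δ * 4 ^ (2 * k))
    (hX : (((Q : ℝ) + 1) ^ (2 * Nat.log 2 Q)) ^ (2 * k + 1) ≤ δ ^ (2 * k) * n) :
    ∑ θ ∈ (fracs Q).filter fun θ => ¬ θ.1 ∣ smoothMod w Q, fracWeight E θ.1 *
      ‖∑ i ∈ Finset.range (smoothMod w Q * n),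
        (if u + i ∈ A then (1 : ℂ) else 0) * ee ((θ.2 : ℝ) / θ.1 * i)‖ ^ 2 ≤
      32 / (8 * k) ^ 4 * δ ^ 2 * ((smoothMod w Q * n : ℕ) : ℝ) ^ 2 := by
  classical
  set W := smoothMod w Q with hWdef
  set P := primePow w Q with hPdef
  set d := Nat.log 2 Q with hd
  have hW : 0 < W := smoothMod_pos
  have hk1 : 1 ≤ k := by omega
  have hkr : (1 : ℝ) ≤ k := by exact_mod_cast hk1
  set ρ : roughPrimes w Q → ℝ := fun p => (rootPow E p ^ 2)⁻¹ with hρ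
  have hρ0 : ∀ p, 0 ≤ ρ p := fun p => by simp only [hρ]; positivity
  have hx : ∀ p : roughPrimes w Q, (8 * k : ℝ) ≤ rootPow E p := by
    intro p
    refine le_rootPow hE ?_
    exact_mod_cast hw.trans (lt_of_roughPrimes p).le
  -- the sum over one choice of rough part
  have hen : ∀ c < W, ∑ S : Finset (roughPrimes w Q) with S.card ≤ d, (∏ i ∈ S, ρ i) ^ 2 *
      ∑ α ∈ numTuples P S, ‖∑ t ∈ Finset.range n, (if u + (c + W * t) ∈ A then (1 : ℂ) else 0) *
        ee ((∑ i, (α i : ℝ) / P i) * ((c + W * t : ℕ) : ℝ))‖ ^ 2 ≤ 16 * δ ^ 2 * n ^ 2 := by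
    intro c hc
    have h := interval_energy (P := P) primePow_coprime (fun i => smoothMod_coprime i) (c : ℤ) hn
      (A := (Finset.range n).filter fun t => u + (c + W * t) ∈ A) (Finset.filter_subset _ _)
      (ρ := ρ) (τ := fun p => 4 * k * ρ p) (d := d) hδ (by
        intro V hV r
        refine le_of_eq_of_le ?_ (hA c hc V hV r)
        rw [Finset.filter_filter]
        simp only [add_assoc]) hk1 hρ0 (by
        intro p
        have := hx p
        simp only [hρ]
        rw [← div_eq_mul_inv]
        exact div_le_one_of_le₀ (by nlinarith) (by positivity)) (fun _ => le_rfl)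
      (sum_roughPrimes_le hE hkE hw) hkδ (sum_prod_primePow_le d) hX
    refine le_of_eq_of_le ?_ h
    refine Finset.sum_congr rfl fun S _ => ?_
    congr 1
    refine Finset.sum_congr rfl fun α _ => ?_
    congr 2
    rw [Finset.sum_filter]
    refine Finset.sum_congr rfl fun t _ => ?_
    rw [ite_mul, one_mul, zero_mul]
    congr 2
    push_cast
    ring
  -- choose the decomposition of every fraction
  have hdec : ∀ θ : ℕ × ℕ, ∃ q : ((Σ _ : Finset (roughPrimes w Q), (roughPrimes w Q → ℕ)) × ℕ),
      θ ∈ fracs Q → q.2 < W ∧ q.1.2 ∈ numTuples P q.1.1 ∧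
      (∃ z : ℤ, (θ.2 : ℝ) / θ.1 = (q.2 : ℝ) / W + ∑ i, (q.1.2 i : ℝ) / P i + z) ∧
      ∏ p ∈ q.1.1, (p : ℕ) ∣ θ.1 ∧ (q.1.1 = ∅ → θ.1 ∣ W) := by
    intro θ
    by_cases hθ : θ ∈ fracs Q
    · obtain ⟨h1, h2, h3, h4⟩ := mem_fracs.mp hθ
      obtain ⟨j, hj, S, α, hα, hz, hdv, hcop⟩ := exists_fraction_decomp (w := w) (a := θ.2) h1 h2
      exact ⟨⟨⟨S, α⟩, j⟩, fun _ => ⟨hj, hα, hz, hdv, hcop h4⟩⟩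
    · exact ⟨⟨⟨∅, 0⟩, 0⟩, fun h => absurd h hθ⟩
  choose q hq using hdec
  set T := (((Finset.univ : Finset (Finset (roughPrimes w Q))).filter fun S => S.card ≤ d).sigma
    fun S => numTuples P S) ×ˢ Finset.range W with hT
  have hmain := sum_le_sum_of_injOn'
    (s := (fracs Q).filter fun θ => ¬ θ.1 ∣ W) (t := T) q
    (f := fun θ => fracWeight E θ.1 * ‖∑ i ∈ Finset.range (W * n),
        (if u + i ∈ A then (1 : ℂ) else 0) * ee ((θ.2 : ℝ) / θ.1 * i)‖ ^ 2)
    (g := fun q => 2 / (8 * k) ^ 4 * ((∏ p ∈ q.1.1, ρ p) ^ 2 * ‖∑ i ∈ Finset.range (W * n),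
        ((if u + i ∈ A then (1 : ℂ) else 0) * ee ((∑ p, (q.1.2 p : ℝ) / P p) * i)) *
          ee ((q.2 : ℝ) / W * i)‖ ^ 2)) ?_ ?_ ?_ ?_
  · refine hmain.trans ?_
    rw [hT, ← Finset.mul_sum, Finset.sum_product, Finset.sum_sigma]
    have hstep : ∀ S : Finset (roughPrimes w Q), ∀ α ∈ numTuples P S,
        ∑ j ∈ Finset.range W, (∏ p ∈ S, ρ p) ^ 2 * ‖∑ i ∈ Finset.range (W * n),
          ((if u + i ∈ A then (1 : ℂ) else 0) * ee ((∑ p, (α p : ℝ) / P p) * i)) *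
            ee ((j : ℝ) / W * i)‖ ^ 2 = W * ∑ c ∈ Finset.range W, (∏ p ∈ S, ρ p) ^ 2 *
          ‖∑ t ∈ Finset.range n, (if u + (c + W * t) ∈ A then (1 : ℂ) else 0) *
            ee ((∑ i, (α i : ℝ) / P i) * ((c + W * t : ℕ) : ℝ))‖ ^ 2 := by
      intro S α _
      rw [← Finset.mul_sum, window_parseval hW n (fun i : ℕ =>
        (if u + i ∈ A then (1 : ℂ) else 0) * ee ((∑ p, (α p : ℝ) / P p) * i)), ← Finset.mul_sum]
      ring
    rw [Finset.sum_congr rfl fun S _ => Finset.sum_congr rfl fun α hα => hstep S α hα]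
    have hsw : ∑ S : Finset (roughPrimes w Q) with S.card ≤ d, ∑ α ∈ numTuples P S,
        W * ∑ c ∈ Finset.range W, (∏ p ∈ S, ρ p) ^ 2 *
          ‖∑ t ∈ Finset.range n, (if u + (c + W * t) ∈ A then (1 : ℂ) else 0) *
            ee ((∑ i, (α i : ℝ) / P i) * ((c + W * t : ℕ) : ℝ))‖ ^ 2 =
        W * ∑ c ∈ Finset.range W, ∑ S : Finset (roughPrimes w Q) with S.card ≤ d,
          (∏ i ∈ S, ρ i) ^ 2 * ∑ α ∈ numTuples P S,
          ‖∑ t ∈ Finset.range n, (if u + (c + W * t) ∈ A then (1 : ℂ) else 0) *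
            ee ((∑ i, (α i : ℝ) / P i) * ((c + W * t : ℕ) : ℝ))‖ ^ 2 := by
      rw [Finset.sum_comm, Finset.mul_sum]
      refine Finset.sum_congr rfl fun S _ => ?_
      rw [← Finset.mul_sum, Finset.sum_comm]
      congr 1
      refine Finset.sum_congr rfl fun c _ => ?_
      rw [Finset.mul_sum]
    rw [hsw]
    have hsum : ∑ c ∈ Finset.range W, ∑ S : Finset (roughPrimes w Q) with S.card ≤ d,
          (∏ i ∈ S, ρ i) ^ 2 * ∑ α ∈ numTuples P S,
          ‖∑ t ∈ Finset.range n, (if u + (c + W * t) ∈ A then (1 : ℂ) else 0) *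
            ee ((∑ i, (α i : ℝ) / P i) * ((c + W * t : ℕ) : ℝ))‖ ^ 2 ≤
        W * (16 * δ ^ 2 * n ^ 2) := by
      refine (Finset.sum_le_sum fun c hc => hen c (Finset.mem_range.mp hc)).trans ?_
      rw [Finset.sum_const, Finset.card_range, nsmul_eq_mul]
    calc _ ≤ 2 / (8 * k : ℝ) ^ 4 * (W * (W * (16 * δ ^ 2 * n ^ 2))) := by gcongr
      _ = _ := by push_cast; ring
  · intro θ hθ
    rw [Finset.mem_filter] at hθ
    obtain ⟨h1, h2, -, h4, -⟩ := hq θ hθ.1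
    obtain ⟨b1, b2, -, -⟩ := mem_fracs.mp hθ.1
    refine Finset.mem_product.mpr ⟨Finset.mem_sigma.mpr
      ⟨Finset.mem_filter.mpr ⟨Finset.mem_univ _, ?_⟩, h2⟩, Finset.mem_range.mpr h1⟩
    refine Nat.le_log_of_pow_le one_lt_two ?_
    calc 2 ^ (q θ).1.1.card = ∏ p ∈ (q θ).1.1, 2 := by rw [Finset.prod_const]
      _ ≤ ∏ p ∈ (q θ).1.1, (p : ℕ) :=
        Finset.prod_le_prod' fun p _ => (prime_of_roughPrimes p).two_le
      _ ≤ θ.1 := Nat.le_of_dvd b1 h4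
      _ ≤ Q := b2
  · intro θ hθ θ' hθ' h
    have m1 := (Finset.mem_filter.mp (Finset.mem_coe.mp hθ)).1
    have m2 := (Finset.mem_filter.mp (Finset.mem_coe.mp hθ')).1
    obtain ⟨-, -, ⟨z, hz⟩, -⟩ := hq θ m1
    obtain ⟨-, -, ⟨z', hz'⟩, -⟩ := hq θ' m2
    refine fracs_eq_of_sub_int (z := z - z') m1 m2 ?_
    rw [hz, hz', h]
    push_cast
    ring
  · intro b _
    positivity
  · intro θ hθ
    rw [Finset.mem_filter] at hθ
    obtain ⟨h1, h2, ⟨z, hz⟩, h4, h5⟩ := hq θ hθ.1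
    obtain ⟨b1, b2, -, -⟩ := mem_fracs.mp hθ.1
    have hne : (q θ).1.1.Nonempty := Finset.nonempty_iff_ne_empty.mpr fun h => hθ.2 (h5 h)
    have hwt := fracWeight_le (Q := Q) hE hk1 hw hne b1 h4
    have hsum : ∑ i ∈ Finset.range (W * n),
        (if u + i ∈ A then (1 : ℂ) else 0) * ee ((θ.2 : ℝ) / θ.1 * i) =
        ∑ i ∈ Finset.range (W * n),
        ((if u + i ∈ A then (1 : ℂ) else 0) * ee ((∑ p, ((q θ).1.2 p : ℝ) / P p) * i)) *
          ee (((q θ).2 : ℝ) / W * i) := by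
      refine Finset.sum_congr rfl fun i _ => ?_
      rw [mul_assoc, ← ee_add, hz]
      congr 1
      rw [← ee_add_int (_ + _) (z * i)]
      congr 1
      push_cast
      ring
    simp only [hsum]
    rw [← mul_assoc]
    exact mul_le_mul_of_nonneg_right hwt (by positivity)

end RoughWindow

section CircleMethod

lemma fourier_count {L n M : ℕ} (hn : 0 < n) (f : ℕ → ℝ) (F : ℕ → ℤ)
    (hF : ∀ x < M, |F x| + L ≤ n) :
    n * |∑ x ∈ Finset.range M, ∑ y ∈ Finset.range L, ∑ y' ∈ Finset.range L,
      if (y' : ℤ) = y + F x then f y * f y' else 0| ≤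
      ∑ ξ ∈ Finset.range n, ‖∑ y ∈ Finset.range L, (f y : ℂ) * ee ((ξ : ℝ) / n * y)‖ ^ 2 *
        ‖∑ x ∈ Finset.range M, ee ((ξ : ℝ) / n * (F x : ℝ))‖ := by
  have hn' : (n : ℝ) ≠ 0 := by positivity
  have key : (n : ℂ) * ((∑ x ∈ Finset.range M, ∑ y ∈ Finset.range L, ∑ y' ∈ Finset.range L,
      if (y' : ℤ) = y + F x then f y * f y' else 0 : ℝ) : ℂ) =
      ∑ ξ ∈ Finset.range n, ((‖∑ y ∈ Finset.range L, (f y : ℂ) * ee ((ξ : ℝ) / n * y)‖ : ℂ)) ^ 2 *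
        ∑ x ∈ Finset.range M, ee ((ξ : ℝ) / n * (F x : ℝ)) := by
    calc _ = ∑ x ∈ Finset.range M, ∑ y ∈ Finset.range L, ∑ y' ∈ Finset.range L,
          ((f y : ℂ) * f y') * ∑ ξ ∈ Finset.range n,
            ee (ξ * ((((y : ℤ) + F x - y' : ℤ) : ℝ) / n)) := by
          push_cast
          rw [Finset.mul_sum]
          refine Finset.sum_congr rfl fun x hx => ?_
          rw [Finset.mul_sum]
          refine Finset.sum_congr rfl fun y hy => ?_
          rw [Finset.mul_sum]
          refine Finset.sum_congr rfl fun y' hy' => ?_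
          have hs := sum_ee_div hn ((y : ℤ) + F x - y')
          push_cast at hs
          rw [hs]
          have hiff : ((y' : ℤ) = y + F x) ↔ ((n : ℤ) ∣ (y : ℤ) + F x - y') := by
            constructor
            · intro h
              rw [h, sub_self]
              exact dvd_zero _
            · intro h
              have h1 := hF x (Finset.mem_range.mp hx)
              have h2 := abs_le.mp (le_refl |F x|)
              rw [Finset.mem_range] at hy hy'
              have := Int.eq_zero_of_abs_lt_dvd h (by rw [abs_lt]; constructor <;> omega)
              omega
          by_cases h : (y' : ℤ) = y + F x
          · rw [if_pos h, if_pos (hiff.mp h)]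
            push_cast
            ring
          · rw [if_neg h, if_neg (fun h' => h (hiff.mpr h'))]
            simp
      _ = ∑ ξ ∈ Finset.range n, ∑ x ∈ Finset.range M, ∑ y ∈ Finset.range L,
          ∑ y' ∈ Finset.range L,
          ((f y : ℂ) * f y') * ee (ξ * ((((y : ℤ) + F x - y' : ℤ) : ℝ) / n)) := by
          simp_rw [Finset.mul_sum]
          rw [Finset.sum_comm (s := Finset.range n)]
          refine Finset.sum_congr rfl fun x _ => ?_
          rw [Finset.sum_comm (s := Finset.range n)]
          refine Finset.sum_congr rfl fun y _ => ?_
          rw [Finset.sum_comm (s := Finset.range n)]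
      _ = _ := by
          refine Finset.sum_congr rfl fun ξ _ => ?_
          rw [← Complex.mul_conj', map_sum, Finset.mul_sum]
          refine Finset.sum_congr rfl fun x _ => ?_
          rw [Finset.sum_mul_sum, Finset.sum_mul]
          refine Finset.sum_congr rfl fun y _ => ?_
          rw [Finset.sum_mul]
          refine Finset.sum_congr rfl fun y' _ => ?_
          rw [map_mul, Complex.conj_ofReal, ← ee_neg]
          have : ee (ξ * ((((y : ℤ) + F x - y' : ℤ) : ℝ) / n)) =
              ee ((ξ : ℝ) / n * y) * ee (-((ξ : ℝ) / n * y')) * ee ((ξ : ℝ) / n * (F x : ℝ)) := by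
            rw [← ee_add, ← ee_add]
            congr 1
            push_cast
            ring
          rw [this]
          ring
  have h := congrArg norm key
  rw [norm_mul, Complex.norm_natCast, Complex.norm_real, Real.norm_eq_abs] at h
  rw [h]
  refine (norm_sum_le _ _).trans (Finset.sum_le_sum fun ξ _ => ?_)
  rw [norm_mul, norm_pow, Complex.norm_real, norm_norm]

lemma half_le_norm_geom {m : ℕ} {β : ℝ} (h : 16 * (|β| * m) ≤ 1) :
    (m : ℝ) / 2 ≤ ‖∑ i ∈ Finset.range m, ee (i * β)‖ := by
  have h1 : ‖∑ i ∈ Finset.range m, (ee (i * β) - 1)‖ ≤ ∑ i ∈ Finset.range m, (7 / 16 : ℝ) := by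
    refine (norm_sum_le _ _).trans (Finset.sum_le_sum fun i hi => ?_)
    refine (norm_ee_sub_one_le _).trans ?_
    rw [abs_mul, Nat.abs_cast]
    have : (i : ℝ) ≤ m := by exact_mod_cast (Finset.mem_range.mp hi).le
    have := mul_le_mul_of_nonneg_left this (abs_nonneg β)
    linarith
  rw [Finset.sum_sub_distrib, Finset.sum_const, Finset.sum_const, Finset.card_range, nsmul_eq_mul,
    nsmul_eq_mul, mul_one] at h1
  have h2 := norm_sub_norm_le (m : ℂ) (∑ i ∈ Finset.range m, ee (i * β))
  rw [norm_sub_rev, Complex.norm_natCast] at h2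
  linarith [(Nat.cast_nonneg m : (0 : ℝ) ≤ m)]

lemma weyl_majorant {k E : ℕ} (hW : WeylInverse k E) (hE : 1 ≤ E) (hk : 1 ≤ k)
    {F : Polynomial ℤ} (hdeg : F.natDegree ≤ k) (hlead : F.coeff k ≠ 0)
    (hgcd : ∀ d : ℕ, (∀ j, 1 ≤ j → (d : ℤ) ∣ F.coeff j) → d = 1)
    {H : ℝ} (hH1 : 1 ≤ H) (hH : ∀ j, |(F.coeff j : ℝ)| ≤ H) {R : ℕ} (hR : 2 ≤ R) {M m : ℕ}
    (hM : 2 * (R : ℝ) ^ (3 * E) * H ^ 2 < M) (hm : 0 < m)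
    (hmM : 16 * ((m : ℝ) * R ^ E) ≤ M ^ k) (α : ℝ) :
    ‖∑ x ∈ Finset.range M, ee (α * (F.eval (x : ℤ) : ℤ))‖ ≤ M * (1 / R + 4 / (m : ℝ) ^ 2 *
      ∑ θ ∈ fracs (R ^ E), fracWeight E θ.1 *
        ‖∑ i ∈ Finset.range m, ee (i * (α - (θ.2 : ℝ) / θ.1))‖ ^ 2) := by
  set S := ∑ x ∈ Finset.range M, ee (α * (F.eval (x : ℤ) : ℤ)) with hS
  have hR0 : (0 : ℝ) < R := by positivity
  have hm0 : (0 : ℝ) < m := by exact_mod_cast hm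
  have hM0 : (0 : ℝ) ≤ M := Nat.cast_nonneg _
  have hterm : ∀ θ ∈ fracs (R ^ E), 0 ≤ fracWeight E θ.1 *
      ‖∑ i ∈ Finset.range m, ee (i * (α - (θ.2 : ℝ) / θ.1))‖ ^ 2 :=
    fun θ _ => mul_nonneg (fracWeight_nonneg _) (by positivity)
  rcases le_or_gt (R * ‖S‖) M with h | h
  · have h1 : ‖S‖ ≤ M * (1 / R) := by
      rw [mul_one_div, le_div_iff₀ hR0]
      linarith
    refine h1.trans (mul_le_mul_of_nonneg_left ?_ hM0)
    exact le_add_of_nonneg_right (mul_nonneg (by positivity) (Finset.sum_nonneg hterm))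
  · obtain ⟨b, hb1, hbR, a, hab, hα, hSE⟩ := exists_major_arc hW hk hdeg hlead hgcd hH1 hH
      (by exact_mod_cast hR) hM α h
    have hbpos : (0 : ℤ) < b := by exact_mod_cast hb1
    have hb0 : (0 : ℝ) < b := by exact_mod_cast hbpos
    set a' := (a % (b : ℤ)).toNat with ha'
    have e1 := Int.emod_nonneg a hbpos.ne'
    have e2 := Int.emod_lt_of_pos a hbpos
    have ha'z : (a' : ℤ) = a % b := Int.toNat_of_nonneg e1
    have hmem : ((b, a') : ℕ × ℕ) ∈ fracs (R ^ E) := by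
      refine mem_fracs.mpr ⟨by exact_mod_cast hb1, by exact_mod_cast hbR, by simp only; omega, ?_⟩
      have : IsCoprime (a' : ℤ) (b : ℤ) := by
        rw [ha'z, Int.emod_def, sub_eq_add_neg, ← mul_neg]
        exact hab.add_mul_left_left _
      exact Nat.isCoprime_iff_coprime.mp this
    have hdiv := div_eq_emod_div_add a (by exact_mod_cast hb1 : 0 < b)
    rw [← ha'] at hdiv
    have hD : (m : ℝ) / 2 ≤ ‖∑ i ∈ Finset.range m, ee (i * (α - (a' : ℝ) / b))‖ := by
      have : ∑ i ∈ Finset.range m, ee (i * (α - (a' : ℝ) / b)) =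
          ∑ i ∈ Finset.range m, ee (i * (α - (a : ℝ) / b)) := by
        refine Finset.sum_congr rfl fun i _ => ?_
        rw [hdiv, ← ee_sub_int _ (i * (a / b))]
        congr 1
        push_cast
        ring
      rw [this]
      refine half_le_norm_geom ?_
      have hl : (1 : ℝ) ≤ |(F.coeff k : ℝ)| := by
        exact_mod_cast Int.one_le_abs hlead
      have hMk : (0 : ℝ) < M ^ k := lt_of_lt_of_le (by positivity) hmM
      have h3 : |α - (a : ℝ) / b| * M ^ k ≤ R ^ E := by
        refine le_trans ?_ hα
        gcongr
        exact le_mul_of_one_le_left hMk.le hl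
      have h4 : |α - (a : ℝ) / b| * (16 * (m * R ^ E)) ≤ 1 * R ^ E := by
        rw [one_mul]
        refine le_trans ?_ h3
        gcongr
      have hRE : (0 : ℝ) < R ^ E := by positivity
      refine le_of_mul_le_mul_right ?_ hRE
      linarith
    have hw : ‖S‖ ≤ M * fracWeight E b := by
      have hSM : ‖S‖ ≤ M := by simpa using norm_sum_ee_le (Finset.range M) _
      have hrp : 0 < rootPow E b := by
        have := one_le_rootPow (E := E) (by exact_mod_cast hb1 : 1 ≤ b)
        linarith
      have h2 : rootPow E b ^ 8 * ‖S‖ ≤ 2 * M := by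
        refine le_of_pow_le_pow_left₀ (n := E) (by omega) (by positivity) ?_
        rw [mul_pow, ← pow_mul, rootPow_pow hE]
        exact_mod_cast hSE
      rw [fracWeight, mul_min_of_nonneg _ _ hM0, mul_one]
      refine le_min hSM ?_
      rw [← mul_div_assoc, le_div_iff₀ (by positivity)]
      linarith
    have hsingle := Finset.single_le_sum hterm hmem
    simp only at hsingle
    have hfw := fracWeight_nonneg (E := E) b
    have hfin : fracWeight E b ≤ 4 / (m : ℝ) ^ 2 * (fracWeight E b *
        ‖∑ i ∈ Finset.range m, ee (i * (α - (a' : ℝ) / b))‖ ^ 2) := by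
      have : ((m : ℝ) / 2) ^ 2 ≤ ‖∑ i ∈ Finset.range m, ee (i * (α - (a' : ℝ) / b))‖ ^ 2 := by
        gcongr
      calc fracWeight E b = 4 / (m : ℝ) ^ 2 * (fracWeight E b * (m / 2) ^ 2) := by
            field_simp
            norm_num
        _ ≤ _ := by gcongr
    refine hw.trans (mul_le_mul_of_nonneg_left ?_ hM0)
    refine hfin.trans (le_trans (mul_le_mul_of_nonneg_left hsingle (by positivity)) ?_)
    have : (0 : ℝ) ≤ 1 / R := by positivity
    linarith

end CircleMethod

section Balanced

/-- The indicator function of `A`, minus `δ` times the indicator function of `I`. -/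
def balanced (A I : Finset ℕ) (δ : ℝ) (y : ℕ) : ℝ :=
  (if y ∈ A then 1 else 0) - δ * (if y ∈ I then 1 else 0)

lemma balanced_eq_zero {A I : Finset ℕ} (hA : A ⊆ I) {δ : ℝ} {y : ℕ} (hy : y ∉ I) :
    balanced A I δ y = 0 := by
  rw [balanced, if_neg hy, if_neg fun h => hy (hA h)]
  ring

lemma abs_balanced_le {A I : Finset ℕ} (hA : A ⊆ I) {δ : ℝ} (h0 : 0 ≤ δ) (h1 : δ ≤ 1) (y : ℕ) :
    |balanced A I δ y| ≤ 1 := by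
  by_cases hI : y ∈ I
  · by_cases h : y ∈ A
    · rw [balanced, if_pos h, if_pos hI, abs_le]
      constructor <;> linarith
    · rw [balanced, if_neg h, if_pos hI, abs_le]
      constructor <;> linarith
  · rw [balanced_eq_zero hA hI, abs_zero]
    exact zero_le_one

lemma sum_balanced_sq_le {A I : Finset ℕ} (hA : A ⊆ I) {L : ℕ} (hI : I ⊆ Finset.range L) {δ : ℝ}
    (h0 : 0 ≤ δ) (hδ : δ * I.card = A.card) :
    ∑ y ∈ Finset.range L, balanced A I δ y ^ 2 ≤ A.card := by
  have h : ∀ y, balanced A I δ y ^ 2 =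
      (1 - 2 * δ) * (if y ∈ A then 1 else 0) + δ ^ 2 * (if y ∈ I then 1 else 0) := by
    intro y
    by_cases hI : y ∈ I
    · by_cases h : y ∈ A
      · rw [balanced, if_pos h, if_pos hI]; ring
      · rw [balanced, if_neg h, if_pos hI]; ring
    · rw [balanced_eq_zero hA hI, if_neg hI, if_neg fun h => hI (hA h)]; ring
  simp_rw [h]
  rw [Finset.sum_add_distrib, ← Finset.mul_sum, ← Finset.mul_sum, Finset.sum_boole,
    Finset.sum_boole, Finset.filter_mem_eq_inter, Finset.filter_mem_eq_inter,
    Finset.inter_eq_right.mpr hI, Finset.inter_eq_right.mpr (hA.trans hI)]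
  have : (0 : ℝ) ≤ δ * A.card := by positivity
  nlinarith

/-- The number of pairs, weighted by `u` and `v`, with difference `t`. -/
def diffCount (L : ℕ) (t : ℤ) (u v : ℕ → ℝ) : ℝ :=
  ∑ y ∈ Finset.range L, ∑ z ∈ Finset.range L, if (z : ℤ) = y + t then u y * v z else 0

/-- The indicator function of a finite set. -/
def indic (A : Finset ℕ) (y : ℕ) : ℝ := if y ∈ A then 1 else 0

lemma indic_nonneg (A : Finset ℕ) (y : ℕ) : 0 ≤ indic A y := by
  rw [indic]; split_ifs <;> norm_num

lemma indic_le_one (A : Finset ℕ) (y : ℕ) : indic A y ≤ 1 := by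
  rw [indic]; split_ifs <;> norm_num

lemma diffCount_balanced (A I : Finset ℕ) (δ : ℝ) (L : ℕ) (t : ℤ) :
    diffCount L t (balanced A I δ) (balanced A I δ) =
      diffCount L t (indic A) (indic A) - δ * diffCount L t (indic A) (indic I) -
        δ * diffCount L t (indic I) (indic A) + δ ^ 2 * diffCount L t (indic I) (indic I) := by
  simp only [diffCount, Finset.mul_sum]
  rw [← Finset.sum_sub_distrib, ← Finset.sum_sub_distrib, ← Finset.sum_add_distrib]
  refine Finset.sum_congr rfl fun y _ => ?_
  rw [← Finset.sum_sub_distrib, ← Finset.sum_sub_distrib, ← Finset.sum_add_distrib]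
  refine Finset.sum_congr rfl fun y' _ => ?_
  split_ifs with h
  · simp only [balanced, indic]
    ring
  · ring

lemma diffCount_comm (L : ℕ) (t : ℤ) (u v : ℕ → ℝ) :
    diffCount L t u v = diffCount L (-t) v u := by
  rw [diffCount, diffCount, Finset.sum_comm]
  refine Finset.sum_congr rfl fun y _ => Finset.sum_congr rfl fun y' _ => ?_
  have : ((y : ℤ) = y' + t) ↔ ((y' : ℤ) = y + -t) := by omega
  simp only [this, mul_comm]

lemma sum_indic {A : Finset ℕ} {L : ℕ} (hA : A ⊆ Finset.range L) :
    ∑ y ∈ Finset.range L, indic A y = A.card := by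
  simp only [indic]
  rw [Finset.sum_boole, Finset.filter_mem_eq_inter, Finset.inter_eq_right.mpr hA]

lemma diffCount_le {A B : Finset ℕ} {L : ℕ} (hA : A ⊆ Finset.range L) (t : ℤ) :
    diffCount L t (indic A) (indic B) ≤ A.card := by
  rw [← sum_indic hA, diffCount]
  refine Finset.sum_le_sum fun y _ => ?_
  have h : ∀ y' ∈ Finset.range L, (if (y' : ℤ) = y + t then indic A y * indic B y' else 0) ≤
      if y' = ((y : ℤ) + t).toNat then indic A y else 0 := by
    intro y' _
    by_cases h : (y' : ℤ) = y + t
    · rw [if_pos h, if_pos (by omega)]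
      exact mul_le_of_le_one_right (indic_nonneg _ _) (indic_le_one _ _)
    · rw [if_neg h]
      split_ifs
      · exact indic_nonneg _ _
      · exact le_rfl
  refine (Finset.sum_le_sum h).trans ?_
  rw [Finset.sum_ite_eq']
  split_ifs
  · exact le_rfl
  · exact indic_nonneg _ _

lemma le_diffCount_add {A : Finset ℕ} {m N L : ℕ} (hA : A ⊆ Finset.Ico m (m + N))
    (hL : m + N ≤ L) (t : ℤ) :
    (A.card : ℝ) ≤ diffCount L t (indic A) (indic (Finset.Ico m (m + N))) + |(t : ℝ)| := by
  have hAL : A ⊆ Finset.range L := fun y hy => by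
    have := Finset.mem_Ico.mp (hA hy)
    exact Finset.mem_range.mpr (by omega)
  set Bd := (Finset.Ico m (m + N)).filter fun y : ℕ =>
    ¬ ((m : ℤ) ≤ (y : ℤ) + t ∧ (y : ℤ) + t < m + N) with hBd
  have hcard : (Bd.card : ℝ) ≤ |(t : ℝ)| := by
    have h1 : Bd.card ≤ t.natAbs := by
      rcases le_total 0 t with ht | ht
      · refine (Finset.card_le_card (t := Finset.Ico (m + N - t.natAbs) (m + N)) ?_).trans ?_
        · intro y hy
          rw [hBd, Finset.mem_filter, Finset.mem_Ico] at hy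
          rw [Finset.mem_Ico]
          omega
        · rw [Nat.card_Ico]; omega
      · refine (Finset.card_le_card (t := Finset.Ico m (m + t.natAbs)) ?_).trans ?_
        · intro y hy
          rw [hBd, Finset.mem_filter, Finset.mem_Ico] at hy
          rw [Finset.mem_Ico]
          omega
        · rw [Nat.card_Ico]; omega
    have h2 : ((t.natAbs : ℤ) : ℝ) = |(t : ℝ)| := by
      rw [Int.natCast_natAbs, Int.cast_abs]
    rw [← h2]
    exact_mod_cast h1
  have hBL : Bd ⊆ Finset.range L := fun y hy => by
    have := Finset.mem_Ico.mp (Finset.mem_filter.mp hy).1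
    exact Finset.mem_range.mpr (by omega)
  have hmain : ∑ y ∈ Finset.range L, indic A y ≤
      ∑ y ∈ Finset.range L, ((∑ y' ∈ Finset.range L, if (y' : ℤ) = y + t then
        indic A y * indic (Finset.Ico m (m + N)) y' else 0) + indic Bd y) := by
    refine Finset.sum_le_sum fun y _ => ?_
    have hnn : ∀ y' ∈ Finset.range L, 0 ≤ if (y' : ℤ) = y + t then
        indic A y * indic (Finset.Ico m (m + N)) y' else 0 := by
      intro y' _
      split_ifs
      · exact mul_nonneg (indic_nonneg _ _) (indic_nonneg _ _)
      · exact le_rfl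
    by_cases hyA : y ∈ A
    · by_cases hyB : y ∈ Bd
      · have h1 := Finset.sum_nonneg hnn
        have h2 : indic Bd y = 1 := by rw [indic, if_pos hyB]
        linarith [indic_le_one A y]
      · have hy : (m : ℤ) ≤ y + t ∧ (y : ℤ) + t < m + N := by
          by_contra h
          exact hyB (Finset.mem_filter.mpr ⟨hA hyA, h⟩)
        have hmem : ((y : ℤ) + t).toNat ∈ Finset.range L := Finset.mem_range.mpr (by omega)
        have h1 := Finset.single_le_sum hnn hmem
        rw [if_pos (by omega)] at h1
        have h2 : indic (Finset.Ico m (m + N)) ((y : ℤ) + t).toNat = 1 := by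
          rw [indic, if_pos (Finset.mem_Ico.mpr (by omega))]
        rw [h2, mul_one] at h1
        linarith [indic_nonneg Bd y]
    · have : indic A y = 0 := by rw [indic, if_neg hyA]
      rw [this]
      exact add_nonneg (by simp) (indic_nonneg _ _)
  rw [Finset.sum_add_distrib, sum_indic hAL, sum_indic hBL] at hmain
  rw [diffCount]
  linarith

lemma le_neg_diffCount_balanced {A : Finset ℕ} {m N L : ℕ} (hA : A ⊆ Finset.Ico m (m + N))
    (hL : m + N ≤ L) {δ : ℝ} (h0 : 0 ≤ δ) (hδ : δ * N = A.card) (t : ℤ) :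
    δ ^ 2 * N - 2 * δ * |(t : ℝ)| - diffCount L t (indic A) (indic A) ≤
      -diffCount L t (balanced A (Finset.Ico m (m + N)) δ)
        (balanced A (Finset.Ico m (m + N)) δ) := by
  have hIL : Finset.Ico m (m + N) ⊆ Finset.range L := fun y hy => by
    have := Finset.mem_Ico.mp hy
    exact Finset.mem_range.mpr (by omega)
  rw [diffCount_balanced]
  have h1 := le_diffCount_add hA hL t
  have h2 := le_diffCount_add hA hL (-t)
  rw [← diffCount_comm] at h2
  have h3 := diffCount_le (B := Finset.Ico m (m + N)) hIL t
  rw [Nat.card_Ico, Nat.add_sub_cancel_left] at h3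
  push_cast at h2
  rw [abs_neg, ← hδ] at h2
  rw [← hδ] at h1
  have e1 := mul_le_mul_of_nonneg_left h1 h0
  have e2 := mul_le_mul_of_nonneg_left h2 h0
  have e3 := mul_le_mul_of_nonneg_left h3 (sq_nonneg δ)
  nlinarith

lemma sum_diffCount_le {A : Finset ℕ} {L M : ℕ} (hA : A ⊆ Finset.range L) {F : Polynomial ℤ}
    (hF : F ≠ 0) (hAF : ∀ a ∈ A, ∀ a' ∈ A, ∀ x : ℕ, F.eval (x : ℤ) ≠ 0 →
      (a : ℤ) - a' ≠ F.eval (x : ℤ)) :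
    ∑ x ∈ Finset.range M, diffCount L (F.eval (x : ℤ)) (indic A) (indic A) ≤
      F.natDegree * A.card := by
  classical
  have h1 : ∀ x ∈ Finset.range M, diffCount L (F.eval (x : ℤ)) (indic A) (indic A) ≤
      if F.eval (x : ℤ) = 0 then (A.card : ℝ) else 0 := by
    intro x _
    split_ifs with h
    · exact diffCount_le hA _
    · refine (Finset.sum_eq_zero fun y _ => Finset.sum_eq_zero fun y' _ => ?_).le
      split_ifs with hy
      · rw [indic, indic]
        by_cases hy1 : y ∈ A
        · by_cases hy2 : y' ∈ A
          · exact absurd (by omega) (hAF y' hy2 y hy1 x h)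
          · rw [if_neg hy2, mul_zero]
        · rw [if_neg hy1, zero_mul]
      · rfl
  refine (Finset.sum_le_sum h1).trans ?_
  rw [← Finset.sum_filter, Finset.sum_const, nsmul_eq_mul]
  refine mul_le_mul_of_nonneg_right ?_ (Nat.cast_nonneg _)
  have h2 : ((Finset.range M).filter fun x : ℕ => F.eval (x : ℤ) = 0).card ≤
      F.roots.toFinset.card := by
    refine Finset.card_le_card_of_injOn (fun x : ℕ => (x : ℤ)) (fun x hx => ?_)
      (fun a _ b _ h => by simpa using h)
    have hx' := (Finset.mem_filter.mp hx).2
    simpa [hF] using hx'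
  have h3 := h2.trans ((Multiset.toFinset_card_le _).trans (Polynomial.card_roots' F))
  exact_mod_cast h3

end Balanced

section Windows

variable {A : Finset ℕ} {m N Q W n u : ℕ} {δ : ℝ}

lemma window_trivial {E : ℕ} {I : Finset ℕ} (hA : A ⊆ I) (h0 : 0 ≤ δ) (h1 : δ ≤ 1) (u m Q : ℕ) :
    ∑ θ ∈ fracs Q, fracWeight E θ.1 * ‖∑ i ∈ Finset.range m,
      (balanced A I δ (u + i) : ℂ) * ee ((θ.2 : ℝ) / θ.1 * i)‖ ^ 2 ≤ (Q : ℝ) ^ 2 * (m : ℝ) ^ 2 := by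
  have hterm : ∀ θ ∈ fracs Q, fracWeight E θ.1 * ‖∑ i ∈ Finset.range m,
      (balanced A I δ (u + i) : ℂ) * ee ((θ.2 : ℝ) / θ.1 * i)‖ ^ 2 ≤ (m : ℝ) ^ 2 := by
    intro θ _
    have h2 : ‖∑ i ∈ Finset.range m,
        (balanced A I δ (u + i) : ℂ) * ee ((θ.2 : ℝ) / θ.1 * i)‖ ≤ m := by
      refine (norm_sum_le _ _).trans ?_
      calc _ ≤ ∑ i ∈ Finset.range m, (1 : ℝ) := by
            refine Finset.sum_le_sum fun i _ => ?_
            rw [norm_mul, norm_ee, mul_one, Complex.norm_real, Real.norm_eq_abs]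
            exact abs_balanced_le hA h0 h1 _
        _ = m := by simp
    calc _ ≤ 1 * (m : ℝ) ^ 2 :=
          mul_le_mul (fracWeight_le_one _) (pow_le_pow_left₀ (norm_nonneg _) h2 2) (by positivity)
            zero_le_one
      _ = _ := one_mul _
  refine (Finset.sum_le_sum hterm).trans ?_
  rw [Finset.sum_const, nsmul_eq_mul]
  refine mul_le_mul_of_nonneg_right ?_ (by positivity)
  exact_mod_cast card_fracs_le Q

lemma balanced_full_window (hu : m ≤ u) (huN : u ≤ N) {i : ℕ} (hi : i < m) :
    balanced A (Finset.Ico m (m + N)) δ (u + i) = indic A (u + i) - δ := by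
  rw [balanced, indic, if_pos (c := u + i ∈ Finset.Ico m (m + N)), mul_one]
  rw [Finset.mem_Ico]
  omega

lemma norm_geom_frac_le {θ : ℕ × ℕ} (hθ : θ ∈ fracs Q) (h1 : θ.1 ≠ 1) (m : ℕ) :
    ‖∑ i ∈ Finset.range m, ee ((θ.2 : ℝ) / θ.1 * i)‖ ≤ Q := by
  obtain ⟨b1, b2, b3, b4⟩ := mem_fracs.mp hθ
  have hb0 : (0 : ℝ) < θ.1 := by exact_mod_cast b1
  have hg := norm_geom_ee_mul_abs_le m ((θ.2 : ℝ) / θ.1)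
  simp_rw [mul_comm _ ((θ.2 : ℝ) / θ.1)] at hg
  set z := round ((θ.2 : ℝ) / θ.1) with hz
  have hne : (θ.2 : ℤ) - z * θ.1 ≠ 0 := by
    intro h
    have hdvd : (θ.1 : ℤ) ∣ (θ.2 : ℤ) := ⟨z, by linarith⟩
    have hdvd' : θ.1 ∣ θ.2 := by exact_mod_cast hdvd
    exact h1 (Nat.eq_one_of_dvd_coprimes b4 hdvd' dvd_rfl)
  have h2 : (1 : ℝ) ≤ |(θ.2 : ℝ) / θ.1 - z| * θ.1 := by
    have h3 : |(θ.2 : ℝ) / θ.1 - z| * θ.1 = |(((θ.2 : ℤ) - z * θ.1 : ℤ) : ℝ)| := by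
      conv_lhs => rw [← abs_of_pos hb0, ← abs_mul, abs_of_pos hb0]
      congr 1
      push_cast
      field_simp
    rw [h3]
    exact_mod_cast Int.one_le_abs hne
  set S := ‖∑ i ∈ Finset.range m, ee ((θ.2 : ℝ) / θ.1 * i)‖
  have hS : 0 ≤ S := norm_nonneg _
  have h4 : S ≤ θ.1 := by
    calc S ≤ S * (|(θ.2 : ℝ) / θ.1 - z| * θ.1) := le_mul_of_one_le_right hS h2
      _ = (S * |(θ.2 : ℝ) / θ.1 - z|) * θ.1 := by ring
      _ ≤ 1 / 2 * θ.1 := by gcongr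
      _ ≤ θ.1 := by linarith
  exact h4.trans (by exact_mod_cast b2)

lemma window_rough {E : ℕ} (hu : m ≤ u) (huN : u ≤ N) (h0 : 0 ≤ δ) {K : ℝ}
    (hK : ∑ θ ∈ (fracs Q).filter fun θ => ¬ θ.1 ∣ W, fracWeight E θ.1 *
      ‖∑ i ∈ Finset.range m,
        (if u + i ∈ A then (1 : ℂ) else 0) * ee ((θ.2 : ℝ) / θ.1 * i)‖ ^ 2 ≤ K) :
    ∑ θ ∈ (fracs Q).filter fun θ => ¬ θ.1 ∣ W, fracWeight E θ.1 * ‖∑ i ∈ Finset.range m,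
      (balanced A (Finset.Ico m (m + N)) δ (u + i) : ℂ) * ee ((θ.2 : ℝ) / θ.1 * i)‖ ^ 2 ≤
      2 * K + 2 * δ ^ 2 * (Q : ℝ) ^ 4 := by
  have hterm : ∀ θ ∈ (fracs Q).filter fun θ => ¬ θ.1 ∣ W,
      fracWeight E θ.1 * ‖∑ i ∈ Finset.range m,
        (balanced A (Finset.Ico m (m + N)) δ (u + i) : ℂ) * ee ((θ.2 : ℝ) / θ.1 * i)‖ ^ 2 ≤
      2 * (fracWeight E θ.1 * ‖∑ i ∈ Finset.range m,
        (if u + i ∈ A then (1 : ℂ) else 0) * ee ((θ.2 : ℝ) / θ.1 * i)‖ ^ 2) +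
      2 * δ ^ 2 * (Q : ℝ) ^ 2 := by
    intro θ hθ
    rw [Finset.mem_filter] at hθ
    have h1 : θ.1 ≠ 1 := fun h => hθ.2 (h ▸ one_dvd _)
    have hg := norm_geom_frac_le hθ.1 h1 m
    have hsplit : ∑ i ∈ Finset.range m,
        (balanced A (Finset.Ico m (m + N)) δ (u + i) : ℂ) * ee ((θ.2 : ℝ) / θ.1 * i) =
        ∑ i ∈ Finset.range m, (if u + i ∈ A then (1 : ℂ) else 0) * ee ((θ.2 : ℝ) / θ.1 * i) -
        δ * ∑ i ∈ Finset.range m, ee ((θ.2 : ℝ) / θ.1 * i) := by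
      rw [Finset.mul_sum, ← Finset.sum_sub_distrib]
      refine Finset.sum_congr rfl fun i hi => ?_
      rw [balanced_full_window hu huN (Finset.mem_range.mp hi), indic]
      split_ifs <;> push_cast <;> ring
    rw [hsplit]
    set X := ∑ i ∈ Finset.range m, (if u + i ∈ A then (1 : ℂ) else 0) * ee ((θ.2 : ℝ) / θ.1 * i)
    set Y := ∑ i ∈ Finset.range m, ee ((θ.2 : ℝ) / θ.1 * i)
    have hXY : ‖X - δ * Y‖ ≤ ‖X‖ + δ * Q := by
      refine (norm_sub_le _ _).trans ?_
      rw [norm_mul, Complex.norm_real, Real.norm_eq_abs, abs_of_nonneg h0]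
      gcongr
    have hsq : ‖X - δ * Y‖ ^ 2 ≤ 2 * ‖X‖ ^ 2 + 2 * δ ^ 2 * (Q : ℝ) ^ 2 := by
      have := pow_le_pow_left₀ (norm_nonneg _) hXY 2
      nlinarith [sq_nonneg (‖X‖ - δ * Q)]
    have hw0 := fracWeight_nonneg (E := E) θ.1
    have hw1 := fracWeight_le_one (E := E) θ.1
    have hc : (0 : ℝ) ≤ 2 * δ ^ 2 * (Q : ℝ) ^ 2 := by positivity
    nlinarith [mul_le_mul_of_nonneg_left hsq hw0, mul_le_mul_of_nonneg_right hw1 hc]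
  refine (Finset.sum_le_sum hterm).trans ?_
  rw [Finset.sum_add_distrib, ← Finset.mul_sum, Finset.sum_const, nsmul_eq_mul]
  have hcard : ((((fracs Q).filter fun θ => ¬ θ.1 ∣ W).card : ℕ) : ℝ) ≤ (Q : ℝ) ^ 2 := by
    exact_mod_cast (Finset.card_filter_le _ _).trans (card_fracs_le Q)
  have hc : (0 : ℝ) ≤ 2 * δ ^ 2 * (Q : ℝ) ^ 2 := by positivity
  have := mul_le_mul_of_nonneg_right hcard hc
  nlinarith

lemma window_smooth {E : ℕ} {η : ℝ} (hW : 0 < W) (hu : W * n ≤ u) (huN : u ≤ N)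
    (hA : ∀ c < W,
      (((Finset.range n).filter fun t => u + c + W * t ∈ A).card : ℝ) ≤ (1 + η) * δ * n) :
    ∑ θ ∈ (fracs Q).filter fun θ => θ.1 ∣ W, fracWeight E θ.1 * ‖∑ i ∈ Finset.range (W * n),
      (balanced A (Finset.Ico (W * n) (W * n + N)) δ (u + i) : ℂ) *
        ee ((θ.2 : ℝ) / θ.1 * i)‖ ^ 2 ≤
      δ ^ 2 * ((W * n : ℕ) : ℝ) ^ 2 - (1 - η) * δ * ((W * n : ℕ) : ℝ) *
        ∑ i ∈ Finset.range (W * n), indic A (u + i) := by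
  have hW' : (W : ℝ) ≠ 0 := by positivity
  have h1 := sum_le_sum_of_injOn' (s := (fracs Q).filter fun θ => θ.1 ∣ W) (t := Finset.range W)
    (fun θ => W / θ.1 * θ.2)
    (f := fun θ => fracWeight E θ.1 * ‖∑ i ∈ Finset.range (W * n),
      (balanced A (Finset.Ico (W * n) (W * n + N)) δ (u + i) : ℂ) *
        ee ((θ.2 : ℝ) / θ.1 * i)‖ ^ 2)
    (g := fun j => ‖∑ i ∈ Finset.range (W * n),
      (balanced A (Finset.Ico (W * n) (W * n + N)) δ (u + i) : ℂ) * ee ((j : ℝ) / W * i)‖ ^ 2)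
  have hfrac : ∀ θ ∈ (fracs Q).filter fun θ => θ.1 ∣ W,
      (((W / θ.1 * θ.2 : ℕ) : ℝ)) / W = (θ.2 : ℝ) / θ.1 := by
    intro θ hθ
    rw [Finset.mem_filter] at hθ
    obtain ⟨b1, -⟩ := mem_fracs.mp hθ.1
    have hb : (θ.1 : ℝ) ≠ 0 := by positivity
    push_cast [Nat.cast_div hθ.2 hb]
    field_simp
  have h2 := h1 ?_ ?_ ?_ ?_
  · refine h2.trans ?_
    rw [window_parseval hW n fun i =>
      (balanced A (Finset.Ico (W * n) (W * n + N)) δ (u + i) : ℂ)]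
    have hc : ∀ c ∈ Finset.range W, ‖∑ t ∈ Finset.range n,
        (balanced A (Finset.Ico (W * n) (W * n + N)) δ (u + (c + W * t)) : ℂ)‖ ^ 2 ≤
        δ ^ 2 * (n : ℝ) ^ 2 -
          (1 - η) * δ * n * ∑ t ∈ Finset.range n, indic A (u + (c + W * t)) := by
      intro c hc
      rw [Finset.mem_range] at hc
      have hlt : ∀ t ∈ Finset.range n, c + W * t < W * n := by
        intro t ht
        have : t + 1 ≤ n := Finset.mem_range.mp ht
        have := Nat.mul_le_mul_left W this
        rw [Nat.mul_add] at this
        omega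
      have hx : ∑ t ∈ Finset.range n, indic A (u + (c + W * t)) =
          ((Finset.range n).filter fun t => u + c + W * t ∈ A).card := by
        simp only [indic]
        rw [Finset.sum_boole]
        simp only [add_assoc]
      have hsum : ∑ t ∈ Finset.range n,
          (balanced A (Finset.Ico (W * n) (W * n + N)) δ (u + (c + W * t)) : ℂ) =
          (((∑ t ∈ Finset.range n, indic A (u + (c + W * t))) - δ * n : ℝ) : ℂ) := by
        rw [Finset.sum_congr rfl fun t ht => by
          rw [balanced_full_window hu huN (hlt t ht)]]
        push_cast
        rw [Finset.sum_sub_distrib, Finset.sum_const, Finset.card_range, nsmul_eq_mul]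
        ring
      rw [hsum, Complex.norm_real, Real.norm_eq_abs, sq_abs]
      have hx1 := hA c hc
      rw [← hx] at hx1
      have hx0 : 0 ≤ ∑ t ∈ Finset.range n, indic A (u + (c + W * t)) :=
        Finset.sum_nonneg fun _ _ => indic_nonneg _ _
      nlinarith
    calc _ ≤ (W : ℝ) * ∑ c ∈ Finset.range W, (δ ^ 2 * (n : ℝ) ^ 2 -
          (1 - η) * δ * n * ∑ t ∈ Finset.range n, indic A (u + (c + W * t))) := by
          exact mul_le_mul_of_nonneg_left (Finset.sum_le_sum hc) (Nat.cast_nonneg W)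
      _ = _ := by
          rw [Finset.sum_sub_distrib, Finset.sum_const, Finset.card_range, nsmul_eq_mul,
            sum_range_mul_eq W n (fun i => indic A (u + i)), Finset.mul_sum (Finset.range W) _
              ((1 - η) * δ * ((W * n : ℕ) : ℝ)), mul_sub, Finset.mul_sum (Finset.range W)]
          congr 1
          · push_cast
            ring
          · refine Finset.sum_congr rfl fun c _ => ?_
            push_cast
            ring
  · intro θ hθ
    rw [Finset.mem_filter] at hθ
    obtain ⟨b1, -, b3, -⟩ := mem_fracs.mp hθ.1
    rw [Finset.mem_range]
    calc W / θ.1 * θ.2 < W / θ.1 * θ.1 :=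
          Nat.mul_lt_mul_of_pos_left b3 (Nat.div_pos (Nat.le_of_dvd hW hθ.2) b1)
      _ = W := Nat.div_mul_cancel hθ.2
  · intro θ hθ θ' hθ' h
    have m1 := Finset.mem_coe.mp hθ
    have m2 := Finset.mem_coe.mp hθ'
    refine fracs_eq_of_sub_int (z := 0) (Finset.mem_filter.mp m1).1 (Finset.mem_filter.mp m2).1 ?_
    have h' : W / θ.1 * θ.2 = W / θ'.1 * θ'.2 := h
    rw [← hfrac θ m1, ← hfrac θ' m2, h', sub_self, Int.cast_zero]
  · intro j _
    positivity
  · intro θ hθ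
    rw [hfrac θ hθ]
    exact mul_le_of_le_one_left (by positivity) (fracWeight_le_one _)

lemma le_sum_window_card (hA : A ⊆ Finset.Ico m (m + N)) :
    (m : ℝ) * (A.card - m) ≤
      ∑ u ∈ Finset.Icc m N, ∑ i ∈ Finset.range m, indic A (u + i) := by
  rw [Finset.sum_comm]
  have h : ∀ i ∈ Finset.range m, (A.card : ℝ) - m ≤ ∑ u ∈ Finset.Icc m N, indic A (u + i) := by
    intro i hi
    rw [Finset.mem_range] at hi
    have h1 : A ⊆ ((Finset.Icc m N).filter fun u => u + i ∈ A).map (addRightEmbedding i) ∪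
        (Finset.Ico m (m + i) ∪ Finset.Ico (N + i + 1) (N + m)) := by
      intro a ha
      have := Finset.mem_Ico.mp (hA ha)
      rw [Finset.mem_union, Finset.mem_union, Finset.mem_Ico, Finset.mem_Ico]
      by_cases h1 : a < m + i
      · exact Or.inr (Or.inl ⟨this.1, h1⟩)
      by_cases h2 : N + i + 1 ≤ a
      · exact Or.inr (Or.inr (by omega))
      refine Or.inl (Finset.mem_map.mpr ⟨a - i, Finset.mem_filter.mpr ⟨?_, ?_⟩, ?_⟩)
      · rw [Finset.mem_Icc]; omega
      · rwa [Nat.sub_add_cancel (by omega)]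
      · simp only [addRightEmbedding_apply]; omega
    have h2 := (Finset.card_le_card h1).trans ((Finset.card_union_le _ _).trans
      (Nat.add_le_add_left (Finset.card_union_le _ _) _))
    rw [Finset.card_map, Nat.card_Ico, Nat.card_Ico] at h2
    simp only [indic]
    rw [Finset.sum_boole]
    have h3 : A.card ≤ ((Finset.Icc m N).filter fun u => u + i ∈ A).card + m := by omega
    have h4 : (A.card : ℝ) ≤ (((Finset.Icc m N).filter fun u => u + i ∈ A).card : ℝ) + m := by
      exact_mod_cast h3
    linarith
  calc _ = ∑ i ∈ Finset.range m, ((A.card : ℝ) - m) := by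
        rw [Finset.sum_const, Finset.card_range, nsmul_eq_mul]
    _ ≤ _ := Finset.sum_le_sum h

end Windows

lemma card_filter_modEq_le (A : Finset ℕ) (u W n r m : ℕ) :
    ((Finset.range n).filter fun t => u + W * t ∈ A ∧ t ≡ r [MOD m]).card ≤
      ((Finset.range (n / m + 1)).filter fun j => u + W * (r % m) + W * m * j ∈ A).card := by
  refine Finset.card_le_card_of_injOn (fun t => t / m) ?_ ?_
  · intro t ht
    obtain ⟨h1, h2, h3⟩ := Finset.mem_filter.mp (Finset.mem_coe.mp ht)
    have h4 : t % m = r % m := h3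
    refine Finset.mem_coe.mpr (Finset.mem_filter.mpr ⟨?_, ?_⟩)
    · exact Finset.mem_range.mpr
        (Nat.lt_succ_of_le (Nat.div_le_div_right (Finset.mem_range.mp h1).le))
    · have h5 : u + W * (r % m) + W * m * (t / m) = u + W * t := by
        rw [← h4, add_assoc, mul_assoc, ← mul_add, Nat.mod_add_div]
      simpa only [h5] using h2
  · intro t ht t' ht' h
    have h1 : t % m = r % m := (Finset.mem_filter.mp (Finset.mem_coe.mp ht)).2.2
    have h2 : t' % m = r % m := (Finset.mem_filter.mp (Finset.mem_coe.mp ht')).2.2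
    have h3 : t / m = t' / m := h
    rw [← Nat.mod_add_div t m, ← Nat.mod_add_div t' m, h1, h2, h3]

/-- `A` has relative density at most `δ` on every progression of step at most `Z` and length at
least `n`. -/
def ProgBound (A : Finset ℕ) (Z n : ℕ) (δ : ℝ) : Prop :=
  ∀ q, 1 ≤ q → q ≤ Z → ∀ a len, n ≤ len →
    (((Finset.range len).filter fun j => a + q * j ∈ A).card : ℝ) ≤ δ * len

lemma prod_primePow_le {w Q : ℕ} (hQ : 1 ≤ Q) (V : Finset (roughPrimes w Q)) {d : ℕ}
    (hV : V.card ≤ d) : ∏ i ∈ V, primePow w Q i ≤ Q ^ d :=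
  (Finset.prod_le_pow_card _ _ _ fun i _ => primePow_le i).trans (Nat.pow_le_pow_right hQ hV)

lemma full_window {E k w Q n n₀ N u : ℕ} {A : Finset ℕ} {δ : ℝ} (hE : 1 ≤ E) (hkE : 8 * E ≤ k)
    (hw : (8 * k) ^ (8 * E) ≤ w) (hQ : 1 ≤ Q) (hδ : 0 < δ)
    (hn : n₀ * Q ^ Nat.log 2 Q ≤ n) (hn4 : 4 * Q ^ Nat.log 2 Q ≤ n)
    (hA : ProgBound A (smoothMod w Q * Q ^ Nat.log 2 Q) n₀ ((1 + 1 / 64) * δ))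
    (hkδ : 3 ≤ 2 * δ * 4 ^ (2 * k))
    (hX : (((Q : ℝ) + 1) ^ (2 * Nat.log 2 Q)) ^ (2 * k + 1) ≤ (2 * δ) ^ (2 * k) * n)
    (hu : smoothMod w Q * n ≤ u) (huN : u ≤ N) :
    ∑ θ ∈ fracs Q, fracWeight E θ.1 * ‖∑ i ∈ Finset.range (smoothMod w Q * n),
      (balanced A (Finset.Ico (smoothMod w Q * n) (smoothMod w Q * n + N)) δ (u + i) : ℂ) *
        ee ((θ.2 : ℝ) / θ.1 * i)‖ ^ 2 ≤
      δ ^ 2 * ((smoothMod w Q * n : ℕ) : ℝ) ^ 2 -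
        (1 - 1 / 64) * δ * ((smoothMod w Q * n : ℕ) : ℝ) *
          ∑ i ∈ Finset.range (smoothMod w Q * n), indic A (u + i) +
        (2 * (32 / (8 * k) ^ 4 * (2 * δ) ^ 2 * ((smoothMod w Q * n : ℕ) : ℝ) ^ 2) +
          2 * δ ^ 2 * (Q : ℝ) ^ 4) := by
  have hW : 0 < smoothMod w Q := smoothMod_pos
  have hQd : 1 ≤ Q ^ Nat.log 2 Q := Nat.one_le_pow _ _ hQ
  have hnpos : 0 < n := by omega
  rw [← Finset.sum_filter_add_sum_filter_not (fracs Q) fun θ => θ.1 ∣ smoothMod w Q]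
  refine add_le_add (window_smooth hW hu huN fun c _ => ?_) (window_rough hu huN hδ.le ?_)
  · exact hA _ hW (Nat.le_mul_of_pos_right _ hQd) (u + c) n
      ((Nat.le_mul_of_pos_right _ hQd).trans hn)
  · refine rough_window hE hkE hw hnpos A u (by positivity) (fun c _ V hV r => ?_) hkδ hX
    set m := ∏ i ∈ V, primePow w Q i with hm
    have hm0 : 0 < m := Finset.prod_pos fun i _ => primePow_pos i
    have hmQ : m ≤ Q ^ Nat.log 2 Q := prod_primePow_le hQ V hV
    have h1 : (((Finset.range n).filter fun t =>
        u + c + smoothMod w Q * t ∈ A ∧ t ≡ r [MOD m]).card : ℝ) ≤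
        ((Finset.range (n / m + 1)).filter fun j =>
          u + c + smoothMod w Q * (r % m) + smoothMod w Q * m * j ∈ A).card := by
      exact_mod_cast card_filter_modEq_le A (u + c) (smoothMod w Q) n r m
    have hlen : n₀ ≤ n / m := by
      rw [Nat.le_div_iff_mul_le hm0]
      exact (Nat.mul_le_mul_left _ hmQ).trans hn
    have h2 := hA (smoothMod w Q * m) (Nat.mul_pos hW hm0) (Nat.mul_le_mul_left _ hmQ)
      (u + c + smoothMod w Q * (r % m)) (n / m + 1) (by omega)
    have h3 : (m : ℝ) * ((n / m + 1 : ℕ) : ℝ) ≤ n + m := by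
      have : m * (n / m + 1) ≤ n + m := by
        rw [mul_add, mul_one]
        exact Nat.add_le_add_right (Nat.mul_div_le n m) m
      exact_mod_cast this
    have h4 : 4 * (m : ℝ) ≤ n := by
      exact_mod_cast (Nat.mul_le_mul_left 4 hmQ).trans hn4
    calc (m : ℝ) * _ ≤ m * ((1 + 1 / 64) * δ * ((n / m + 1 : ℕ) : ℝ)) := by
          exact mul_le_mul_of_nonneg_left (h1.trans h2) (Nat.cast_nonneg m)
      _ = (1 + 1 / 64) * δ * (m * ((n / m + 1 : ℕ) : ℝ)) := by ring
      _ ≤ (1 + 1 / 64) * δ * (n + m) := by gcongr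
      _ ≤ 2 * δ * n := by nlinarith

lemma windows_energy {E k w Q n n₀ N : ℕ} {A : Finset ℕ} {δ : ℝ} (hE : 1 ≤ E) (hkE : 8 * E ≤ k)
    (hw : (8 * k) ^ (8 * E) ≤ w) (hQ : 1 ≤ Q) (hδ : 0 < δ) (hδ1 : δ ≤ 1)
    (hn : n₀ * Q ^ Nat.log 2 Q ≤ n) (hn4 : 4 * Q ^ Nat.log 2 Q ≤ n) (hn16 : 16 * Q ^ 2 ≤ n)
    (hA : ProgBound A (smoothMod w Q * Q ^ Nat.log 2 Q) n₀ ((1 + 1 / 64) * δ))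
    (hkδ : 3 ≤ 2 * δ * 4 ^ (2 * k))
    (hX : (((Q : ℝ) + 1) ^ (2 * Nat.log 2 Q)) ^ (2 * k + 1) ≤ (2 * δ) ^ (2 * k) * n)
    (hAs : A ⊆ Finset.Ico (smoothMod w Q * n) (smoothMod w Q * n + N)) (hAδ : δ * N = A.card)
    (hN : 128 * ((smoothMod w Q * n : ℕ) : ℝ) * (Q : ℝ) ^ 2 ≤ δ ^ 2 * N) :
    ∑ u ∈ Finset.range (smoothMod w Q * n + N),
      ∑ θ ∈ fracs Q, fracWeight E θ.1 * ‖∑ i ∈ Finset.range (smoothMod w Q * n),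
        (balanced A (Finset.Ico (smoothMod w Q * n) (smoothMod w Q * n + N)) δ (u + i) : ℂ) *
          ee ((θ.2 : ℝ) / θ.1 * i)‖ ^ 2 ≤
      ((smoothMod w Q * n : ℕ) : ℝ) ^ 2 * (δ ^ 2 * N / 16) := by
  have hW : 0 < smoothMod w Q := smoothMod_pos
  have hnpos : 0 < n := by
    have : 1 ≤ Q ^ 2 := Nat.one_le_pow _ _ hQ
    omega
  have hQ1 : (1 : ℝ) ≤ Q := by exact_mod_cast hQ
  have hk8 : (8 : ℝ) ≤ k := by
    have : 8 ≤ k := by omega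
    exact_mod_cast this
  set m := smoothMod w Q * n with hm
  have hmn : n ≤ m := Nat.le_mul_of_pos_left _ hW
  have hm16 : 16 * (Q : ℝ) ^ 2 ≤ m := by exact_mod_cast hn16.trans hmn
  have hm1 : (1 : ℝ) ≤ m := by exact_mod_cast (by omega : 1 ≤ m)
  have hmN' : (m : ℝ) ≤ N := by
    have h1 : δ ^ 2 * (N : ℝ) ≤ 1 * N := by
      gcongr
      exact pow_le_one₀ hδ.le hδ1
    nlinarith [one_le_pow₀ hQ1 (n := 2)]
  have hmN : m ≤ N := by exact_mod_cast hmN'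
  set G : ℕ → ℝ := fun u => ∑ θ ∈ fracs Q, fracWeight E θ.1 * ‖∑ i ∈ Finset.range m,
      (balanced A (Finset.Ico m (m + N)) δ (u + i) : ℂ) * ee ((θ.2 : ℝ) / θ.1 * i)‖ ^ 2 with hG
  set Xs : ℕ → ℝ := fun u => ∑ i ∈ Finset.range m, indic A (u + i) with hXs
  set c1 : ℝ := δ ^ 2 * (m : ℝ) ^ 2 +
    (2 * (32 / (8 * k) ^ 4 * (2 * δ) ^ 2 * (m : ℝ) ^ 2) + 2 * δ ^ 2 * (Q : ℝ) ^ 4) with hc1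
  have hc1' : 0 ≤ c1 := by positivity
  have hcover : Finset.range (m + N) ⊆
      Finset.Icc m N ∪ (Finset.range m ∪ Finset.Ico (N + 1) (N + m)) := by
    intro u hu
    simp only [Finset.mem_union, Finset.mem_Icc, Finset.mem_range, Finset.mem_Ico] at hu ⊢
    omega
  have hGnn : ∀ u, 0 ≤ G u := fun u =>
    Finset.sum_nonneg fun θ _ => mul_nonneg (fracWeight_nonneg _) (by positivity)
  have htriv : ∀ u, G u ≤ (Q : ℝ) ^ 2 * (m : ℝ) ^ 2 := fun u => window_trivial hAs hδ.le hδ1 u m Q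
  have hfull : ∀ u ∈ Finset.Icc m N, G u ≤ c1 - (1 - 1 / 64) * δ * m * Xs u := by
    intro u hu
    rw [Finset.mem_Icc] at hu
    have := full_window hE hkE hw hQ hδ hn hn4 hA hkδ hX hu.1 hu.2
    rw [hc1]
    simp only [hG, hXs]
    linarith
  have hsum : ∑ u ∈ Finset.range (m + N), G u ≤
      ∑ u ∈ Finset.Icc m N, G u + ∑ u ∈ Finset.range m ∪ Finset.Ico (N + 1) (N + m), G u := by
    refine (Finset.sum_le_sum_of_subset_of_nonneg hcover fun u _ _ => hGnn u).trans ?_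
    rw [← Finset.sum_union_inter]
    exact le_add_of_nonneg_right (Finset.sum_nonneg fun u _ => hGnn u)
  have hedge : ∑ u ∈ Finset.range m ∪ Finset.Ico (N + 1) (N + m), G u ≤
      2 * m * ((Q : ℝ) ^ 2 * (m : ℝ) ^ 2) := by
    refine (Finset.sum_le_sum fun u _ => htriv u).trans ?_
    rw [Finset.sum_const, nsmul_eq_mul]
    refine mul_le_mul_of_nonneg_right ?_ (by positivity)
    have h1 := Finset.card_union_le (Finset.range m) (Finset.Ico (N + 1) (N + m))
    rw [Finset.card_range, Nat.card_Ico] at h1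
    have h2 : (Finset.range m ∪ Finset.Ico (N + 1) (N + m)).card ≤ 2 * m := by omega
    exact_mod_cast h2
  have hXsum := le_sum_window_card hAs
  have hmain : ∑ u ∈ Finset.Icc m N, G u ≤
      N * c1 - (1 - 1 / 64) * δ * m * (m * (A.card - m)) := by
    refine (Finset.sum_le_sum hfull).trans ?_
    rw [Finset.sum_sub_distrib, Finset.sum_const, nsmul_eq_mul, ← Finset.mul_sum, Nat.card_Icc]
    have h1 : ((N + 1 - m : ℕ) : ℝ) ≤ N := by exact_mod_cast (by omega : N + 1 - m ≤ N)
    have h2 := mul_le_mul_of_nonneg_right h1 hc1'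
    have h3 : 0 ≤ (1 - 1 / 64) * δ * (m : ℝ) := by
      have : (0 : ℝ) ≤ m := Nat.cast_nonneg m
      nlinarith [mul_nonneg hδ.le this]
    have h4 := mul_le_mul_of_nonneg_left hXsum h3
    simp only [hXs]
    linarith
  have hk4 : 32 / (8 * (k : ℝ)) ^ 4 ≤ 1 / 1024 := by
    rw [div_le_div_iff₀ (by positivity) (by norm_num)]
    have : (64 : ℝ) ^ 4 ≤ (8 * (k : ℝ)) ^ 4 := pow_le_pow_left₀ (by norm_num) (by linarith) 4
    linarith
  have hQ4 : (Q : ℝ) ^ 4 ≤ (m : ℝ) ^ 2 / 256 := by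
    have := pow_le_pow_left₀ (by positivity) hm16 2
    nlinarith
  have hδN : 0 ≤ δ ^ 2 * (N : ℝ) := by positivity
  have hδm : 128 * (m : ℝ) * δ ≤ δ ^ 2 * N := by
    have : (m : ℝ) * δ ≤ m * 1 := by gcongr
    nlinarith [one_le_pow₀ hQ1 (n := 2)]
  have hc1le : c1 ≤ (m : ℝ) ^ 2 * (δ ^ 2 * (1 + 1 / 64)) := by
    have e1 : 32 / (8 * (k : ℝ)) ^ 4 * (2 * δ) ^ 2 * (m : ℝ) ^ 2 ≤
        1 / 1024 * (2 * δ) ^ 2 * (m : ℝ) ^ 2 := by gcongr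
    have e2 : 2 * δ ^ 2 * (Q : ℝ) ^ 4 ≤ 2 * δ ^ 2 * ((m : ℝ) ^ 2 / 256) := by gcongr
    have e3 : c1 ≤ δ ^ 2 * (m : ℝ) ^ 2 + (2 * (1 / 1024 * (2 * δ) ^ 2 * (m : ℝ) ^ 2) +
        2 * δ ^ 2 * ((m : ℝ) ^ 2 / 256)) := by
      rw [hc1]
      linarith
    refine e3.trans (le_of_eq ?_)
    ring
  rw [← hAδ] at hmain
  have hm2 : 0 ≤ (m : ℝ) ^ 2 := by positivity
  calc ∑ u ∈ Finset.range (m + N), G u ≤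
      N * ((m : ℝ) ^ 2 * (δ ^ 2 * (1 + 1 / 64))) - (1 - 1 / 64) * δ * m * (m * (δ * N - m)) +
        2 * m * ((Q : ℝ) ^ 2 * (m : ℝ) ^ 2) := by
        have := mul_le_mul_of_nonneg_left hc1le (Nat.cast_nonneg (α := ℝ) N)
        linarith
    _ = (m : ℝ) ^ 2 * (δ ^ 2 * N / 32 + (1 - 1 / 64) * (m * δ) + 2 * (m * (Q : ℝ) ^ 2)) := by ring
    _ ≤ _ := by
        refine mul_le_mul_of_nonneg_left ?_ hm2
        have : 0 ≤ (m : ℝ) * δ := by positivity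
        linarith

lemma abs_sum_diffCount_le {k E : ℕ} (hW : WeylInverse k E) (hE : 1 ≤ E) (hk : 1 ≤ k)
    {F : Polynomial ℤ} (hdeg : F.natDegree ≤ k) (hlead : F.coeff k ≠ 0)
    (hgcd : ∀ d : ℕ, (∀ j, 1 ≤ j → (d : ℤ) ∣ F.coeff j) → d = 1)
    {H : ℝ} (hH1 : 1 ≤ H) (hH : ∀ j, |(F.coeff j : ℝ)| ≤ H) {R : ℕ} (hR : 2 ≤ R) {M m : ℕ}
    (hM : 2 * (R : ℝ) ^ (3 * E) * H ^ 2 < M) (hm : 0 < m) (hmM : 16 * ((m : ℝ) * (R : ℝ) ^ E) ≤ (M : ℝ) ^ k)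
    {L : ℕ} (f : ℕ → ℝ) (hf0 : ∀ y < m, f y = 0) (hfL : ∀ y, L ≤ y → f y = 0)
    (hL : 0 < L) (hFL : ∀ x < M, |F.eval (x : ℤ)| ≤ L) :
    |∑ x ∈ Finset.range M, diffCount L (F.eval (x : ℤ)) f f| ≤
      M * (1 / R * ∑ y ∈ Finset.range L, f y ^ 2 + 4 / (m : ℝ) ^ 2 *
        ∑ u ∈ Finset.range L, ∑ θ ∈ fracs (R ^ E), fracWeight E θ.1 *
          ‖∑ i ∈ Finset.range m, (f (u + i) : ℂ) * ee ((θ.2 : ℝ) / θ.1 * i)‖ ^ 2) := by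
  have hn : 0 < 2 * L := by omega
  have hn' : (0 : ℝ) < ((2 * L : ℕ) : ℝ) := by exact_mod_cast hn
  have h1 := fourier_count (L := L) (M := M) hn f (fun x => F.eval (x : ℤ)) fun x hx => by
    have := hFL x hx
    push_cast
    linarith
  refine le_of_mul_le_mul_left (h1.trans ?_) hn'
  set n := 2 * L with hn2
  have hmaj := weyl_majorant hW hE hk hdeg hlead hgcd hH1 hH hR hM hm hmM
  calc _ ≤ ∑ ξ ∈ Finset.range n, ‖∑ y ∈ Finset.range L, (f y : ℂ) * ee ((ξ : ℝ) / n * y)‖ ^ 2 *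
        (M * (1 / R + 4 / (m : ℝ) ^ 2 * ∑ θ ∈ fracs (R ^ E), fracWeight E θ.1 *
          ‖∑ i ∈ Finset.range m, ee (i * ((ξ : ℝ) / n - (θ.2 : ℝ) / θ.1))‖ ^ 2)) := by
        refine Finset.sum_le_sum fun ξ _ => mul_le_mul_of_nonneg_left ?_ (by positivity)
        exact hmaj _
    _ = M * (1 / R * (∑ ξ ∈ Finset.range n,
          ‖∑ y ∈ Finset.range L, (f y : ℂ) * ee ((ξ : ℝ) / n * y)‖ ^ 2) +
        4 / (m : ℝ) ^ 2 * ∑ θ ∈ fracs (R ^ E), fracWeight E θ.1 * ∑ ξ ∈ Finset.range n,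
          ‖∑ y ∈ Finset.range L, (f y : ℂ) * ee ((ξ : ℝ) / n * y)‖ ^ 2 *
          ‖∑ i ∈ Finset.range m, ee (i * ((ξ : ℝ) / n - (θ.2 : ℝ) / θ.1))‖ ^ 2) := by
        simp only [Finset.mul_sum, mul_add, Finset.sum_add_distrib]
        congr 1
        · exact Finset.sum_congr rfl fun ξ _ => by ring
        · rw [Finset.sum_comm]
          exact Finset.sum_congr rfl fun θ _ => Finset.sum_congr rfl fun ξ _ => by ring
    _ = _ := by
        rw [parseval_range (by omega : L ≤ n) fun y => (f y : ℂ)]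
        have hw : ∀ θ : ℕ × ℕ, _ := fun θ => window_energy (by omega : L ≤ n)
          (fun y => (f y : ℂ)) (fun y hy => by rw [hf0 y hy, Complex.ofReal_zero])
          (fun y hy => by rw [hfL y hy, Complex.ofReal_zero]) ((θ.2 : ℝ) / θ.1)
        simp only [hw]
        rw [Finset.sum_comm (s := Finset.range L)]
        simp only [Complex.norm_real, Real.norm_eq_abs, sq_abs]
        have e : ∀ θ ∈ fracs (R ^ E), fracWeight E θ.1 * ((n : ℝ) * ∑ u ∈ Finset.range L,
            ‖∑ i ∈ Finset.range m, (f (u + i) : ℂ) * ee ((θ.2 : ℝ) / θ.1 * i)‖ ^ 2) =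
            n * ∑ u ∈ Finset.range L, fracWeight E θ.1 *
            ‖∑ i ∈ Finset.range m, (f (u + i) : ℂ) * ee ((θ.2 : ℝ) / θ.1 * i)‖ ^ 2 := by
          intro θ _
          rw [← Finset.mul_sum]
          ring
        rw [Finset.sum_congr rfl e, ← Finset.mul_sum]
        ring

/-- A dense set that is well distributed along progressions has differences of the form `F x`. -/
theorem exists_difference_of_progBound {k E k' w n n₀ N R M : ℕ} {A : Finset ℕ} {δ H : ℝ}
    {F : Polynomial ℤ} (hW : WeylInverse k E) (hE : 1 ≤ E) (hk : 1 ≤ k)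
    (hdeg : F.natDegree ≤ k) (hlead : F.coeff k ≠ 0)
    (hgcd : ∀ d : ℕ, (∀ j, 1 ≤ j → (d : ℤ) ∣ F.coeff j) → d = 1)
    (hH1 : 1 ≤ H) (hH : ∀ j, |(F.coeff j : ℝ)| ≤ H)
    (hkE : 8 * E ≤ k') (hw : (8 * k') ^ (8 * E) ≤ w) (hδ : 0 < δ) (hR2 : 2 ≤ R)
    (hR : 16 ≤ δ * R)
    (hn : n₀ * (R ^ E) ^ Nat.log 2 (R ^ E) ≤ n) (hn4 : 4 * (R ^ E) ^ Nat.log 2 (R ^ E) ≤ n)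
    (hn16 : 16 * (R ^ E) ^ 2 ≤ n)
    (hA : ProgBound A (smoothMod w (R ^ E) * (R ^ E) ^ Nat.log 2 (R ^ E)) n₀ ((1 + 1 / 64) * δ))
    (hkδ : 3 ≤ 2 * δ * 4 ^ (2 * k'))
    (hX : ((((R ^ E : ℕ) : ℝ) + 1) ^ (2 * Nat.log 2 (R ^ E))) ^ (2 * k' + 1) ≤
      (2 * δ) ^ (2 * k') * n)
    (hAs : A ⊆ Finset.Ico (smoothMod w (R ^ E) * n) (smoothMod w (R ^ E) * n + N))
    (hAδ : δ * N = A.card)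
    (hN : 128 * ((smoothMod w (R ^ E) * n : ℕ) : ℝ) * ((R ^ E : ℕ) : ℝ) ^ 2 ≤ δ ^ 2 * N)
    (hM : 2 * (R : ℝ) ^ (3 * E) * H ^ 2 < M)
    (hmM : 16 * (((smoothMod w (R ^ E) * n : ℕ) : ℝ) * (R : ℝ) ^ E) ≤ (M : ℝ) ^ k)
    (hFN : ∀ x < M, 64 * |((F.eval (x : ℤ) : ℤ) : ℝ)| ≤ δ * N) (hkM : 4 * k ≤ δ * M) :
    ∃ a ∈ A, ∃ a' ∈ A, ∃ x : ℕ, F.eval (x : ℤ) ≠ 0 ∧ (a : ℤ) - a' = F.eval (x : ℤ) := by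
  by_contra hcon
  have hno : ∀ a ∈ A, ∀ a' ∈ A, ∀ x : ℕ, F.eval (x : ℤ) ≠ 0 → (a : ℤ) - a' ≠ F.eval (x : ℤ) :=
    fun a ha a' ha' x hx h => hcon ⟨a, ha, a', ha', x, hx, h⟩
  have hQ : 1 ≤ R ^ E := Nat.one_le_pow _ _ (by omega)
  have hW0 : 0 < smoothMod w (R ^ E) := smoothMod_pos
  have hnpos : 0 < n := by
    have : 1 ≤ (R ^ E) ^ 2 := Nat.one_le_pow _ _ hQ
    omega
  set m := smoothMod w (R ^ E) * n with hm
  have hm0 : 0 < m := Nat.mul_pos hW0 hnpos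
  set L := m + N with hL
  have hcardIco : (Finset.Ico m (m + N)).card = N := by rw [Nat.card_Ico]; omega
  have hAN : (A.card : ℝ) ≤ N := by
    exact_mod_cast (Finset.card_le_card hAs).trans hcardIco.le
  have hQ1 : (1 : ℝ) ≤ ((R ^ E : ℕ) : ℝ) := by exact_mod_cast hQ
  have hm1 : (1 : ℝ) ≤ m := by exact_mod_cast hm0
  have hNpos : (0 : ℝ) < N := by
    have h1 : (0 : ℝ) < 128 * (m : ℝ) * ((R ^ E : ℕ) : ℝ) ^ 2 := by positivity
    exact pos_of_mul_pos_right (h1.trans_le hN) (by positivity)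
  have hδ1 : δ ≤ 1 := by
    rw [← hAδ] at hAN
    exact le_of_mul_le_mul_right (by linarith) hNpos
  have hF0 : F ≠ 0 := fun h => hlead (by rw [h, Polynomial.coeff_zero])
  set f := balanced A (Finset.Ico m (m + N)) δ with hf
  have hupper := abs_sum_diffCount_le hW hE hk hdeg hlead hgcd hH1 hH hR2 hM hm0 hmM (L := L) f
    (fun y hy => balanced_eq_zero hAs (by rw [Finset.mem_Ico]; omega))
    (fun y hy => balanced_eq_zero hAs (by rw [Finset.mem_Ico]; omega)) (by omega)
    (fun x hx => by
      have h1 := hFN x hx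
      have h2 : |((F.eval (x : ℤ) : ℤ) : ℝ)| ≤ N := by
        have h3 : δ * N ≤ 1 * N := by gcongr
        have := abs_nonneg ((F.eval (x : ℤ) : ℤ) : ℝ)
        linarith
      have h3 : |F.eval (x : ℤ)| ≤ (N : ℤ) := by exact_mod_cast h2
      rw [hL]
      push_cast
      linarith)
  have hen := windows_energy hE hkE hw hQ hδ hδ1 hn hn4 hn16 hA hkδ hX hAs hAδ hN
  have hsq := sum_balanced_sq_le hAs (L := L) (fun y hy => by
    rw [Finset.mem_Ico] at hy
    exact Finset.mem_range.mpr hy.2) hδ.le (by rw [hcardIco, hAδ])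
  have hdiff := sum_diffCount_le (M := M) (L := L) (A := A) (fun y hy => by
    exact Finset.mem_range.mpr (Finset.mem_Ico.mp (hAs hy)).2) hF0 hno
  have hlow := Finset.sum_le_sum fun x (_ : x ∈ Finset.range M) =>
    le_neg_diffCount_balanced hAs (le_refl L) hδ.le hAδ (F.eval (x : ℤ))
  have hlow2 : ∑ x ∈ Finset.range M, (δ ^ 2 * N - δ ^ 2 * N / 32 -
      diffCount L (F.eval (x : ℤ)) (indic A) (indic A)) ≤
      ∑ x ∈ Finset.range M, -diffCount L (F.eval (x : ℤ)) f f := by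
    refine le_trans (Finset.sum_le_sum fun x hx => ?_) hlow
    have h1 := mul_le_mul_of_nonneg_left (hFN x (Finset.mem_range.mp hx)) hδ.le
    have h2 : δ * (δ * N) = δ ^ 2 * N := by ring
    linarith
  rw [Finset.sum_sub_distrib, Finset.sum_neg_distrib, Finset.sum_const, Finset.card_range,
    nsmul_eq_mul] at hlow2
  have hMpos : (0 : ℝ) < M := lt_of_le_of_lt (by positivity) hM
  have hdiff2 : (F.natDegree : ℝ) * A.card ≤ M * (δ ^ 2 * N) / 4 := by
    have h1 : (F.natDegree : ℝ) ≤ k := by exact_mod_cast hdeg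
    have h2 : (F.natDegree : ℝ) ≤ δ * M / 4 := by linarith
    rw [← hAδ]
    calc (F.natDegree : ℝ) * (δ * N) ≤ δ * M / 4 * (δ * N) := by gcongr
      _ = _ := by ring
  have hRpos : (0 : ℝ) < R := by exact_mod_cast (by omega : 0 < R)
  have hR' : 1 / (R : ℝ) * ∑ y ∈ Finset.range L, f y ^ 2 ≤ δ ^ 2 * N / 16 := by
    calc 1 / (R : ℝ) * ∑ y ∈ Finset.range L, f y ^ 2 ≤ 1 / R * (δ * N) := by
          rw [hAδ]
          gcongr
      _ ≤ δ / 16 * (δ * N) := by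
          refine mul_le_mul_of_nonneg_right ?_ (by positivity)
          rw [div_le_div_iff₀ hRpos (by norm_num)]
          linarith
      _ = _ := by ring
  have hen' : 4 / (m : ℝ) ^ 2 * ∑ u ∈ Finset.range L, ∑ θ ∈ fracs (R ^ E), fracWeight E θ.1 *
      ‖∑ i ∈ Finset.range m, (f (u + i) : ℂ) * ee ((θ.2 : ℝ) / θ.1 * i)‖ ^ 2 ≤
      δ ^ 2 * N / 4 := by
    calc _ ≤ 4 / (m : ℝ) ^ 2 * ((m : ℝ) ^ 2 * (δ ^ 2 * N / 16)) := by gcongr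
      _ = _ := by
        field_simp
        norm_num
  have hup2 := hupper.trans (mul_le_mul_of_nonneg_left (add_le_add hR' hen') hMpos.le)
  have hneg := neg_le_of_abs_le hup2
  have hpos : 0 < M * (δ ^ 2 * N) := by positivity
  nlinarith

lemma ProgBound.map_add {A : Finset ℕ} {Z n : ℕ} {δ : ℝ} (h : ProgBound A Z n δ) (m : ℕ) :
    ProgBound (A.map (addLeftEmbedding m)) Z n δ := by
  classical
  intro q hq hqZ a len hlen
  have hex : ∃ j, m ≤ a + q * j := ⟨m, by nlinarith⟩
  set j₀ := Nat.find hex with hj₀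
  have h1 : m ≤ a + q * j₀ := Nat.find_spec hex
  have key : ∀ j ∈ (((Finset.range len).filter fun j =>
      a + q * j ∈ A.map (addLeftEmbedding m) : Finset ℕ) : Set ℕ),
      j < len ∧ j₀ ≤ j ∧ a + q * j - m ∈ A := by
    intro j hj
    obtain ⟨h2, h3⟩ := Finset.mem_filter.mp (Finset.mem_coe.mp hj)
    obtain ⟨x, hx, hxj⟩ := Finset.mem_map.mp h3
    have hxj' : m + x = a + q * j := hxj
    refine ⟨Finset.mem_range.mp h2, Nat.find_min' hex (by omega), ?_⟩
    rwa [← hxj', Nat.add_sub_cancel_left]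
  refine le_trans ?_ (h q hq hqZ (a + q * j₀ - m) len hlen)
  refine Nat.cast_le.mpr (Finset.card_le_card_of_injOn (fun j => j - j₀) ?_ ?_)
  · intro j hj
    obtain ⟨h2, h3, h4⟩ := key j hj
    refine Finset.mem_coe.mpr (Finset.mem_filter.mpr ⟨Finset.mem_range.mpr ?_, ?_⟩)
    · show j - j₀ < len
      omega
    · show a + q * j₀ - m + q * (j - j₀) ∈ A
      have h5 : q * j = q * j₀ + q * (j - j₀) := by rw [← mul_add, Nat.add_sub_cancel' h3]
      have h6 : a + q * j₀ - m + q * (j - j₀) = a + q * j - m := by omega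
      rwa [h6]
  · intro j hj j' hj' hjj
    have h2 := (key j hj).2.1
    have h3 := (key j' hj').2.1
    have h4 : j - j₀ = j' - j₀ := hjj
    omega

lemma card_le_of_forall_block {B : Finset ℕ} {s n : ℕ} {δ : ℝ} (hs : 0 < s) (hn : 0 < n)
    (hδ : 0 ≤ δ)
    (h : ∀ c, (((Finset.range n).filter fun j => c + s * j ∈ B).card : ℝ) ≤ δ * n) (len : ℕ) :
    (((Finset.range len).filter fun j => j ∈ B).card : ℝ) ≤ δ * len + s * n := by
  have hblock : ∀ t : ℕ, ∑ i ∈ Finset.range (s * n * t), indic B i ≤ δ * (s * n * t : ℕ) := by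
    intro t
    induction t with
    | zero => simp
    | succ t ih =>
      rw [mul_add, mul_one, Finset.sum_range_add,
        sum_range_mul_eq s n fun i => indic B (s * n * t + i)]
      have h1 : ∑ c ∈ Finset.range s, ∑ j ∈ Finset.range n, indic B (s * n * t + (c + s * j)) ≤
          ∑ c ∈ Finset.range s, δ * n := by
        refine Finset.sum_le_sum fun c _ => ?_
        have := h (s * n * t + c)
        simp only [indic]
        rw [Finset.sum_boole]
        simpa only [add_assoc] using this
      rw [Finset.sum_const, Finset.card_range, nsmul_eq_mul] at h1
      push_cast at ih ⊢
      linarith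
  have hsum : (((Finset.range len).filter fun j => j ∈ B).card : ℝ) =
      ∑ i ∈ Finset.range len, indic B i := by
    simp only [indic]
    rw [Finset.sum_boole]
  rw [hsum, ← Nat.div_add_mod len (s * n), Finset.sum_range_add]
  have h1 := hblock (len / (s * n))
  have h2 : ∑ i ∈ Finset.range (len % (s * n)), indic B (s * n * (len / (s * n)) + i) ≤
      ((len % (s * n) : ℕ) : ℝ) := by
    calc _ ≤ ∑ i ∈ Finset.range (len % (s * n)), (1 : ℝ) :=
          Finset.sum_le_sum fun i _ => indic_le_one _ _
      _ = _ := by simp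
  have h3 : ((len % (s * n) : ℕ) : ℝ) ≤ s * n := by
    exact_mod_cast (Nat.mod_lt len (Nat.mul_pos hs hn)).le
  have h4 : (0 : ℝ) ≤ δ * ((len % (s * n) : ℕ) : ℝ) := by positivity
  push_cast at h1 h2 h3 h4 ⊢
  linarith

def stepR (ℓ : ℕ) : ℕ := 2 ^ (ℓ + 4)

def stepQ (E ℓ : ℕ) : ℕ := stepR ℓ ^ E

def stepK (E ℓ : ℕ) : ℕ := ℓ + 8 * E

def stepW (E ℓ : ℕ) : ℕ := smoothMod ((8 * stepK E ℓ) ^ (8 * E)) (stepQ E ℓ)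

/-- Bound for the moduli used in one density increment step. -/
def stepZ (E ℓ : ℕ) : ℕ := stepW E ℓ * stepQ E ℓ ^ Nat.log 2 (stepQ E ℓ)

def stepB (E ℓ : ℕ) : ℕ :=
  16 * 2 ^ (2 * stepK E ℓ * ℓ) *
    (stepQ E ℓ + 1) ^ (2 * Nat.log 2 (stepQ E ℓ) * (2 * stepK E ℓ + 1))

def stepM (k E ℓ H : ℕ) : ℕ := 2 * stepR ℓ ^ (3 * E) * H ^ 2 + 1 + 4 * k * 2 ^ ℓ

/-- The factor by which lengths shrink in one density increment step. -/
def stepY (k E ℓ H : ℕ) : ℕ :=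
  stepZ E ℓ ^ k * 128 * 2 ^ ℓ * (128 * 4 ^ ℓ * stepW E ℓ * stepB E ℓ * stepQ E ℓ ^ 2 *
    (64 * (k + 1) * H) * 2 ^ k * (16 * stepM k E ℓ H ^ k))

lemma exists_pow_between {k T : ℕ} (hk : 1 ≤ k) (hT : 2 ≤ T) :
    ∃ M : ℕ, T ≤ M ^ k ∧ M ^ k ≤ 2 ^ k * T := by
  classical
  have hex : ∃ M : ℕ, T ≤ M ^ k := ⟨T, Nat.le_self_pow (by omega) T⟩
  refine ⟨Nat.find hex, Nat.find_spec hex, ?_⟩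
  set M := Nat.find hex with hM
  have h1 : T ≤ M ^ k := Nat.find_spec hex
  have h2 : 2 ≤ M := by
    by_contra h
    have : M ^ k ≤ 1 ^ k := Nat.pow_le_pow_left (by omega) k
    rw [one_pow] at this
    omega
  have h3 : ¬ T ≤ (M - 1) ^ k := Nat.find_min hex (by omega)
  calc M ^ k ≤ (2 * (M - 1)) ^ k := Nat.pow_le_pow_left (by omega) k
    _ = 2 ^ k * (M - 1) ^ k := mul_pow _ _ _
    _ ≤ _ := Nat.mul_le_mul_left _ (by omega)

lemma abs_eval_le {k : ℕ} {F : Polynomial ℤ} (hdeg : F.natDegree ≤ k) {H : ℝ}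
    (hH : ∀ j, |(F.coeff j : ℝ)| ≤ H) {x M : ℕ} (hx : x ≤ M) (hM : 1 ≤ M) :
    |((F.eval (x : ℤ) : ℤ) : ℝ)| ≤ (k + 1) * H * (M : ℝ) ^ k := by
  rw [Polynomial.eval_eq_sum_range' (Nat.lt_succ_of_le hdeg)]
  push_cast
  refine (Finset.abs_sum_le_sum_abs _ _).trans ?_
  have h0 : 0 ≤ H := (abs_nonneg _).trans (hH 0)
  have hM' : (1 : ℝ) ≤ M := by exact_mod_cast hM
  calc _ ≤ ∑ i ∈ Finset.range (k + 1), H * (M : ℝ) ^ k := by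
        refine Finset.sum_le_sum fun j hj => ?_
        rw [abs_mul, abs_pow, Nat.abs_cast]
        have h1 : (x : ℝ) ^ j ≤ (M : ℝ) ^ k :=
          (pow_le_pow_left₀ (Nat.cast_nonneg x) (by exact_mod_cast hx) j).trans
            (pow_le_pow_right₀ hM' (Nat.lt_succ_iff.mp (Finset.mem_range.mp hj)))
        exact mul_le_mul (hH j) h1 (by positivity) h0
    _ = _ := by
        rw [Finset.sum_const, Finset.card_range, nsmul_eq_mul]
        push_cast
        ring

lemma stepQ_eq (E ℓ : ℕ) : stepQ E ℓ = 2 ^ ((ℓ + 4) * E) := by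
  rw [stepQ, stepR, pow_mul]

lemma log_stepQ (E ℓ : ℕ) : Nat.log 2 (stepQ E ℓ) = (ℓ + 4) * E := by
  rw [stepQ_eq, Nat.log_pow (by norm_num)]

lemma progBound_of_forall_exists {A : Finset ℕ} {Z S n ℓ : ℕ} {δ : ℝ} (hδ : 1 ≤ δ * 2 ^ ℓ)
    (hn : 1 ≤ n)
    (h : ∀ q, 1 ≤ q → q ≤ Z → ∃ s, 1 ≤ s ∧ s ≤ S ∧ ∀ b,
      (((Finset.range n).filter fun j => b + q * s * j ∈ A).card : ℝ) ≤ (1 + 1 / 128) * δ * n) :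
    ProgBound A Z (n * (S * 128 * 2 ^ ℓ)) ((1 + 1 / 64) * δ) := by
  intro q hq hqZ a len hlen
  obtain ⟨s, hs1, hsS, hs⟩ := h q hq hqZ
  have hδ0 : 0 < δ := pos_of_mul_pos_left (zero_lt_one.trans_le hδ) (by positivity)
  set B := (Finset.range len).filter fun j => a + q * j ∈ A with hB
  have h1 := card_le_of_forall_block (B := B) hs1 hn (δ := (1 + 1 / 128) * δ) (by positivity)
    (fun c => by
      refine le_trans ?_ (hs (a + q * c))
      refine Nat.cast_le.mpr (Finset.card_le_card fun j hj => ?_)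
      obtain ⟨h2, h3⟩ := Finset.mem_filter.mp hj
      refine Finset.mem_filter.mpr ⟨h2, ?_⟩
      have h4 := (Finset.mem_filter.mp h3).2
      have h5 : a + q * c + q * s * j = a + q * (c + s * j) := by ring
      rwa [h5]) len
  have h2 : ((Finset.range len).filter fun j => j ∈ B) = B := by
    ext j
    rw [Finset.mem_filter]
    exact ⟨fun h => h.2, fun h => ⟨(Finset.mem_filter.mp h).1, h⟩⟩
  rw [h2] at h1
  have h3 : (s : ℝ) * n ≤ S * n := by
    have : (s : ℝ) ≤ S := by exact_mod_cast hsS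
    gcongr
  have h4 : ((n : ℝ) * (S * 128 * 2 ^ ℓ)) ≤ len := by exact_mod_cast hlen
  have h5 : (S : ℝ) * n * 128 ≤ δ * len := by
    calc (S : ℝ) * n * 128 = 1 * (S * n * 128) := by ring
      _ ≤ δ * 2 ^ ℓ * (S * n * 128) := by gcongr
      _ = δ * (n * (S * 128 * 2 ^ ℓ)) := by ring
      _ ≤ _ := by gcongr
  linarith

set_option maxHeartbeats 400000 in
theorem exists_progression_increment {k E ℓ N n H : ℕ} {A : Finset ℕ} {δ : ℝ}
    {F : Polynomial ℤ} (hW : WeylInverse k E) (hE : 1 ≤ E) (hk : 1 ≤ k)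
    (hdeg : F.natDegree ≤ k) (hlead : F.coeff k ≠ 0)
    (hgcd : ∀ d : ℕ, (∀ j, 1 ≤ j → (d : ℤ) ∣ F.coeff j) → d = 1)
    (hH1 : 1 ≤ H) (hH : ∀ j, |(F.coeff j : ℝ)| ≤ H) (hδ : 1 ≤ δ * 2 ^ ℓ)
    (hA : A ⊆ Finset.range N) (hAδ : δ * N = A.card) (hn : 1 ≤ n) (hN : n * stepY k E ℓ H ≤ N)
    (hno : ∀ a ∈ A, ∀ a' ∈ A, ∀ x : ℕ, F.eval (x : ℤ) ≠ 0 → (a : ℤ) - a' ≠ F.eval (x : ℤ)) :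
    ∃ q, 1 ≤ q ∧ q ≤ stepZ E ℓ ∧ ∀ s, 1 ≤ s → s ≤ stepZ E ℓ ^ k → ∃ b,
      (1 + 1 / 128) * δ * n < ((Finset.range n).filter fun j => b + q * s * j ∈ A).card := by
  by_contra! hcon
  have hδ0 : 0 < δ := pos_of_mul_pos_left (zero_lt_one.trans_le hδ) (by positivity)
  have hPB := progBound_of_forall_exists hδ hn hcon
  set Q := stepQ E ℓ with hQ
  set d := Nat.log 2 Q with hd
  set K := stepK E ℓ with hK
  set n₀ := n * (stepZ E ℓ ^ k * 128 * 2 ^ ℓ) with hn₀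
  have hR1 : 1 ≤ stepR ℓ := Nat.one_le_two_pow
  have hQ16 : 16 ≤ Q := by
    calc 16 = 2 ^ 4 := by norm_num
      _ ≤ 2 ^ ((ℓ + 4) * E) := Nat.pow_le_pow_right (by norm_num)
          (le_trans (by omega) (Nat.le_mul_of_pos_right (ℓ + 4) hE))
      _ = Q := (stepQ_eq E ℓ).symm
  have hd1 : 1 ≤ d := Nat.log_pos (by norm_num) (by omega)
  have hWpos : 1 ≤ stepW E ℓ := smoothMod_pos
  have hZpos : 1 ≤ stepZ E ℓ := Nat.mul_pos hWpos (Nat.pow_pos (by omega))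
  have hn₀1 : 1 ≤ n₀ := Nat.mul_pos hn (by positivity)
  set P := (Q + 1) ^ (2 * d * (2 * K + 1)) with hP
  have hPd : Q ^ d ≤ P := (Nat.pow_le_pow_left (Nat.le_succ Q) d).trans
    (Nat.pow_le_pow_right (by omega) (le_trans (by omega) (Nat.le_mul_of_pos_right (2 * d) (by omega))))
  have hP2 : Q ^ 2 ≤ P := (Nat.pow_le_pow_left (Nat.le_succ Q) 2).trans
    (Nat.pow_le_pow_right (by omega) (le_trans (by omega) (Nat.le_mul_of_pos_right (2 * d) (by omega))))
  have hB : stepB E ℓ = 16 * 2 ^ (2 * K * ℓ) * P := rfl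
  have h2pos : 1 ≤ 2 ^ (2 * K * ℓ) := Nat.one_le_two_pow
  have hBP : 16 * P ≤ stepB E ℓ := by
    rw [hB]
    exact Nat.mul_le_mul_right _ (Nat.le_mul_of_pos_right _ h2pos)
  set n₁ := n₀ * stepB E ℓ with hn₁
  have hBn : stepB E ℓ ≤ n₁ := Nat.le_mul_of_pos_left _ hn₀1
  set m := stepW E ℓ * n₁ with hm
  have hm1 : 1 ≤ m := Nat.mul_pos hWpos (by
    have : 0 < P := Nat.pow_pos (by omega)
    omega)
  set M₀ := stepM k E ℓ H with hM₀
  have hM₀1 : 1 ≤ M₀ := by rw [hM₀, stepM]; omega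
  set T := 16 * m * Q * M₀ ^ k with hT
  have hM₀k : 1 ≤ M₀ ^ k := Nat.one_le_pow _ _ hM₀1
  have hT1 : 16 * m * Q ≤ T := Nat.le_mul_of_pos_right _ hM₀k
  have hmQ : 1 ≤ m * Q := Nat.mul_pos hm1 (by omega)
  have h16 : 16 ≤ 16 * m * Q := by rw [mul_assoc]; omega
  have hT2 : M₀ ^ k ≤ T := Nat.le_mul_of_pos_left _ (by omega)
  obtain ⟨M, hTM, hMT⟩ := exists_pow_between hk (T := T) (by omega)
  have hM₀M : M₀ ≤ M := (Nat.pow_le_pow_iff_left (by omega)).mp (hT2.trans hTM)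
  have hNbig : (128 * 4 ^ ℓ * m * Q ^ 2) * ((64 * (k + 1) * H) * 2 ^ k * (16 * M₀ ^ k)) ≤ N := by
    refine le_trans (le_of_eq ?_) hN
    simp only [stepY, hm, hn₁, hn₀, ← hQ, ← hM₀]
    ring
  have hNpos : 0 < N := lt_of_lt_of_le (by positivity) hNbig
  have hN1 : 128 * 4 ^ ℓ * m * Q ^ 2 ≤ N := (Nat.le_mul_of_pos_right _ (by positivity)).trans hNbig
  have hN2 : 64 * ((k + 1) * H * (2 ^ k * T)) * 2 ^ ℓ ≤ N := by
    refine le_trans ?_ hNbig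
    rw [hT]
    have e1 : 2 ^ ℓ ≤ 4 ^ ℓ := Nat.pow_le_pow_left (by norm_num) ℓ
    have e2 : Q ≤ 128 * Q ^ 2 :=
      (Nat.le_self_pow two_ne_zero Q).trans (Nat.le_mul_of_pos_left _ (by norm_num))
    calc 64 * ((k + 1) * H * (2 ^ k * (16 * m * Q * M₀ ^ k))) * 2 ^ ℓ =
        (2 ^ ℓ * m * Q) * ((64 * (k + 1) * H) * 2 ^ k * (16 * M₀ ^ k)) := by ring
      _ ≤ (4 ^ ℓ * m * (128 * Q ^ 2)) * ((64 * (k + 1) * H) * 2 ^ k * (16 * M₀ ^ k)) := by gcongr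
      _ = _ := by ring
  have hδN2 : ∀ X : ℕ, X * 2 ^ ℓ ≤ N → (X : ℝ) ≤ δ * N := by
    intro X hX
    have h1 : (X : ℝ) * 2 ^ ℓ ≤ N := by exact_mod_cast hX
    calc (X : ℝ) = X * 1 := (mul_one _).symm
      _ ≤ X * (δ * 2 ^ ℓ) := by gcongr
      _ = δ * (X * 2 ^ ℓ) := by ring
      _ ≤ _ := by gcongr
  have hM1 : 1 ≤ M := hM₀1.trans hM₀M
  have hRδ : (16 : ℝ) ≤ δ * stepR ℓ := by
    rw [stepR]
    push_cast
    rw [pow_add]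
    linarith
  obtain ⟨a, ha, a', ha', x, hx, hax⟩ := exists_difference_of_progBound (k := k) (E := E)
    (k' := K) (w := (8 * K) ^ (8 * E)) (n := n₁) (n₀ := n₀) (N := N) (R := stepR ℓ) (M := M)
    (A := A.map (addLeftEmbedding m)) (δ := δ) (H := H) (F := F) hW hE hk hdeg hlead hgcd
    (by exact_mod_cast hH1) hH (by rw [hK, stepK]; omega) le_rfl hδ0
    (by
      rw [stepR]
      calc 2 = 2 ^ 1 := by norm_num
        _ ≤ _ := Nat.pow_le_pow_right (by norm_num) (by omega))
    hRδ
    (Nat.mul_le_mul_left _ (hPd.trans (by omega)))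
    (by
      have : 4 * Q ^ d ≤ 16 * P := by omega
      exact this.trans (hBP.trans hBn))
    (by
      have : 16 * Q ^ 2 ≤ 16 * P := by omega
      exact this.trans (hBP.trans hBn))
    (hPB.map_add m)
    (by
      have e1 : (2 : ℝ) ^ ℓ * 2 ≤ 4 ^ (2 * K) := by
        have : (2 : ℝ) ^ (ℓ + 1) ≤ 2 ^ (2 * (2 * K)) :=
          pow_le_pow_right₀ (by norm_num) (by rw [hK, stepK]; omega)
        rw [pow_mul, pow_succ] at this
        norm_num at this ⊢
        exact this
      calc (3 : ℝ) ≤ 4 * 1 := by norm_num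
        _ ≤ 4 * (δ * 2 ^ ℓ) := by gcongr
        _ = 2 * δ * (2 ^ ℓ * 2) := by ring
        _ ≤ _ := by gcongr)
    (by
      have e1 : (1 : ℝ) ≤ (2 * δ) ^ (2 * K) * 2 ^ (2 * K * ℓ) := by
        rw [mul_comm (2 * K) ℓ, pow_mul 2 ℓ (2 * K), ← mul_pow]
        exact one_le_pow₀ (by linarith)
      have e2 : (2 : ℝ) ^ (2 * K * ℓ) * P ≤ n₁ := by
        have : 2 ^ (2 * K * ℓ) * P ≤ n₁ := by
          refine le_trans ?_ hBn
          rw [hB, mul_assoc 16]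
          exact Nat.le_mul_of_pos_left _ (by norm_num)
        exact_mod_cast this
      calc (((Q : ℝ) + 1) ^ (2 * d)) ^ (2 * K + 1) = (P : ℝ) := by
            rw [hP, ← pow_mul]
            push_cast
            rfl
        _ ≤ ((2 * δ) ^ (2 * K) * 2 ^ (2 * K * ℓ)) * P := le_mul_of_one_le_left (by positivity) e1
        _ = (2 * δ) ^ (2 * K) * (2 ^ (2 * K * ℓ) * P) := by ring
        _ ≤ _ := by gcongr)
    (by
      intro y hy
      obtain ⟨x, hx, rfl⟩ := Finset.mem_map.mp hy
      have h1 := Finset.mem_range.mp (hA hx)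
      rw [Finset.mem_Ico]
      show m ≤ m + x ∧ m + x < m + N
      omega)
    (by rw [Finset.card_map, hAδ])
    (by
      have e1 : (128 * 4 ^ ℓ * m * Q ^ 2 : ℝ) ≤ N := by exact_mod_cast hN1
      have e2 : (1 : ℝ) ≤ δ ^ 2 * 4 ^ ℓ := by
        have : (1 : ℝ) ≤ (δ * 2 ^ ℓ) ^ 2 := one_le_pow₀ hδ
        rw [mul_pow, ← pow_mul, mul_comm ℓ 2, pow_mul] at this
        norm_num at this
        exact this
      calc (128 : ℝ) * m * (Q : ℝ) ^ 2 ≤ (δ ^ 2 * 4 ^ ℓ) * (128 * m * (Q : ℝ) ^ 2) :=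
            le_mul_of_one_le_left (by positivity) e2
        _ = δ ^ 2 * (128 * 4 ^ ℓ * m * Q ^ 2) := by ring
        _ ≤ _ := by gcongr)
    (by
      have e1 : 2 * stepR ℓ ^ (3 * E) * H ^ 2 < M := by
        refine lt_of_lt_of_le ?_ hM₀M
        rw [hM₀, stepM]
        omega
      exact_mod_cast e1)
    (by
      have e1 : 16 * (m * stepR ℓ ^ E) ≤ M ^ k := by
        refine le_trans (le_of_eq ?_) (hT1.trans hTM)
        rw [hQ, stepQ]
        ring
      exact_mod_cast e1)
    (fun x hx => by
      have e1 := abs_eval_le hdeg hH hx.le hM1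
      have e2 : (M : ℝ) ^ k ≤ 2 ^ k * T := by exact_mod_cast hMT
      have e3 := hδN2 _ hN2
      push_cast at e3
      refine le_trans ?_ e3
      refine mul_le_mul_of_nonneg_left (e1.trans ?_) (by norm_num)
      gcongr)
    (by
      have e1 : 4 * k * 2 ^ ℓ ≤ M := by
        refine le_trans ?_ hM₀M
        rw [hM₀, stepM]
        omega
      have e2 : (4 * k * 2 ^ ℓ : ℝ) ≤ M := by exact_mod_cast e1
      calc (4 * k : ℝ) ≤ δ * 2 ^ ℓ * (4 * k) := le_mul_of_one_le_left (by positivity) hδ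
        _ = δ * (4 * k * 2 ^ ℓ) := by ring
        _ ≤ _ := by gcongr)
  obtain ⟨y, hy, rfl⟩ := Finset.mem_map.mp ha
  obtain ⟨y', hy', rfl⟩ := Finset.mem_map.mp ha'
  refine hno y hy y' hy' x hx ?_
  rw [← hax]
  show (y : ℤ) - y' = ((m + y : ℕ) : ℤ) - ((m + y' : ℕ) : ℤ)
  push_cast
  ring

open Polynomial in
/-- The gcd of the nonconstant coefficients of `G(dX)`. -/
noncomputable def dilateGcd (G : Polynomial ℤ) (d : ℕ) : ℕ :=
  (G.comp (C (d : ℤ) * X)).divX.content.natAbs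

section Gcd

open Polynomial

lemma dvd_dilateGcd {G : ℤ[X]} {d e : ℕ} :
    e ∣ dilateGcd G d ↔ ∀ j, 1 ≤ j → (e : ℤ) ∣ G.coeff j * (d : ℤ) ^ j := by
  rw [dilateGcd, ← Int.natCast_dvd, dvd_content_iff_C_dvd, C_dvd_iff_dvd_coeff]
  simp only [coeff_divX, comp_C_mul_X_coeff]
  constructor
  · intro h j hj
    obtain ⟨i, rfl⟩ := Nat.exists_eq_add_of_le' hj
    exact h i
  · exact fun h i => h (i + 1) (Nat.le_add_left 1 i)

lemma dilateGcd_dvd (G : ℤ[X]) (d : ℕ) {j : ℕ} (hj : 1 ≤ j) :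
    (dilateGcd G d : ℤ) ∣ G.coeff j * (d : ℤ) ^ j :=
  dvd_dilateGcd.mp dvd_rfl j hj

lemma dilateGcd_mul_dvd (G : ℤ[X]) (d m : ℕ) : dilateGcd G d * m ∣ dilateGcd G (d * m) := by
  refine dvd_dilateGcd.mpr fun j hj => ?_
  push_cast
  rw [mul_pow, ← mul_assoc]
  exact mul_dvd_mul (dilateGcd_dvd G d hj) (dvd_pow_self _ (by omega))

lemma dilateGcd_dvd_mul_pow {G : ℤ[X]} {k : ℕ} (hG : G.natDegree ≤ k) (d m : ℕ) :
    dilateGcd G (d * m) ∣ dilateGcd G d * m ^ k := by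
  have h : (dilateGcd G (d * m) : ℤ) ∣
      (C ((m : ℤ) ^ k) * (G.comp (C (d : ℤ) * X)).divX).content := by
    rw [dvd_content_iff_C_dvd, C_dvd_iff_dvd_coeff]
    intro i
    rw [coeff_C_mul, coeff_divX, comp_C_mul_X_coeff]
    by_cases hi : i + 1 ≤ k
    · have h1 := dilateGcd_dvd G (d * m) (Nat.le_add_left 1 i)
      push_cast at h1
      rw [mul_pow, ← mul_assoc] at h1
      exact (h1.trans (mul_dvd_mul_left _ (pow_dvd_pow _ hi))).trans (dvd_of_eq (mul_comm _ _))
    · rw [coeff_eq_zero_of_natDegree_lt (by omega), zero_mul, mul_zero]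
      exact dvd_zero _
  rw [content_C_mul, Int.normalize_of_nonneg (by positivity), Int.natCast_dvd, Int.natAbs_mul,
    Int.natAbs_pow, Int.natAbs_natCast] at h
  exact h.trans (dvd_of_eq (mul_comm _ _))

lemma dilateGcd_pos {G : ℤ[X]} {k d : ℕ} (hk : 1 ≤ k) (hG : G.coeff k ≠ 0) (hd : 1 ≤ d) :
    0 < dilateGcd G d := by
  refine Nat.pos_of_ne_zero fun h => ?_
  have h1 := dilateGcd_dvd G d hk
  rw [h, Nat.cast_zero, zero_dvd_iff] at h1
  exact mul_ne_zero hG (pow_ne_zero _ (by omega)) h1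

lemma dilateGcd_le {G : ℤ[X]} {k d : ℕ} (hk : 1 ≤ k) (hG : G.coeff k ≠ 0) (hd : 1 ≤ d) :
    dilateGcd G d ≤ (G.coeff k).natAbs * d ^ k := by
  have h1 := Int.natAbs_dvd_natAbs.mpr (dilateGcd_dvd G d hk)
  rw [Int.natAbs_natCast, Int.natAbs_mul, Int.natAbs_pow, Int.natAbs_natCast] at h1
  exact Nat.le_of_dvd (Nat.mul_pos (Int.natAbs_pos.mpr hG) (Nat.pow_pos (by omega))) h1

lemma dvd_coeff_comp_add {P : ℤ[X]} {e : ℤ} (h : ∀ j, 1 ≤ j → e ∣ P.coeff j) (t : ℤ) {j : ℕ}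
    (hj : 1 ≤ j) : e ∣ (P.comp (X + C t)).coeff j := by
  have h1 : C e ∣ P.divX := by
    rw [C_dvd_iff_dvd_coeff]
    intro i
    rw [coeff_divX]
    exact h _ (Nat.le_add_left 1 i)
  obtain ⟨S, hS⟩ := h1
  have h2 : P.comp (X + C t) = C e * (S * X).comp (X + C t) + C (P.coeff 0) := by
    conv_lhs => rw [← divX_mul_X_add P, hS]
    rw [add_comp, C_comp, mul_assoc, mul_comp, C_comp]
  rw [h2, coeff_add, coeff_C_mul, coeff_C, if_neg (by omega), add_zero]
  exact dvd_mul_right _ _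

lemma dvd_eval_of_dvd_coeff {P : ℤ[X]} {e : ℤ} (h : ∀ j, 1 ≤ j → e ∣ P.coeff j)
    (h0 : e ∣ P.coeff 0) (t : ℤ) : e ∣ P.eval t := by
  rw [eval_eq_sum_range]
  refine Finset.dvd_sum fun j _ => Dvd.dvd.mul_right ?_ _
  rcases Nat.eq_zero_or_pos j with rfl | hj
  · exact h0
  · exact h j hj

lemma exists_coeff_bound (g : ℤ[X]) : ∃ H : ℕ, 1 ≤ H ∧ ∀ j, |g.coeff j| ≤ H := by
  refine ⟨1 + ∑ i ∈ g.support, (g.coeff i).natAbs, by omega, fun j => ?_⟩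
  by_cases hj : j ∈ g.support
  · have h1 := Finset.single_le_sum (f := fun i => (g.coeff i).natAbs)
      (fun i _ => Nat.zero_le _) hj
    have h2 : (g.coeff j).natAbs ≤ ∑ i ∈ g.support, (g.coeff i).natAbs := h1
    rw [Int.abs_eq_natAbs]
    exact_mod_cast h2.trans (Nat.le_add_left _ _)
  · rw [notMem_support_iff.mp hj, abs_zero]
    exact Int.natCast_nonneg _

lemma abs_coeff_comp_add_le {g : ℤ[X]} {k H : ℕ} (hg : g.natDegree ≤ k)
    (hH : ∀ j, |g.coeff j| ≤ H) {r d : ℕ} (hd : 1 ≤ d) (hr : r ≤ d) (j : ℕ) :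
    |(g.comp (X + C (r : ℤ))).coeff j| ≤ ((k + 1) * H * (2 * d) ^ k : ℕ) := by
  have h1 : (g.comp (X + C (r : ℤ))).coeff j =
      ∑ i ∈ Finset.range (k + 1), g.coeff i * ((r : ℤ) ^ (i - j) * (i.choose j : ℤ)) := by
    rw [comp, eval₂_eq_sum_range' C (Nat.lt_succ_of_le hg), finsetSum_coeff]
    refine Finset.sum_congr rfl fun i _ => ?_
    rw [coeff_C_mul, coeff_X_add_C_pow]
  rw [h1]
  refine (Finset.abs_sum_le_sum_abs _ _).trans ?_
  calc _ ≤ ∑ i ∈ Finset.range (k + 1), (H : ℤ) * ((2 * d) ^ k : ℕ) := by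
        refine Finset.sum_le_sum fun i hi => ?_
        rw [Finset.mem_range] at hi
        have h2 : r ^ (i - j) * i.choose j ≤ (2 * d) ^ k := by
          calc r ^ (i - j) * i.choose j ≤ d ^ k * 2 ^ k := by
                refine Nat.mul_le_mul ((Nat.pow_le_pow_left hr _).trans
                  (Nat.pow_le_pow_right hd (by omega))) ?_
                exact (Nat.choose_le_two_pow i j).trans
                  (Nat.pow_le_pow_right (by norm_num) (by omega))
            _ = _ := by rw [mul_pow, mul_comm]
        rw [abs_mul]
        refine mul_le_mul (hH i) ?_ (abs_nonneg _) (Int.natCast_nonneg _)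
        rw [abs_of_nonneg (by positivity)]
        exact_mod_cast h2
    _ = _ := by
        rw [Finset.sum_const, Finset.card_range, nsmul_eq_mul]
        push_cast
        ring

end Gcd

section StagePoly

open Polynomial

lemma exists_residue_rep (r : ℕ) {d : ℕ} (hd : 1 ≤ d) :
    ∃ s : ℕ, 1 ≤ s ∧ s ≤ d ∧ ∃ t : ℤ, (r : ℤ) = s + d * t := by
  have h1 : (0 : ℤ) < d := by exact_mod_cast hd
  have h2 := Int.emod_nonneg ((r : ℤ) - 1) h1.ne'
  have h3 := Int.emod_lt_of_pos ((r : ℤ) - 1) h1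
  have h4 := Int.emod_add_mul_ediv ((r : ℤ) - 1) d
  refine ⟨(((r : ℤ) - 1) % d).toNat + 1, by omega, by omega, ((r : ℤ) - 1) / d, ?_⟩
  push_cast
  rw [Int.toNat_of_nonneg h2]
  linarith

lemma exists_stage_poly {k l : ℕ} (hk : 1 ≤ k) {g h : ℤ[X]} (hg : g.natDegree = k)
    (hl : h.natDegree = l) (hh : Intersective h) :
    ∃ C₀ : ℕ, 1 ≤ C₀ ∧ ∀ r d : ℕ, 1 ≤ d →
      (dilateGcd (g.comp (X + C (r : ℤ))) d : ℤ) ∣ g.eval (r : ℤ) →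
      ∃ F : ℤ[X], F.natDegree ≤ k ∧ F.coeff k ≠ 0 ∧
        (∀ e : ℕ, (∀ j, 1 ≤ j → (e : ℤ) ∣ F.coeff j) → e = 1) ∧
        (∀ j, |F.coeff j| ≤ (C₀ * d ^ (2 * k + k * l) : ℕ)) ∧
        ∀ x : ℕ, ∃ u v : ℕ, 1 ≤ u ∧ 1 ≤ v ∧
          (dilateGcd (g.comp (X + C (r : ℤ))) d : ℤ) * F.eval (x : ℤ) =
            g.eval (u : ℤ) + h.eval (v : ℤ) := by
  obtain ⟨Hg, hHg1, hHg⟩ := exists_coeff_bound g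
  obtain ⟨Hh, hHh1, hHh⟩ := exists_coeff_bound h
  have hlead : g.coeff k ≠ 0 := by
    rw [← hg]
    refine leadingCoeff_ne_zero.mpr ?_
    rintro rfl
    rw [natDegree_zero] at hg
    omega
  set L := (g.coeff k).natAbs with hL
  have hLpos : 1 ≤ L := Int.natAbs_pos.mpr hlead
  refine ⟨(k + 1) * Hg * 2 ^ k + (l + 1) * Hh * L ^ l, ?_, fun r d hd hdvd => ?_⟩
  · exact Nat.add_pos_left (by positivity) _
  set G := g.comp (X + C (r : ℤ)) with hGdef
  set D := dilateGcd G d with hDdef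
  have hGk : G.coeff k = g.coeff k := by
    have h1 : G.natDegree = k := by
      rw [hGdef, natDegree_comp, natDegree_X_add_C, mul_one, hg]
    have h2 := leadingCoeff_comp (p := g) (q := X + C (r : ℤ)) (by
      rw [natDegree_X_add_C]; exact one_ne_zero)
    rw [leadingCoeff_X_add_C, one_pow, mul_one, ← hGdef, leadingCoeff, leadingCoeff, h1, hg] at h2
    exact h2
  have hD1 : 1 ≤ D := dilateGcd_pos hk (by rw [hGk]; exact hlead) hd
  have hDle : D ≤ L * d ^ k := by
    have h1 := dilateGcd_le hk (by rw [hGk]; exact hlead) hd (G := G)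
    rwa [hGk] at h1
  obtain ⟨r₀, hr₀1, hr₀d, t, ht⟩ := exists_residue_rep r hd
  obtain ⟨n, -, hn⟩ := hh.2 D hD1
  obtain ⟨s, hs1, hsD, t', ht'⟩ := exists_residue_rep n hD1
  have hhs : (D : ℤ) ∣ h.eval (s : ℤ) := by
    have h1 := sub_dvd_eval_sub (n : ℤ) (s : ℤ) h
    rw [ht', add_sub_cancel_left, ← ht'] at h1
    have h2 := (dvd_mul_right (D : ℤ) t').trans h1
    exact (dvd_sub_right hn).mp h2
  set P := G.comp (C (d : ℤ) * X) with hPdef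
  set R := (g.comp (X + C (r₀ : ℤ))).comp (C (d : ℤ) * X) with hRdef
  have hPR : P = R.comp (X + C t) := by
    rw [hPdef, hRdef, hGdef, comp_assoc, comp_assoc, comp_assoc]
    congr 1
    simp only [add_comp, mul_comp, C_comp, X_comp]
    rw [ht]
    simp only [C_add, C_mul]
    ring
  have hRP : R = P.comp (X + C (-t)) := by
    rw [hPR, comp_assoc]
    simp [add_comp]
  have hPj : ∀ j, 1 ≤ j → (D : ℤ) ∣ P.coeff j := by
    intro j hj
    rw [hPdef, comp_C_mul_X_coeff]
    exact dilateGcd_dvd G d hj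
  have hRj : ∀ j, 1 ≤ j → (D : ℤ) ∣ R.coeff j := by
    intro j hj
    rw [hRP]
    exact dvd_coeff_comp_add hPj _ hj
  have hP0 : (D : ℤ) ∣ P.coeff 0 := by
    have : P.coeff 0 = g.eval (r : ℤ) := by
      rw [coeff_zero_eq_eval_zero, hPdef, hGdef]
      simp [eval_comp]
    rw [this]
    exact hdvd
  have hR0 : (D : ℤ) ∣ R.coeff 0 := by
    rw [coeff_zero_eq_eval_zero, hRP, eval_comp]
    exact dvd_eval_of_dvd_coeff hPj hP0 _
  have hdiv : C (D : ℤ) ∣ R + C (h.eval (s : ℤ)) := by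
    rw [C_dvd_iff_dvd_coeff]
    intro j
    rw [coeff_add]
    rcases Nat.eq_zero_or_pos j with rfl | hj
    · rw [coeff_C_zero]
      exact dvd_add hR0 hhs
    · rw [coeff_C, if_neg (by omega), add_zero]
      exact hRj j hj
  obtain ⟨F, hF⟩ := hdiv
  have hDz : (D : ℤ) ≠ 0 := by exact_mod_cast (by omega : D ≠ 0)
  have hFj : ∀ j, 1 ≤ j → (D : ℤ) * F.coeff j = R.coeff j := by
    intro j hj
    have h1 := congrArg (fun p : ℤ[X] => p.coeff j) hF
    simp only [coeff_add, coeff_C_mul] at h1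
    rw [coeff_C, if_neg (by omega), add_zero] at h1
    exact h1.symm
  have hFcoeff : ∀ j, (D : ℤ) * F.coeff j = R.coeff j + (C (h.eval (s : ℤ))).coeff j := by
    intro j
    have h1 := congrArg (fun p : ℤ[X] => p.coeff j) hF
    simp only [coeff_add, coeff_C_mul] at h1
    exact h1.symm
  have hRcoeff : ∀ j, R.coeff j = (g.comp (X + C (r₀ : ℤ))).coeff j * (d : ℤ) ^ j := fun j => by
    rw [hRdef, comp_C_mul_X_coeff]
  have hgr₀deg : (g.comp (X + C (r₀ : ℤ))).natDegree = k := by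
    rw [natDegree_comp, natDegree_X_add_C, mul_one, hg]
  have hgr₀k : (g.comp (X + C (r₀ : ℤ))).coeff k = g.coeff k := by
    have h2 := leadingCoeff_comp (p := g) (q := X + C (r₀ : ℤ)) (by
      rw [natDegree_X_add_C]; exact one_ne_zero)
    rw [leadingCoeff_X_add_C, one_pow, mul_one, leadingCoeff, leadingCoeff, hgr₀deg, hg] at h2
    exact h2
  have hRzero : ∀ j, k < j → R.coeff j = 0 := fun j hj => by
    rw [hRcoeff, coeff_eq_zero_of_natDegree_lt (by omega), zero_mul]
  refine ⟨F, ?_, ?_, ?_, ?_, ?_⟩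
  · rw [natDegree_le_iff_coeff_eq_zero]
    intro j hj
    have h1 := hFj j (by omega)
    rw [hRzero j (by omega)] at h1
    exact (mul_eq_zero.mp h1).resolve_left hDz
  · intro h0
    have h1 := hFj k hk
    rw [h0, mul_zero, hRcoeff, hgr₀k] at h1
    exact mul_ne_zero hlead (pow_ne_zero _ (by omega)) h1.symm
  · intro e he
    have h1 : ∀ j, 1 ≤ j → ((D * e : ℕ) : ℤ) ∣ R.coeff j := by
      intro j hj
      rw [← hFj j hj]
      push_cast
      exact mul_dvd_mul_left _ (he j hj)
    have h2 : D * e ∣ D := by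
      rw [hDdef]
      refine dvd_dilateGcd.mpr fun j hj => ?_
      rw [← comp_C_mul_X_coeff, ← hPdef, hPR]
      exact dvd_coeff_comp_add h1 t hj
    exact Nat.dvd_one.mp (Nat.dvd_of_mul_dvd_mul_left hD1 (by rwa [mul_one]))
  · intro j
    have h1 : |R.coeff j| ≤ ((k + 1) * Hg * 2 ^ k * d ^ (2 * k) : ℕ) := by
      by_cases hj : j ≤ k
      · rw [hRcoeff, abs_mul, abs_of_nonneg (by positivity : (0 : ℤ) ≤ (d : ℤ) ^ j)]
        have h2 := abs_coeff_comp_add_le hg.le hHg hd hr₀d j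
        have h3 : (d : ℤ) ^ j ≤ (d ^ k : ℕ) := by
          exact_mod_cast Nat.pow_le_pow_right hd hj
        refine (mul_le_mul h2 h3 (by positivity) (Int.natCast_nonneg _)).trans (le_of_eq ?_)
        push_cast
        ring
      · rw [hRzero j (by omega), abs_zero]
        exact Int.natCast_nonneg _
    have h2 : |(C (h.eval (s : ℤ))).coeff j| ≤ ((l + 1) * Hh * (L ^ l * d ^ (k * l)) : ℕ) := by
      rw [coeff_C]
      split_ifs
      · have h3 := abs_eval_le (F := h) (k := l) (H := Hh) hl.le
          (fun j => by exact_mod_cast hHh j) (hsD.trans hDle) (hD1.trans hDle)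
        have h4 : ((l : ℝ) + 1) * Hh * ((L * d ^ k : ℕ) : ℝ) ^ l =
            (((l + 1) * Hh * (L ^ l * d ^ (k * l)) : ℕ) : ℝ) := by
          push_cast
          ring
        rw [h4] at h3
        exact_mod_cast h3
      · rw [abs_zero]
        exact Int.natCast_nonneg _
    have h3 : |F.coeff j| ≤ |(D : ℤ) * F.coeff j| := by
      rw [abs_mul]
      refine le_mul_of_one_le_left (abs_nonneg _) ?_
      rw [Nat.abs_cast]
      exact_mod_cast hD1
    rw [hFcoeff] at h3
    refine (h3.trans (abs_add_le _ _)).trans ((add_le_add h1 h2).trans ?_)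
    have h5 : (k + 1) * Hg * 2 ^ k * d ^ (2 * k) + (l + 1) * Hh * (L ^ l * d ^ (k * l)) ≤
        ((k + 1) * Hg * 2 ^ k + (l + 1) * Hh * L ^ l) * d ^ (2 * k + k * l) := by
      rw [add_mul _ _ (d ^ (2 * k + k * l)), ← mul_assoc ((l + 1) * Hh)]
      exact Nat.add_le_add (Nat.mul_le_mul_left _ (Nat.pow_le_pow_right hd (by omega)))
        (Nat.mul_le_mul_left _ (Nat.pow_le_pow_right hd (by omega)))
    exact_mod_cast h5
  · intro x
    refine ⟨r₀ + d * x, s, by omega, hs1, ?_⟩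
    have h1 := congrArg (fun p : ℤ[X] => p.eval (x : ℤ)) hF
    simp only [eval_add, eval_mul, eval_C] at h1
    rw [← h1, hRdef]
    simp only [eval_comp, eval_add, eval_mul, eval_C, eval_X]
    push_cast
    rw [add_comm (r₀ : ℤ)]

end StagePoly

section Iteration

open Polynomial

lemma stepZ_pos (E ℓ : ℕ) : 0 < stepZ E ℓ :=
  Nat.mul_pos smoothMod_pos (Nat.pow_pos (Nat.pow_pos (Nat.pow_pos (by norm_num))))

lemma stepY_pos (k E ℓ H : ℕ) (hH : 1 ≤ H) : 0 < stepY k E ℓ H := by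
  have h1 := stepZ_pos E ℓ
  have h2 : 0 < stepW E ℓ := smoothMod_pos
  have h3 : 0 < stepB E ℓ := by unfold stepB; positivity
  have h4 : 0 < stepQ E ℓ := Nat.pow_pos (Nat.pow_pos (by norm_num))
  have h5 : 0 < stepM k E ℓ H := by unfold stepM; positivity
  unfold stepY
  positivity

lemma exists_dense_progression {k l E : ℕ} (hW : WeylInverse k E) (hE : 1 ≤ E) (hk : 1 ≤ k)
    {g h : ℤ[X]} {C₀ r ℓ T : ℕ} (hC₀ : 1 ≤ C₀)
    (hGdeg : (g.comp (X + C (r : ℤ))).natDegree ≤ k)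
    (hlead : (g.comp (X + C (r : ℤ))).coeff k ≠ 0)
    (hstage : ∀ d : ℕ, 1 ≤ d → d ≤ stepZ E ℓ ^ T →
      ∃ F : ℤ[X], F.natDegree ≤ k ∧ F.coeff k ≠ 0 ∧
        (∀ e : ℕ, (∀ j, 1 ≤ j → (e : ℤ) ∣ F.coeff j) → e = 1) ∧
        (∀ j, |F.coeff j| ≤ (C₀ * d ^ (2 * k + k * l) : ℕ)) ∧
        ∀ x : ℕ, ∃ u v : ℕ, 1 ≤ u ∧ 1 ≤ v ∧
          (dilateGcd (g.comp (X + C (r : ℤ))) d : ℤ) * F.eval (x : ℤ) =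
            g.eval (u : ℤ) + h.eval (v : ℤ))
    {Y : ℕ} (hY : Y = stepY k E ℓ (C₀ * (stepZ E ℓ ^ T) ^ (2 * k + k * l))) {A : Finset ℕ}
    (hA : ∀ a ∈ A, ∀ a' ∈ A, a ≠ a' → ∀ m n : ℕ, 1 ≤ m → 1 ≤ n →
      (a : ℤ) - a' ≠ g.eval (m : ℤ) + h.eval (n : ℤ))
    {c : ℕ} (hc : (2 ^ ℓ : ℝ)⁻¹ * ((Y ^ T : ℕ) : ℝ) < ((Finset.range (Y ^ T)).filter fun i =>
      c + dilateGcd (g.comp (X + C (r : ℤ))) 1 * i ∈ A).card) {j : ℕ} (hj : j ≤ T) :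
    ∃ d b : ℕ, 1 ≤ d ∧ d ≤ stepZ E ℓ ^ j ∧
      (1 + 1 / 128) ^ j * (2 ^ ℓ : ℝ)⁻¹ * ((Y ^ (T - j) : ℕ) : ℝ) <
        ((Finset.range (Y ^ (T - j))).filter fun i =>
          b + dilateGcd (g.comp (X + C (r : ℤ))) d * i ∈ A).card := by
  set G := g.comp (X + C (r : ℤ)) with hG
  set Z := stepZ E ℓ with hZ
  have hZ1 : 1 ≤ Z := stepZ_pos E ℓ
  set H := C₀ * (Z ^ T) ^ (2 * k + k * l) with hH
  have hH1 : 1 ≤ H := Nat.mul_pos hC₀ (Nat.pow_pos (Nat.pow_pos hZ1))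
  have hY1 : 1 ≤ Y := by rw [hY]; exact stepY_pos _ _ _ _ hH1
  induction j with
  | zero =>
    refine ⟨1, c, le_rfl, by rw [pow_zero], ?_⟩
    rw [pow_zero, one_mul]
    exact hc
  | succ j ih =>
    obtain ⟨d, b, hd1, hdle, hdb⟩ := ih (by omega)
    obtain ⟨F, hFdeg, hFk, hFgcd, hFco, hFval⟩ :=
      hstage d hd1 (hdle.trans (Nat.pow_le_pow_right hZ1 (by omega)))
    set D := dilateGcd G d with hD
    have hD1 : 1 ≤ D := dilateGcd_pos hk hlead hd1
    set N := Y ^ (T - j) with hN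
    set n := Y ^ (T - (j + 1)) with hn
    have hn1 : 1 ≤ n := Nat.pow_pos hY1
    have hN1 : 1 ≤ N := Nat.pow_pos hY1
    have hNn : N = n * Y := by
      rw [hN, hn, ← pow_succ]
      congr 1
      omega
    have hNR : (0 : ℝ) < N := by exact_mod_cast hN1
    have hnR : (0 : ℝ) < n := by exact_mod_cast hn1
    set B := (Finset.range N).filter fun i => b + D * i ∈ A with hB
    set δ : ℝ := (B.card : ℝ) / N with hδ
    have hδlt : (1 + 1 / 128) ^ j * (2 ^ ℓ : ℝ)⁻¹ < δ := by
      rw [hδ, lt_div_iff₀ hNR]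
      exact hdb
    have hδ1 : 1 ≤ δ * 2 ^ ℓ := by
      have h1 : (1 : ℝ) ≤ (1 + 1 / 128) ^ j := one_le_pow₀ (by norm_num)
      have h2 : (2 ^ ℓ : ℝ)⁻¹ ≤ δ :=
        (le_mul_of_one_le_left (by positivity) h1).trans hδlt.le
      calc (1 : ℝ) = (2 ^ ℓ : ℝ)⁻¹ * 2 ^ ℓ := (inv_mul_cancel₀ (by positivity)).symm
        _ ≤ _ := mul_le_mul_of_nonneg_right h2 (by positivity)
    have hFH : ∀ i, |((F.coeff i : ℤ) : ℝ)| ≤ (H : ℝ) := by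
      intro i
      have h1 : C₀ * d ^ (2 * k + k * l) ≤ H := Nat.mul_le_mul_left _
        (Nat.pow_le_pow_left (hdle.trans (Nat.pow_le_pow_right hZ1 (by omega))) _)
      have h2 : |F.coeff i| ≤ (H : ℤ) := (hFco i).trans (by exact_mod_cast h1)
      exact_mod_cast h2
    obtain ⟨q, hq1, hqZ, hq⟩ := exists_progression_increment hW hE hk hFdeg hFk hFgcd hH1 hFH hδ1
      (Finset.filter_subset _ _ : B ⊆ Finset.range N) (div_mul_cancel₀ _ hNR.ne') hn1
      (by rw [hNn, hY]) (by
        intro a ha a' ha' x hx heq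
        obtain ⟨u, v, hu, hv, huv⟩ := hFval x
        have h1 := (Finset.mem_filter.mp ha).2
        have h2 := (Finset.mem_filter.mp ha').2
        have hDz : (D : ℤ) ≠ 0 := by exact_mod_cast (by omega : D ≠ 0)
        have h3 : ((b + D * a : ℕ) : ℤ) - ((b + D * a' : ℕ) : ℤ) = D * F.eval (x : ℤ) := by
          rw [← heq]
          push_cast
          ring
        refine hA _ h1 _ h2 ?_ u v hu hv (h3.trans huv)
        intro h4
        rw [h4, sub_self] at h3
        exact mul_ne_zero hDz hx h3.symm)
    obtain ⟨s, hs⟩ := dilateGcd_mul_dvd G d q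
    have hDq1 : 1 ≤ dilateGcd G (d * q) := dilateGcd_pos hk hlead (Nat.mul_pos hd1 hq1)
    have hs1 : 1 ≤ s := by
      rcases Nat.eq_zero_or_pos s with h0 | h0
      · rw [h0, mul_zero] at hs
        omega
      · exact h0
    have hsk : s ≤ Z ^ k := by
      have h1 := dilateGcd_dvd_mul_pow hGdeg d q
      rw [hs, mul_assoc] at h1
      have h2 := Nat.le_of_dvd (Nat.pow_pos hq1) (Nat.dvd_of_mul_dvd_mul_left hD1 h1)
      calc s ≤ q * s := Nat.le_mul_of_pos_left _ hq1
        _ ≤ q ^ k := h2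
        _ ≤ Z ^ k := Nat.pow_le_pow_left hqZ _
    obtain ⟨b', hb'⟩ := hq s hs1 hsk
    refine ⟨d * q, b + D * b', Nat.mul_pos hd1 hq1, ?_, ?_⟩
    · rw [pow_succ]
      exact Nat.mul_le_mul hdle hqZ
    · calc (1 + 1 / 128) ^ (j + 1) * (2 ^ ℓ : ℝ)⁻¹ * (n : ℝ)
          = (1 + 1 / 128) * ((1 + 1 / 128) ^ j * (2 ^ ℓ : ℝ)⁻¹) * n := by ring
        _ ≤ (1 + 1 / 128) * δ * n := by gcongr
        _ < _ := hb'
        _ ≤ _ := by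
          refine Nat.cast_le.mpr (Finset.card_le_card fun i hi => ?_)
          rw [Finset.mem_filter] at hi ⊢
          refine ⟨hi.1, ?_⟩
          have h1 := (Finset.mem_filter.mp hi.2).2
          rw [hs]
          convert h1 using 1
          ring

lemma card_le_of_no_differences {k l E : ℕ} (hW : WeylInverse k E) (hE : 1 ≤ E) (hk : 1 ≤ k)
    {g h : ℤ[X]} (hg : g.natDegree = k) (hl : h.natDegree = l) (hgi : Intersective g)
    (hhi : Intersective h) :
    ∃ C₀ : ℕ, 1 ≤ C₀ ∧ ∀ ℓ T Y : ℕ, T = 128 * ℓ →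
      Y = stepY k E ℓ (C₀ * (stepZ E ℓ ^ T) ^ (2 * k + k * l)) →
      ∀ (N : ℕ) (A : Finset ℕ), A ⊆ Finset.range N →
        (∀ a ∈ A, ∀ a' ∈ A, a ≠ a' → ∀ m n : ℕ, 1 ≤ m → 1 ≤ n →
          (a : ℤ) - a' ≠ g.eval (m : ℤ) + h.eval (n : ℤ)) →
        (A.card : ℝ) ≤ (2 ^ ℓ : ℝ)⁻¹ * N + C₀ * (Y : ℝ) ^ T := by
  obtain ⟨C₀, hC₀, hstage⟩ := exists_stage_poly hk hg hl hhi
  set L := (g.coeff k).natAbs with hL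
  refine ⟨C₀ + L, by omega, fun ℓ T Y hT hY N A hAN hA => ?_⟩
  have hlead : g.coeff k ≠ 0 := by
    rw [← hg]
    exact leadingCoeff_ne_zero.mpr hgi.1
  have hLpos : 1 ≤ L := Int.natAbs_pos.mpr hlead
  have hZ1 : 1 ≤ stepZ E ℓ := stepZ_pos E ℓ
  set Z := stepZ E ℓ with hZ
  have hY1 : 1 ≤ Y := by
    rw [hY]
    exact stepY_pos _ _ _ _ (Nat.mul_pos (by omega) (Nat.pow_pos (Nat.pow_pos hZ1)))
  obtain ⟨r, -, hr⟩ := hgi.2 (L * (Z ^ T).factorial ^ k)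
    (Nat.mul_pos hLpos (Nat.pow_pos (Nat.factorial_pos _)))
  have hGdeg : (g.comp (X + C (r : ℤ))).natDegree = k := by
    rw [natDegree_comp, natDegree_X_add_C, mul_one, hg]
  have hGk : (g.comp (X + C (r : ℤ))).coeff k = g.coeff k := by
    have h2 := leadingCoeff_comp (p := g) (q := X + C (r : ℤ)) (by
      rw [natDegree_X_add_C]; exact one_ne_zero)
    rw [leadingCoeff_X_add_C, one_pow, mul_one, leadingCoeff, leadingCoeff, hGdeg, hg] at h2
    exact h2
  set G := g.comp (X + C (r : ℤ)) with hG
  have hGlead : G.coeff k ≠ 0 := by rwa [hGk]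
  have hdvd : ∀ d : ℕ, 1 ≤ d → d ≤ Z ^ T → (dilateGcd G d : ℤ) ∣ g.eval (r : ℤ) := by
    intro d hd hdX
    have h1 := Int.natAbs_dvd_natAbs.mpr (dilateGcd_dvd G d hk)
    rw [Int.natAbs_natCast, Int.natAbs_mul, Int.natAbs_pow, Int.natAbs_natCast, hGk] at h1
    have h2 : dilateGcd G d ∣ L * (Z ^ T).factorial ^ k :=
      h1.trans (mul_dvd_mul_left _ (pow_dvd_pow_of_dvd (Nat.dvd_factorial hd hdX) k))
    exact (Int.natCast_dvd_natCast.mpr h2).trans hr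
  have hD1 : 0 < dilateGcd G 1 := dilateGcd_pos hk hGlead le_rfl
  have hDL : dilateGcd G 1 ≤ L := by
    have h1 := dilateGcd_le hk hGlead le_rfl
    rwa [hGk, one_pow, mul_one] at h1
  have hstage' : ∀ d : ℕ, 1 ≤ d → d ≤ Z ^ T →
      ∃ F : ℤ[X], F.natDegree ≤ k ∧ F.coeff k ≠ 0 ∧
        (∀ e : ℕ, (∀ j, 1 ≤ j → (e : ℤ) ∣ F.coeff j) → e = 1) ∧
        (∀ j, |F.coeff j| ≤ ((C₀ + L) * d ^ (2 * k + k * l) : ℕ)) ∧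
        ∀ x : ℕ, ∃ u v : ℕ, 1 ≤ u ∧ 1 ≤ v ∧
          (dilateGcd G d : ℤ) * F.eval (x : ℤ) = g.eval (u : ℤ) + h.eval (v : ℤ) := by
    intro d hd hdX
    obtain ⟨F, h1, h2, h3, h4, h5⟩ := hstage r d hd (hdvd d hd hdX)
    refine ⟨F, h1, h2, h3, fun j => (h4 j).trans ?_, h5⟩
    exact_mod_cast Nat.mul_le_mul_right _ (Nat.le_add_right C₀ L)
  have hblock : ∀ c : ℕ, (((Finset.range (Y ^ T)).filter fun i =>
      c + dilateGcd G 1 * i ∈ A).card : ℝ) ≤ (2 ^ ℓ : ℝ)⁻¹ * ((Y ^ T : ℕ) : ℝ) := by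
    intro c
    by_contra! hc
    obtain ⟨d, b, -, -, hdb⟩ := exists_dense_progression hW hE hk (l := l) (h := h)
      (by omega : 1 ≤ C₀ + L) hGdeg.le hGlead hstage' hY hA hc le_rfl
    rw [Nat.sub_self, pow_zero, Nat.cast_one, mul_one] at hdb
    have h1 : ((Finset.range 1).filter fun i => b + dilateGcd G d * i ∈ A).card ≤ 1 :=
      (Finset.card_filter_le _ _).trans (by rw [Finset.card_range])
    have h2 : (2 : ℝ) ^ ℓ ≤ (1 + 1 / 128) ^ T := by
      rw [hT, pow_mul]
      refine pow_le_pow_left₀ (by norm_num) ?_ _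
      have h3 := one_add_mul_le_pow (a := (1 / 128 : ℝ)) (by norm_num) 128
      norm_num at h3 ⊢
    have h3 : (1 : ℝ) ≤ (1 + 1 / 128) ^ T * (2 ^ ℓ : ℝ)⁻¹ := by
      rw [← div_eq_mul_inv, le_div_iff₀ (by positivity), one_mul]
      exact h2
    have h4 : (((Finset.range 1).filter fun i => b + dilateGcd G d * i ∈ A).card : ℝ) ≤ 1 := by
      exact_mod_cast h1
    exact absurd (h3.trans_lt hdb) (not_lt.mpr h4)
  have h1 := card_le_of_forall_block hD1 (Nat.pow_pos hY1) (by positivity) hblock N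
  have h2 : ((Finset.range N).filter fun j => j ∈ A) = A := by
    ext a
    rw [Finset.mem_filter]
    exact ⟨fun h => h.2, fun h => ⟨hAN h, h⟩⟩
  rw [h2] at h1
  refine h1.trans (add_le_add le_rfl ?_)
  rw [Nat.cast_pow]
  refine mul_le_mul_of_nonneg_right ?_ (by positivity)
  exact_mod_cast hDL.trans (Nat.le_add_left _ _)

end Iteration

section Growth

/-- `p` is bounded by a polynomial of degree `e`. -/
def PolyBound (e : ℕ) (p : ℕ → ℕ) : Prop := ∃ K, ∀ ℓ, 1 ≤ ℓ → p ℓ ≤ K * ℓ ^ e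

/-- `f` is bounded by the exponential of a polynomial of degree `e`. -/
def ExpBound (e : ℕ) (f : ℕ → ℕ) : Prop := ∃ K, ∀ ℓ, 1 ≤ ℓ → f ℓ ≤ 2 ^ (K * ℓ ^ e)

variable {e e' : ℕ} {p p' f f' : ℕ → ℕ}

lemma polyBound_const (c : ℕ) : PolyBound e fun _ => c :=
  ⟨c, fun _ hℓ => Nat.le_mul_of_pos_right _ (Nat.pow_pos hℓ)⟩

lemma polyBound_id : PolyBound 1 fun ℓ => ℓ :=
  ⟨1, fun ℓ _ => by rw [pow_one, one_mul]⟩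

lemma PolyBound.add (hp : PolyBound e p) (hp' : PolyBound e p') :
    PolyBound e fun ℓ => p ℓ + p' ℓ := by
  obtain ⟨K, hK⟩ := hp
  obtain ⟨K', hK'⟩ := hp'
  exact ⟨K + K', fun ℓ hℓ => (Nat.add_le_add (hK ℓ hℓ) (hK' ℓ hℓ)).trans (add_mul _ _ _).ge⟩

lemma PolyBound.mul (hp : PolyBound e p) (hp' : PolyBound e' p') :
    PolyBound (e + e') fun ℓ => p ℓ * p' ℓ := by
  obtain ⟨K, hK⟩ := hp
  obtain ⟨K', hK'⟩ := hp'
  refine ⟨K * K', fun ℓ hℓ => (Nat.mul_le_mul (hK ℓ hℓ) (hK' ℓ hℓ)).trans (le_of_eq ?_)⟩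
  ring

lemma PolyBound.const_mul (hp : PolyBound e p) (c : ℕ) : PolyBound e fun ℓ => c * p ℓ := by
  simpa only [zero_add] using (polyBound_const (e := 0) c).mul hp

lemma PolyBound.pow (hp : PolyBound e p) (n : ℕ) : PolyBound (e * n) fun ℓ => p ℓ ^ n := by
  obtain ⟨K, hK⟩ := hp
  refine ⟨K ^ n, fun ℓ hℓ => (Nat.pow_le_pow_left (hK ℓ hℓ) n).trans (le_of_eq ?_)⟩
  rw [mul_pow, pow_mul]

lemma ExpBound.mono (hf : ExpBound e f) (he : e ≤ e') : ExpBound e' f := by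
  obtain ⟨K, hK⟩ := hf
  exact ⟨K, fun ℓ hℓ => (hK ℓ hℓ).trans (Nat.pow_le_pow_right two_pos
    (Nat.mul_le_mul_left _ (Nat.pow_le_pow_right hℓ he)))⟩

lemma ExpBound.of_le (hf : ExpBound e f) (h : ∀ ℓ, f' ℓ ≤ f ℓ) : ExpBound e f' := by
  obtain ⟨K, hK⟩ := hf
  exact ⟨K, fun ℓ hℓ => (h ℓ).trans (hK ℓ hℓ)⟩

lemma PolyBound.expBound_two_pow (hp : PolyBound e p) : ExpBound e fun ℓ => 2 ^ p ℓ := by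
  obtain ⟨K, hK⟩ := hp
  exact ⟨K, fun ℓ hℓ => Nat.pow_le_pow_right two_pos (hK ℓ hℓ)⟩

lemma expBound_const (c : ℕ) : ExpBound e fun _ => c :=
  (polyBound_const c).expBound_two_pow.of_le fun _ => Nat.lt_two_pow_self.le

lemma ExpBound.mul (hf : ExpBound e f) (hf' : ExpBound e f') :
    ExpBound e fun ℓ => f ℓ * f' ℓ := by
  obtain ⟨K, hK⟩ := hf
  obtain ⟨K', hK'⟩ := hf'
  refine ⟨K + K', fun ℓ hℓ => (Nat.mul_le_mul (hK ℓ hℓ) (hK' ℓ hℓ)).trans (le_of_eq ?_)⟩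
  rw [← pow_add, add_mul]

lemma ExpBound.add (hf : ExpBound e f) (hf' : ExpBound e f') :
    ExpBound e fun ℓ => f ℓ + f' ℓ := by
  obtain ⟨K, hK⟩ := hf
  obtain ⟨K', hK'⟩ := hf'
  have h : ExpBound e fun ℓ => 2 * (2 ^ (K * ℓ ^ e) * 2 ^ (K' * ℓ ^ e)) :=
    (expBound_const 2).mul (ExpBound.mul ⟨K, fun _ _ => le_rfl⟩ ⟨K', fun _ _ => le_rfl⟩)
  obtain ⟨K₂, hK₂⟩ := h
  refine ⟨K₂, fun ℓ hℓ => le_trans ?_ (hK₂ ℓ hℓ)⟩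
  have h1 := hK ℓ hℓ
  have h2 := hK' ℓ hℓ
  have h3 : 0 < 2 ^ (K * ℓ ^ e) := Nat.pow_pos two_pos
  have h4 : 0 < 2 ^ (K' * ℓ ^ e) := Nat.pow_pos two_pos
  nlinarith

lemma ExpBound.pow (hf : ExpBound e f) (hp : PolyBound e' p) :
    ExpBound (e + e') fun ℓ => f ℓ ^ p ℓ := by
  obtain ⟨K, hK⟩ := hf
  obtain ⟨K', hK'⟩ := hp
  refine ⟨K * K', fun ℓ hℓ => ?_⟩
  calc f ℓ ^ p ℓ ≤ (2 ^ (K * ℓ ^ e)) ^ p ℓ := Nat.pow_le_pow_left (hK ℓ hℓ) _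
    _ ≤ (2 ^ (K * ℓ ^ e)) ^ (K' * ℓ ^ e') :=
      Nat.pow_le_pow_right (Nat.pow_pos two_pos) (hK' ℓ hℓ)
    _ = _ := by
      rw [← pow_mul, pow_add]
      congr 1
      ring

lemma ExpBound.pow_const (hf : ExpBound e f) (n : ℕ) : ExpBound e fun ℓ => f ℓ ^ n :=
  hf.pow (polyBound_const (e := 0) n)

lemma expBound_stepY (k E C₀ m : ℕ) (hE : 1 ≤ E) :
    ExpBound (8 * E + 2) fun ℓ => stepY k E ℓ (C₀ * (stepZ E ℓ ^ (128 * ℓ)) ^ m) := by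
  have hlin : ∀ c : ℕ, PolyBound 1 fun ℓ => ℓ + c := fun c => polyBound_id.add (polyBound_const c)
  have hR : ExpBound 1 stepR := (hlin 4).expBound_two_pow
  have hQ : ExpBound 1 fun ℓ => stepQ E ℓ := hR.pow_const E
  have hlog : PolyBound 1 fun ℓ => Nat.log 2 (stepQ E ℓ) := by
    simp only [log_stepQ]
    exact (hlin 4).mul (polyBound_const (e := 0) E)
  have hK : PolyBound 1 fun ℓ => stepK E ℓ := hlin (8 * E)
  have hW : ExpBound (8 * E + 1) fun ℓ => stepW E ℓ := by
    have h1 : PolyBound (8 * E) fun ℓ => (8 * stepK E ℓ) ^ (8 * E) := by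
      simpa only [one_mul] using (hK.const_mul 8).pow (8 * E)
    have h2 := hQ.pow h1
    exact (h2.of_le fun ℓ => smoothMod_le (Nat.pow_pos (Nat.pow_pos two_pos))).mono (by omega)
  have hZ : ExpBound (8 * E + 1) fun ℓ => stepZ E ℓ :=
    hW.mul ((hQ.pow hlog).mono (by omega))
  have hB : ExpBound (8 * E + 2) fun ℓ => stepB E ℓ := by
    have h1 : PolyBound 2 fun ℓ => 2 * stepK E ℓ * ℓ := (hK.const_mul 2).mul polyBound_id
    have h2 : PolyBound 2 fun ℓ => 2 * Nat.log 2 (stepQ E ℓ) * (2 * stepK E ℓ + 1) :=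
      (hlog.const_mul 2).mul ((hK.const_mul 2).add (polyBound_const 1))
    exact ((expBound_const 16).mul (h1.expBound_two_pow.mono (by omega))).mul
      (((hQ.add (expBound_const 1)).pow h2).mono (by omega))
  have hH : ExpBound (8 * E + 2) fun ℓ => C₀ * (stepZ E ℓ ^ (128 * ℓ)) ^ m :=
    (expBound_const C₀).mul ((hZ.pow (polyBound_id.const_mul 128)).pow_const m)
  have h2 : ExpBound (8 * E + 2) fun ℓ => 2 ^ ℓ := polyBound_id.expBound_two_pow.mono (by omega)
  have h4 : ExpBound (8 * E + 2) fun ℓ => 4 ^ ℓ :=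
    ((expBound_const (e := 0) 4).pow polyBound_id).mono (by omega)
  have hM : ExpBound (8 * E + 2)
      fun ℓ => stepM k E ℓ (C₀ * (stepZ E ℓ ^ (128 * ℓ)) ^ m) :=
    ((((expBound_const 2).mul ((hR.pow_const (3 * E)).mono (by omega))).mul
      (hH.pow_const 2)).add (expBound_const 1)).add ((expBound_const (4 * k)).mul h2)
  have hW' := hW.mono (e' := 8 * E + 2) (by omega)
  have hZ' := hZ.mono (e' := 8 * E + 2) (by omega)
  have hQ' := hQ.mono (e' := 8 * E + 2) (by omega)
  exact (((hZ'.pow_const k).mul (expBound_const 128)).mul h2).mul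
    (((((((expBound_const 128).mul h4).mul hW').mul hB).mul (hQ'.pow_const 2)).mul
      ((expBound_const (64 * (k + 1))).mul hH)).mul (expBound_const (2 ^ k)) |>.mul
      ((expBound_const 16).mul (hM.pow_const k)))

end Growth

lemma WeylInverse.mono {n E E' : ℕ} (h : WeylInverse n E) (hE : E ≤ E') : WeylInverse n E' := by
  intro P hP R hR M hM hsum
  obtain ⟨b, hb, hbR, hc⟩ := h P hP R hR M hM hsum
  have h1 : R ^ E ≤ R ^ E' := pow_le_pow_right₀ (by linarith) hE
  refine ⟨b, hb, hbR.trans h1, fun j hj => ?_⟩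
  obtain ⟨a, ha⟩ := hc j hj
  exact ⟨a, ha.trans h1⟩

/-- Optimising the parameter `ℓ` in a bound `2^{-ℓ} (N + 1 + 2 ^ (K ℓ ^ e))`. -/
lemma exists_exp_bound {e : ℕ} (he : 1 ≤ e) (K : ℕ) (hK : 1 ≤ K) :
    ∃ c C : ℝ, 0 < c ∧ 0 < C ∧ ∀ N : ℕ, 1 ≤ N → ∀ x : ℝ, x ≤ N →
      (∀ ℓ : ℕ, 1 ≤ ℓ → x ≤ (2 ^ ℓ : ℝ)⁻¹ * (N + 1 + 2 ^ (K * ℓ ^ e))) →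
      x ≤ C * N * Real.exp (-c * Real.log N ^ (1 / (e : ℝ))) := by
  have hlog2 : 0 < Real.log 2 := Real.log_pos one_lt_two
  have hKR : (1 : ℝ) ≤ K := by exact_mod_cast hK
  have hKl : 0 < K * Real.log 2 := by positivity
  set c' : ℝ := ((K * Real.log 2) ^ (1 / (e : ℝ)))⁻¹ with hc'
  have hc'pos : 0 < c' := inv_pos.mpr (Real.rpow_pos_of_pos hKl _)
  refine ⟨Real.log 2 * c', 6, by positivity, by norm_num, fun N hN x hxN hx => ?_⟩
  have hNR : (1 : ℝ) ≤ N := by exact_mod_cast hN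
  have hlogN : 0 ≤ Real.log N := Real.log_nonneg hNR
  set y : ℝ := c' * Real.log N ^ (1 / (e : ℝ)) with hy
  have hy0 : 0 ≤ y := by positivity
  have hye : y ^ e * (K * Real.log 2) = Real.log N := by
    have hpow : ∀ z : ℝ, 0 ≤ z → (z ^ (1 / (e : ℝ))) ^ e = z := fun z hz => by
      rw [one_div]
      exact Real.rpow_inv_natCast_pow hz (by omega)
    rw [hy, hc', mul_pow, inv_pow, hpow _ hKl.le, hpow _ hlogN]
    field_simp
  have hexp : Real.exp (-(Real.log 2 * c') * Real.log N ^ (1 / (e : ℝ))) = (2 : ℝ) ^ (-y) := by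
    rw [Real.rpow_def_of_pos two_pos, hy]
    congr 1
    ring
  rw [hexp]
  rcases lt_or_ge y 1 with h1 | h1
  · have h2 : (2 : ℝ) ^ (-1 : ℝ) ≤ 2 ^ (-y) :=
      Real.rpow_le_rpow_of_exponent_le one_le_two (by linarith)
    rw [Real.rpow_neg_one] at h2
    nlinarith
  · set ℓ := ⌊y⌋₊ with hℓ
    have hℓ1 : 1 ≤ ℓ := (Nat.one_le_floor_iff y).mpr h1
    have hℓy : (ℓ : ℝ) ≤ y := Nat.floor_le hy0
    have hyℓ : y < ℓ + 1 := Nat.lt_floor_add_one y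
    have h2 : (2 : ℝ) ^ (K * ℓ ^ e) ≤ N := by
      have h3 : Real.log ((2 : ℝ) ^ (K * ℓ ^ e)) ≤ Real.log N := by
        rw [Real.log_pow, ← hye]
        push_cast
        have h4 : (ℓ : ℝ) ^ e ≤ y ^ e := pow_le_pow_left₀ (Nat.cast_nonneg _) hℓy e
        calc (K : ℝ) * ℓ ^ e * Real.log 2 = ℓ ^ e * (K * Real.log 2) := by ring
          _ ≤ _ := mul_le_mul_of_nonneg_right h4 hKl.le
      exact (Real.log_le_log_iff (by positivity) (by linarith)).mp h3
    have h3 : (2 ^ ℓ : ℝ)⁻¹ ≤ 2 * (2 : ℝ) ^ (-y) := by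
      have h4 : (2 : ℝ) ^ (-(ℓ : ℝ)) ≤ 2 ^ (1 + -y) :=
        Real.rpow_le_rpow_of_exponent_le one_le_two (by linarith)
      rwa [Real.rpow_neg two_pos.le, Real.rpow_natCast, Real.rpow_add two_pos,
        Real.rpow_one] at h4
    calc x ≤ (2 ^ ℓ : ℝ)⁻¹ * (N + 1 + 2 ^ (K * ℓ ^ e)) := hx ℓ hℓ1
      _ ≤ (2 * (2 : ℝ) ^ (-y)) * (3 * N) :=
        mul_le_mul h3 (by linarith) (by positivity) (by positivity)
      _ = _ := by ring

/-- For all degrees `k, ℓ ≥ 1` there is `μ = μ(k,ℓ) > 0` such that: for any nonzero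
intersective `g, h ∈ ℤ[x]` of degrees `k, ℓ`, there are `c, C > 0` with the property that
any `A ⊆ {1,…,N}` with no difference of distinct elements of the form `g(m)+h(n)`,
`m, n ≥ 1`, satisfies `|A| ≤ C · N · exp(-c (log N)^μ)`. -/
theorem sum_of_two_intersective_polys
    (k l : ℕ) (hk : 0 < k) (hl : 0 < l) :
    ∃ μ : ℝ, 0 < μ ∧
      ∀ g h : Polynomial ℤ, Intersective g → Intersective h →
        g.natDegree = k → h.natDegree = l →
        ∃ c C : ℝ, 0 < c ∧ 0 < C ∧
          ∀ N : ℕ, 2 ≤ N → ∀ A : Finset ℕ, A ⊆ Finset.Icc 1 N →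
            (∀ a ∈ A, ∀ a' ∈ A, a ≠ a' → ∀ m n : ℕ, 1 ≤ m → 1 ≤ n →
              (a : ℤ) - (a' : ℤ) ≠ g.eval (m : ℤ) + h.eval (n : ℤ)) →
            (A.card : ℝ) ≤ C * N * Real.exp (-c * Real.log N ^ μ) := by
  obtain ⟨k, rfl⟩ := Nat.exists_eq_add_of_le' hk
  obtain ⟨E₀, hE₀⟩ := exists_weylInverse k
  set E := E₀ + 1 with hEdef
  have hE : 1 ≤ E := Nat.le_add_left 1 E₀
  have hW : WeylInverse (k + 1) E := hE₀.mono (Nat.le_succ E₀)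
  refine ⟨1 / ((8 * E + 3 : ℕ) : ℝ), by positivity, fun g h hg hh hgk hhl => ?_⟩
  obtain ⟨C₀, -, hcard⟩ := card_le_of_no_differences hW hE hk hgk hhl hg hh
  have hgrow : ExpBound (8 * E + 3) fun ℓ => 2 ^ ℓ * (C₀ *
      stepY (k + 1) E ℓ (C₀ * (stepZ E ℓ ^ (128 * ℓ)) ^ (2 * (k + 1) + (k + 1) * l)) ^
        (128 * ℓ)) :=
    (polyBound_id.expBound_two_pow.mono (by omega)).mul ((expBound_const C₀).mul
      ((expBound_stepY (k + 1) E C₀ _ hE).pow (polyBound_id.const_mul 128)))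
  obtain ⟨K, hK⟩ := hgrow
  obtain ⟨c, C, hc, hC, hcC⟩ :=
    exists_exp_bound (Nat.le_add_left 1 (8 * E + 2)) (K + 1) (Nat.le_add_left 1 K)
  refine ⟨c, C, hc, hC, fun N hN A hAN hA => hcC N (by omega) _ ?_ fun ℓ hℓ => ?_⟩
  · have h1 := Finset.card_le_card hAN
    rw [Nat.card_Icc, Nat.add_sub_cancel] at h1
    exact_mod_cast h1
  · have hAr : A ⊆ Finset.range (N + 1) := fun a ha => by
      rw [Finset.mem_range]
      have h1 := (Finset.mem_Icc.mp (hAN ha)).2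
      omega
    have h1 := hcard ℓ _ _ rfl rfl (N + 1) A hAr hA
    have h2 := (hK ℓ hℓ).trans (Nat.pow_le_pow_right two_pos
      (Nat.mul_le_mul_right (ℓ ^ (8 * E + 3)) (Nat.le_succ K)))
    have h3 := (Nat.cast_le (α := ℝ)).mpr h2
    push_cast at h1 h3
    refine h1.trans ?_
    have h4 : (0 : ℝ) < 2 ^ ℓ := by positivity
    rw [mul_add (2 ^ ℓ : ℝ)⁻¹ ((N : ℝ) + 1)]
    refine add_le_add le_rfl ?_
    rw [inv_mul_eq_div, le_div_iff₀ h4, mul_comm]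
    exact h3
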